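/- Let γ : ℝ × (-∞,0] → ℝ² be an ancient complete non-compact embedded smooth curve shortening flow whose entropy equals a positive integer m. Then for every x₀ ∈ ℝ² and every t ≤ 0, the set of local minimum points of the function u ↦ |γ(u,t) - x₀|² has at most m elements, and the set of local maximum points of this function has at most m - 1 elements. -/

import Mathlib

open Real MeasureTheory Set Filter
open scoped RealInnerProductSpace ENNReal

noncomputable section

/-- The Euclidean plane. -/
abbrev R2 := EuclideanSpace ℝ (Fin 2)

/-- The point of `ℝ²` with coordinates `(x, y)`. -/
def toR2 (x y : ℝ) : R2 := (WithLp.equiv 2 (Fin 2 → ℝ)).symm ![x, y]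

/-- Counterclockwise rotation of the plane by `π/2`. -/
def Jrot (v : R2) : R2 := toR2 (-(v 1)) (v 0)

/-- Arclength derivative `∂ₛ := |∂ᵤγ|⁻¹ ∂ᵤ` along the time-`t` curve of the flow `γ`,
applied to a function `f` of `(u, t)`. -/
def aderiv (γ : ℝ → ℝ → R2) {F : Type} [NormedAddCommGroup F] [NormedSpace ℝ F]
    (f : ℝ → ℝ → F) (u t : ℝ) : F :=
  ‖deriv (fun v => γ v t) u‖⁻¹ • deriv (fun v => f v t) u

/-- The unit tangent `T = ∂ᵤγ / |∂ᵤγ|`. -/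
def unitT (γ : ℝ → ℝ → R2) (u t : ℝ) : R2 := aderiv γ γ u t

/-- The unit normal `n = J T`. -/
def unitN (γ : ℝ → ℝ → R2) (u t : ℝ) : R2 := Jrot (unitT γ u t)

/-- The signed curvature `κ = ⟨∂ₛT, n⟩`. -/
def curv (γ : ℝ → ℝ → R2) (u t : ℝ) : ℝ := ⟪aderiv γ (unitT γ) u t, unitN γ u t⟫

/-- `γ : ℝ × I → ℝ²` is a smooth curve shortening flow in fixed-parametrization form:
smooth, regular (`∂ᵤγ ≠ 0`), and `∂ₜγ = ∂ₛ(∂ₛγ)` (time derivative taken within `I`). -/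
structure IsCSF (γ : ℝ → ℝ → R2) (I : Set ℝ) : Prop where
  smooth : ContDiffOn ℝ (⊤ : ℕ∞) (fun p : ℝ × ℝ => γ p.1 p.2) (univ ×ˢ I)
  regular : ∀ (u : ℝ), ∀ t ∈ I, deriv (fun v => γ v t) u ≠ 0
  flow : ∀ (u : ℝ), ∀ t ∈ I, derivWithin (fun s => γ u s) I t = aderiv γ (aderiv γ γ) u t

/-- The Gaussian weighted length `F_{x₀,l}` of the time-`t` curve (as an extended real). -/
def gaussLenE (γ : ℝ → ℝ → R2) (x₀ : R2) (l t : ℝ) : ℝ≥0∞ :=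
  (ENNReal.ofReal (Real.sqrt (4 * π * l)))⁻¹ *
    ∫⁻ u : ℝ, ENNReal.ofReal
      (Real.exp (-‖γ u t - x₀‖ ^ 2 / (4 * l)) * ‖deriv (fun v => γ v t) u‖)

/-- The total curvature of the time-`t` curve (as an extended real). -/
def totalCurvE (γ : ℝ → ℝ → R2) (t : ℝ) : ℝ≥0∞ :=
  ∫⁻ u : ℝ, ENNReal.ofReal (|curv γ u t| * ‖deriv (fun v => γ v t) u‖)

/-- The entropy of the flow: the supremum of the Gaussian weighted lengths over all
times `t ∈ I`, centers `x₀ ∈ ℝ²` and scales `l > 0`. -/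
def entropyE (γ : ℝ → ℝ → R2) (I : Set ℝ) : ℝ≥0∞ :=
  ⨆ t ∈ I, ⨆ x₀ : R2, ⨆ l ∈ Ioi (0:ℝ), gaussLenE γ x₀ l t


/-- Abstract data of a flow (spatial identities for all `t`, evolution for `t ≤ 0`). -/
structure CFlow where
  X : ℝ → ℝ → ℝ
  Y : ℝ → ℝ → ℝ
  g : ℝ → ℝ → ℝ
  c : ℝ → ℝ → ℝ
  s : ℝ → ℝ → ℝ
  k : ℝ → ℝ → ℝ
  gu : ℝ → ℝ → ℝ
  M : ℝ
  contX : Continuous (fun p : ℝ × ℝ => X p.1 p.2)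
  contY : Continuous (fun p : ℝ × ℝ => Y p.1 p.2)
  contg : Continuous (fun p : ℝ × ℝ => g p.1 p.2)
  contc : Continuous (fun p : ℝ × ℝ => c p.1 p.2)
  conts : Continuous (fun p : ℝ × ℝ => s p.1 p.2)
  contk : Continuous (fun p : ℝ × ℝ => k p.1 p.2)
  contgu : Continuous (fun p : ℝ × ℝ => gu p.1 p.2)
  gpos : ∀ u t, 0 < g u t
  cs : ∀ u t, c u t ^ 2 + s u t ^ 2 = 1
  Xu : ∀ u t, HasDerivAt (fun v => X v t) (g u t * c u t) u
  Yu : ∀ u t, HasDerivAt (fun v => Y v t) (g u t * s u t) u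
  cu : ∀ u t, HasDerivAt (fun v => c v t) (-(k u t * g u t * s u t)) u
  su : ∀ u t, HasDerivAt (fun v => s v t) (k u t * g u t * c u t) u
  guu : ∀ u t, HasDerivAt (fun v => g v t) (gu u t) u
  Xt : ∀ u t, t ≤ 0 → HasDerivWithinAt (fun r => X u r) (-(k u t * s u t)) (Iic 0) t
  Yt : ∀ u t, t ≤ 0 → HasDerivWithinAt (fun r => Y u r) (k u t * c u t) (Iic 0) t
  gt : ∀ u t, t < 0 → HasDerivAt (fun r => g u r) (-(k u t ^ 2 * g u t)) t
  proper : ∀ t, t ≤ 0 → ∀ R : ℝ, ∃ U : ℝ, ∀ u, U ≤ |u| → R ≤ X u t ^ 2 + Y u t ^ 2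
  ent : ∀ t, t ≤ 0 → ∀ l : ℝ, 0 < l → ∀ a b : ℝ, a ≤ b →
    ∫ u in a..b, Real.exp (-(X u t ^ 2 + Y u t ^ 2) / (4 * l)) * g u t ≤ M * √(4 * π * l)

namespace CFlow
variable (Γ : CFlow)

def q (u t : ℝ) : ℝ := Γ.X u t ^ 2 + Γ.Y u t ^ 2
def S (u t : ℝ) : ℝ := Γ.X u t * Γ.c u t + Γ.Y u t * Γ.s u t
def p (u t : ℝ) : ℝ := -(Γ.X u t * Γ.s u t) + Γ.Y u t * Γ.c u t

theorem contq : Continuous (fun p : ℝ × ℝ => Γ.q p.1 p.2) :=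
  (Γ.contX.pow 2).add (Γ.contY.pow 2)
theorem contS : Continuous (fun p : ℝ × ℝ => Γ.S p.1 p.2) :=
  (Γ.contX.mul Γ.contc).add (Γ.contY.mul Γ.conts)
theorem contp : Continuous (fun p : ℝ × ℝ => Γ.p p.1 p.2) :=
  (Γ.contX.mul Γ.conts).neg.add (Γ.contY.mul Γ.contc)

theorem q_nonneg (u t : ℝ) : 0 ≤ Γ.q u t := by unfold q; positivity

theorem Sp (u t : ℝ) : Γ.S u t ^ 2 + Γ.p u t ^ 2 = Γ.q u t := by
  have := Γ.cs u t
  unfold S p q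
  linear_combination (Γ.X u t ^ 2 + Γ.Y u t ^ 2) * this

theorem qu (u t : ℝ) : HasDerivAt (fun v => Γ.q v t) (2 * (Γ.g u t * Γ.S u t)) u := by
  have := ((Γ.Xu u t).fun_pow 2).fun_add ((Γ.Yu u t).fun_pow 2)
  unfold q S
  refine this.congr_deriv ?_
  push_cast; ring

theorem Su (u t : ℝ) : HasDerivAt (fun v => Γ.S v t) (Γ.g u t * (1 + Γ.k u t * Γ.p u t)) u := by
  have := ((Γ.Xu u t).fun_mul (Γ.cu u t)).fun_add ((Γ.Yu u t).fun_mul (Γ.su u t))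
  unfold S p
  refine this.congr_deriv ?_
  linear_combination Γ.g u t * Γ.cs u t

theorem pu (u t : ℝ) : HasDerivAt (fun v => Γ.p v t) (-(Γ.k u t * Γ.g u t * Γ.S u t)) u := by
  have := ((Γ.Xu u t).fun_mul (Γ.su u t)).fun_neg.fun_add ((Γ.Yu u t).fun_mul (Γ.cu u t))
  unfold S p
  refine this.congr_deriv ?_
  ring

theorem qt (u t : ℝ) (ht : t ≤ 0) :
    HasDerivWithinAt (fun r => Γ.q u r) (2 * (Γ.k u t * Γ.p u t)) (Iic 0) t := by
  have := ((Γ.Xt u t ht).fun_pow 2).fun_add ((Γ.Yt u t ht).fun_pow 2)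
  unfold q p
  refine this.congr_deriv ?_
  push_cast; ring

theorem qt' (u t : ℝ) (ht : t < 0) :
    HasDerivAt (fun r => Γ.q u r) (2 * (Γ.k u t * Γ.p u t)) t :=
  (Γ.qt u t ht.le).hasDerivAt (Iic_mem_nhds ht)

theorem S_abs (u t : ℝ) : |Γ.S u t| ≤ √(Γ.q u t) := by
  apply Real.abs_le_sqrt
  have := Γ.Sp u t
  nlinarith [sq_nonneg (Γ.p u t)]

theorem p_abs (u t : ℝ) : |Γ.p u t| ≤ √(Γ.q u t) := by
  apply Real.abs_le_sqrt
  have := Γ.Sp u t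
  nlinarith [sq_nonneg (Γ.S u t)]

theorem ent' (t : ℝ) (ht : t ≤ 0) (l : ℝ) (hl : 0 < l) (a b : ℝ) (hab : a ≤ b) :
    ∫ u in a..b, Real.exp (-(Γ.q u t) / (4 * l)) * Γ.g u t ≤ Γ.M * √(4 * π * l) :=
  Γ.ent t ht l hl a b hab

theorem M_nonneg : 0 ≤ Γ.M := by
  have := Γ.ent' 0 le_rfl 1 one_pos 0 0 le_rfl
  simp only [intervalIntegral.integral_same] at this
  exact nonneg_of_mul_nonneg_left this (by positivity)

theorem slice (f : ℝ × ℝ → ℝ) (h : Continuous f) (t : ℝ) : Continuous (fun u => f (u, t)) :=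
  h.comp (by fun_prop)
theorem cq (t : ℝ) : Continuous (fun u => Γ.q u t) := slice _ Γ.contq t
theorem cS (t : ℝ) : Continuous (fun u => Γ.S u t) := slice _ Γ.contS t
theorem cp (t : ℝ) : Continuous (fun u => Γ.p u t) := slice _ Γ.contp t
theorem cg (t : ℝ) : Continuous (fun u => Γ.g u t) := slice _ Γ.contg t
theorem ck (t : ℝ) : Continuous (fun u => Γ.k u t) := slice _ Γ.contk t
theorem cgu (t : ℝ) : Continuous (fun u => Γ.gu u t) := slice _ Γ.contgu t
end CFlow

/-- Differentiation under the integral sign. -/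
theorem dui (P P' : ℝ → ℝ → ℝ) (hP : ∀ t < 0, Continuous fun u => P u t)
    (hP' : ContinuousOn (fun x : ℝ × ℝ => P' x.1 x.2) (univ ×ˢ Iio 0))
    (hd : ∀ u, ∀ t < 0, HasDerivAt (fun r => P u r) (P' u t) t) (a b t : ℝ) (ht : t < 0) :
    HasDerivAt (fun r => ∫ u in a..b, P u r) (∫ u in a..b, P' u t) t := by
  have hcpt : IsCompact (uIcc a b ×ˢ Icc (2 * t) (t / 2)) := isCompact_uIcc.prod isCompact_Icc
  obtain ⟨C, hC⟩ := hcpt.exists_bound_of_continuousOn (hP'.mono (by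
    rintro ⟨x, y⟩ ⟨_, hy⟩
    simp only [mem_Icc] at hy
    simp only [mem_prod, mem_univ, mem_Iio, true_and]; linarith [hy.2]))
  have hc : Continuous fun u => P' u t := by
    rw [← continuousOn_univ]
    exact hP'.comp (f := fun u : ℝ => (u, t)) (by fun_prop) (by intro x _; simp [ht])
  refine (intervalIntegral.hasDerivAt_integral_of_dominated_loc_of_deriv_le (μ := volume)
    (F := fun r u => P u r) (F' := fun r u => P' u r) (bound := fun _ => C)
    (s := Ioo (2 * t) (t / 2)) (Ioo_mem_nhds (by linarith) (by linarith)) ?_ ?_ ?_ ?_ ?_ ?_).2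
  · filter_upwards [Iio_mem_nhds ht] with r hr
    exact (hP r hr).aestronglyMeasurable
  · exact (hP t ht).intervalIntegrable _ _
  · exact hc.aestronglyMeasurable
  · refine Eventually.of_forall fun u hu r hr => ?_
    exact hC (u, r) ⟨uIoc_subset_uIcc hu, hr.1.le, hr.2.le⟩
  · exact intervalIntegrable_const
  · refine Eventually.of_forall fun u hu r hr => hd u r (by linarith [hr.2])

theorem hasDerivAt_maxpow (n : ℕ) (y : ℝ) :
    HasDerivAt (fun y : ℝ => max y 0 ^ (n + 2)) ((n + 2) * max y 0 ^ (n + 1)) y := by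
  rcases lt_trichotomy y 0 with h | h | h
  · have : (fun y : ℝ => max y 0 ^ (n + 2)) =ᶠ[nhds y] fun _ => 0 := by
      filter_upwards [Iio_mem_nhds h] with z hz
      rw [max_eq_right (le_of_lt hz)]; simp
    rw [max_eq_right h.le]
    simpa using (hasDerivAt_const y (0:ℝ)).congr_of_eventuallyEq this
  · subst h
    rw [hasDerivAt_iff_isLittleO_nhds_zero]
    simp only [zero_add, max_self, ne_eq, Nat.add_eq_zero_iff, OfNat.ofNat_ne_zero, and_false,
      not_false_eq_true, zero_pow, sub_zero, one_ne_zero, mul_zero, smul_zero]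
    have : (fun h : ℝ => max h 0 ^ (n + 2)) =O[nhds 0] fun h => h ^ (n + 2) := by
      refine Asymptotics.IsBigO.of_bound 1 (Eventually.of_forall fun h => ?_)
      rw [norm_pow, norm_pow, one_mul]
      gcongr
      rw [Real.norm_eq_abs, Real.norm_eq_abs, abs_of_nonneg (le_max_right _ _)]
      exact max_le (le_abs_self h) (abs_nonneg h)
    refine this.trans_isLittleO ?_
    exact Asymptotics.isLittleO_pow_id (by omega)
  · have : (fun y : ℝ => max y 0 ^ (n + 2)) =ᶠ[nhds y] fun y => y ^ (n + 2) := by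
      filter_upwards [Ioi_mem_nhds h] with z hz
      rw [max_eq_left (le_of_lt hz)]
    rw [max_eq_left h.le]
    refine ((hasDerivAt_pow (n + 2) y).congr_of_eventuallyEq this).congr_deriv ?_
    push_cast; simp

namespace CFlow
variable (Γ : CFlow)

def psi (A u t : ℝ) : ℝ := max (A - Γ.q u t) 0 ^ 2

theorem contpsi (A : ℝ) : Continuous (fun x : ℝ × ℝ => Γ.psi A x.1 x.2) := by
  unfold psi
  have := Γ.contq
  fun_prop

def psiT (A u t : ℝ) : ℝ :=
  -(Γ.k u t ^ 2 * Γ.g u t) * Γ.psi A u t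
    + Γ.g u t * (2 * max (A - Γ.q u t) 0 * (-(2 * (Γ.k u t * Γ.p u t))))

theorem psi_t (A u t : ℝ) (ht : t < 0) :
    HasDerivAt (fun r => Γ.g u r * Γ.psi A u r) (Γ.psiT A u t) t := by
  have h1 := (hasDerivAt_maxpow 0 (A - Γ.q u t)).comp t ((Γ.qt' u t ht).const_sub A)
  have h2 := (Γ.gt u t ht).fun_mul h1
  refine h2.congr_deriv ?_
  unfold psiT psi
  simp

theorem psiT_le (A : ℝ) (hA : 0 < A) (u t : ℝ) :
    Γ.psiT A u t ≤ 4 * A * Real.exp (1 / 4) * (Real.exp (-(Γ.q u t) / (4 * A)) * Γ.g u t) := by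
  have hg := Γ.gpos u t
  unfold psiT psi
  rcases le_total (A - Γ.q u t) 0 with h | h
  · rw [max_eq_right h]
    simp only [ne_eq, OfNat.ofNat_ne_zero, not_false_eq_true, zero_pow, mul_zero, zero_mul, add_zero]
    positivity
  · rw [max_eq_left h]
    have h1 : Real.exp (-(Γ.q u t) / (4 * A)) ≥ Real.exp (-(1/4)) := by
      apply Real.exp_le_exp.2
      rw [le_div_iff₀ (by positivity)]
      linarith
    have h2 : Real.exp (1/4) * Real.exp (-(1/4)) = 1 := by rw [← Real.exp_add]; simp
    have h3 : 1 ≤ Real.exp (1 / 4) * Real.exp (-(Γ.q u t) / (4 * A)) := by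
      refine h2.symm.le.trans ?_
      gcongr
    have h4 : Γ.p u t ^ 2 ≤ A := by
      have := Γ.Sp u t
      nlinarith [sq_nonneg (Γ.S u t)]
    have h5 : -(Γ.k u t ^ 2 * Γ.g u t) * (A - Γ.q u t) ^ 2
        + Γ.g u t * (2 * (A - Γ.q u t) * (-(2 * (Γ.k u t * Γ.p u t)))) ≤ 4 * A * Γ.g u t := by
      nlinarith [mul_nonneg hg.le (sq_nonneg (Γ.k u t * (A - Γ.q u t) + 2 * Γ.p u t)),
        mul_le_mul_of_nonneg_left h4 hg.le]
    calc _ ≤ 4 * A * Γ.g u t := h5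
      _ = 4 * A * Γ.g u t * 1 := by ring
      _ ≤ 4 * A * Γ.g u t * (Real.exp (1 / 4) * Real.exp (-(Γ.q u t) / (4 * A))) := by gcongr
      _ = _ := by ring

theorem contpsiT (A : ℝ) : Continuous (fun x : ℝ × ℝ => Γ.psiT A x.1 x.2) := by
  unfold psiT
  have := Γ.contq
  have := Γ.contk
  have := Γ.contg
  have := Γ.contp
  have := Γ.contpsi A
  fun_prop

/-- growth of the cutoff mass -/
theorem psi_growth (A : ℝ) (hA : 0 < A) (a b : ℝ) (hab : a ≤ b) (t₀ t : ℝ) (h : t₀ ≤ t) (ht : t ≤ 0)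
    (h0 : ∀ u ∈ Icc a b, A ≤ Γ.q u t₀) :
    ∫ u in a..b, Γ.g u t * Γ.psi A u t ≤
      4 * A * Real.exp (1 / 4) * (Γ.M * √(4 * π * A)) * (t - t₀) := by
  have hz : ∫ u in a..b, Γ.g u t₀ * Γ.psi A u t₀ = 0 := by
    rw [intervalIntegral.integral_congr (g := fun _ => 0)]
    · simp
    · intro u hu
      rw [uIcc_of_le hab] at hu
      simp only [psi]
      rw [max_eq_right (by linarith [h0 u hu])]; simp
  rcases h.eq_or_lt with rfl | h
  · rw [hz]; simp
  have hcont : Continuous (fun x : ℝ × ℝ => Γ.g x.1 x.2 * Γ.psi A x.1 x.2) :=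
    Γ.contg.mul (Γ.contpsi A)
  have hE : Continuous (fun r => ∫ u in a..b, Γ.g u r * Γ.psi A u r) :=
    intervalIntegral.continuous_parametric_intervalIntegral_of_continuous'
      (f := fun r u => Γ.g u r * Γ.psi A u r) (hcont.comp (by fun_prop : Continuous fun x : ℝ × ℝ => (x.2, x.1))) a b
  have hd : ∀ r < 0, HasDerivAt (fun r => ∫ u in a..b, Γ.g u r * Γ.psi A u r)
      (∫ u in a..b, Γ.psiT A u r) r := fun r hr =>
    dui (fun u r => Γ.g u r * Γ.psi A u r) (Γ.psiT A) (fun t _ => slice _ hcont t)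
      (Γ.contpsiT A).continuousOn (fun u t ht => Γ.psi_t A u t ht) a b r hr
  obtain ⟨r, hr, hr'⟩ := exists_hasDerivAt_eq_slope (fun r => ∫ u in a..b, Γ.g u r * Γ.psi A u r)
    (fun r => ∫ u in a..b, Γ.psiT A u r) h hE.continuousOn (fun x hx => hd x (by linarith [hx.2]))
  have hr0 : r < 0 := by linarith [hr.2]
  rw [hz, sub_zero, eq_div_iff (by linarith)] at hr'
  rw [← hr']
  have hI : ∫ u in a..b, Γ.psiT A u r ≤
      4 * A * Real.exp (1 / 4) * (Γ.M * √(4 * π * A)) := by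
    calc _ ≤ ∫ u in a..b, 4 * A * Real.exp (1 / 4) * (Real.exp (-(Γ.q u r) / (4 * A)) * Γ.g u r) := by
          apply intervalIntegral.integral_mono_on hab
          · exact (slice _ (Γ.contpsiT A) r).intervalIntegrable _ _
          · have := Γ.cq r
            have := Γ.cg r
            apply Continuous.intervalIntegrable
            fun_prop
          · intro u _; exact Γ.psiT_le A hA u r
      _ = 4 * A * Real.exp (1 / 4) * ∫ u in a..b, (Real.exp (-(Γ.q u r) / (4 * A)) * Γ.g u r) := by
          rw [intervalIntegral.integral_const_mul]
      _ ≤ _ := by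
          gcongr
          exact Γ.ent' r hr0.le A hA a b hab
  gcongr

/-- pointwise bound from the mass -/
theorem psi_point (A : ℝ) (a b : ℝ) (t u : ℝ) (hu : u ∈ Icc a b)
    (hend : A ≤ Γ.q a t ∨ A ≤ Γ.q b t) :
    max (A - Γ.q u t) 0 ^ 3 ≤ 6 * √A * ∫ v in a..b, Γ.g v t * Γ.psi A v t := by
  have hab : a ≤ b := hu.1.trans hu.2
  have hcont : Continuous fun v => Γ.g v t * Γ.psi A v t := (Γ.cg t).mul (slice _ (Γ.contpsi A) t)
  have hnn : ∀ v, 0 ≤ Γ.g v t * Γ.psi A v t := fun v =>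
    mul_nonneg (Γ.gpos v t).le (by unfold psi; positivity)
  have hd : ∀ v, HasDerivAt (fun v => max (A - Γ.q v t) 0 ^ 3)
      (3 * max (A - Γ.q v t) 0 ^ 2 * (-(2 * (Γ.g v t * Γ.S v t)))) v := fun v => by
    have h1 := (hasDerivAt_maxpow 1 (A - Γ.q v t)).comp v ((Γ.qu v t).const_sub A)
    refine h1.congr_deriv ?_
    norm_num
  have hdc : Continuous fun v => (3 * max (A - Γ.q v t) 0 ^ 2 * (-(2 * (Γ.g v t * Γ.S v t)))) := by
    have := Γ.cq t
    have := Γ.cg t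
    have := Γ.cS t
    fun_prop
  have hb : ∀ v, |3 * max (A - Γ.q v t) 0 ^ 2 * (-(2 * (Γ.g v t * Γ.S v t)))|
      ≤ 6 * √A * (Γ.g v t * Γ.psi A v t) := fun v => by
    unfold psi
    rcases le_total (A - Γ.q v t) 0 with h | h
    · rw [max_eq_right h]; simp
    · rw [max_eq_left h]
      have h1 : |Γ.S v t| ≤ √A := (Γ.S_abs v t).trans (Real.sqrt_le_sqrt (by linarith))
      rw [abs_mul, abs_neg, abs_mul, abs_mul, abs_mul, abs_of_pos (Γ.gpos v t), abs_of_nonneg (by positivity : (0:ℝ) ≤ (A - Γ.q v t)^2)]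
      norm_num
      have := mul_le_mul_of_nonneg_left h1 (mul_nonneg (Γ.gpos v t).le (sq_nonneg (A - Γ.q v t)))
      nlinarith
  have key : ∀ x y, a ≤ x → x ≤ y → y ≤ b → |max (A - Γ.q y t) 0 ^ 3 - max (A - Γ.q x t) 0 ^ 3|
      ≤ 6 * √A * ∫ v in a..b, Γ.g v t * Γ.psi A v t := fun x y hx hxy hy => by
    rw [← intervalIntegral.integral_eq_sub_of_hasDerivAt (fun v _ => hd v)
      (hdc.intervalIntegrable _ _)]
    calc _ ≤ ∫ v in x..y, |3 * max (A - Γ.q v t) 0 ^ 2 * (-(2 * (Γ.g v t * Γ.S v t)))| :=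
          intervalIntegral.abs_integral_le_integral_abs hxy
      _ ≤ ∫ v in x..y, 6 * √A * (Γ.g v t * Γ.psi A v t) :=
          intervalIntegral.integral_mono_on hxy (hdc.abs.intervalIntegrable _ _)
            ((hcont.const_mul _).intervalIntegrable _ _) (fun v _ => hb v)
      _ = 6 * √A * ∫ v in x..y, (Γ.g v t * Γ.psi A v t) := by
          rw [intervalIntegral.integral_const_mul]
      _ ≤ _ := by
          gcongr
          exact intervalIntegral.integral_mono_interval hx hxy hy
            (Eventually.of_forall hnn) (hcont.intervalIntegrable _ _)
  rcases hend with h | h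
  · have := key a u le_rfl hu.1 hu.2
    rw [max_eq_right (by linarith : A - Γ.q a t ≤ 0)] at this
    simpa using (le_abs_self _).trans this
  · have := key u b hu.1 hu.2 le_rfl
    rw [max_eq_right (by linarith : A - Γ.q b t ≤ 0)] at this
    have := (neg_le_abs _).trans this
    simpa using this

theorem up_step (R : ℝ) (hR : 0 ≤ R) : ∃ h > 0, ∀ t₀ ≤ 0, ∃ U : ℝ, ∀ t, t₀ ≤ t → t ≤ t₀ + h → t ≤ 0 →
    ∀ u, U ≤ |u| → R ≤ Γ.q u t := by
  set A := R + 1 with hAdef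
  have hA : 0 < A := by linarith
  set C := 6 * √A * (4 * A * Real.exp (1 / 4) * (Γ.M * √(4 * π * A))) with hC
  have hC0 : 0 ≤ C := by have := Γ.M_nonneg; positivity
  refine ⟨1 / (C + 1), by positivity, fun t₀ ht₀ => ?_⟩
  obtain ⟨U, hU⟩ := Γ.proper t₀ ht₀ A
  refine ⟨max U 0, fun t h1 h2 h3 u hu => ?_⟩
  obtain ⟨V, hV⟩ := Γ.proper t h3 A
  by_contra hlt
  push Not at hlt
  have main : ∀ a b, u ∈ Icc a b → (∀ v ∈ Icc a b, A ≤ Γ.q v t₀) → (A ≤ Γ.q a t ∨ A ≤ Γ.q b t) → False := by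
    intro a b hu' h0 hend
    have e1 := Γ.psi_point A a b t u hu' hend
    have e2 := Γ.psi_growth A hA a b (hu'.1.trans hu'.2) t₀ t h1 h3 h0
    have e3 : (1:ℝ) < max (A - Γ.q u t) 0 ^ 3 := by
      apply one_lt_pow₀ _ (by norm_num)
      apply lt_max_of_lt_left; linarith
    have e4 : max (A - Γ.q u t) 0 ^ 3 ≤ C * (t - t₀) := by
      calc _ ≤ _ := e1
        _ ≤ 6 * √A * (4 * A * Real.exp (1 / 4) * (Γ.M * √(4 * π * A)) * (t - t₀)) := by gcongr
        _ = _ := by rw [hC]; ring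
    have e5 : C * (t - t₀) ≤ C * (1 / (C + 1)) := by gcongr; linarith
    have e6 : C * (1 / (C + 1)) ≤ 1 := by
      rw [mul_one_div, div_le_one (by positivity)]; linarith
    linarith
  rcases le_total 0 u with h | h
  · rw [abs_of_nonneg h] at hu
    refine main u (max u V) ⟨le_rfl, le_max_left _ _⟩ (fun v hv => hU v ?_) (Or.inr (hV _ ?_))
    · exact (le_max_left _ _).trans (hu.trans (hv.1.trans (le_abs_self v)))
    · exact (le_max_right _ _).trans (le_abs_self _)
  · rw [abs_of_nonpos h] at hu
    refine main (min u (-V)) u ⟨min_le_left _ _, le_rfl⟩ (fun v hv => hU v ?_) (Or.inl (hV _ ?_))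
    · exact (le_max_left _ _).trans (hu.trans ((neg_le_neg hv.2).trans (neg_le_abs v)))
    · exact (by linarith [min_le_right u (-V)] : V ≤ - min u (-V)).trans (neg_le_abs _)

theorem up (R t₁ t₂ : ℝ) (ht₂ : t₂ ≤ 0) : ∃ U : ℝ, 0 < U ∧ ∀ t, t₁ ≤ t → t ≤ t₂ →
    ∀ u, U ≤ |u| → R ≤ Γ.q u t := by
  wlog hR : 0 ≤ R
  · obtain ⟨U, h1, h2⟩ := this Γ 0 t₁ t₂ ht₂ le_rfl
    exact ⟨U, h1, fun t a b u hu => by linarith [h2 t a b u hu]⟩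
  obtain ⟨h, hh, H⟩ := Γ.up_step R hR
  have ind : ∀ n : ℕ, ∃ U : ℝ, ∀ t, t₁ ≤ t → t ≤ t₁ + n * h → t ≤ 0 → ∀ u, U ≤ |u| → R ≤ Γ.q u t := by
    intro n
    induction n with
    | zero =>
      by_cases h0 : t₁ ≤ 0
      · obtain ⟨U, hU⟩ := H t₁ h0
        exact ⟨U, fun t a b c => hU t a (by simp at b; linarith) c⟩
      · exact ⟨0, fun t a b c => absurd (a.trans c) h0⟩
    | succ n ih =>
      obtain ⟨U, hU⟩ := ih
      by_cases h0 : t₁ + n * h ≤ 0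
      · obtain ⟨V, hV⟩ := H _ h0
        refine ⟨max U V, fun t a b c u hu => ?_⟩
        rcases le_total t (t₁ + n * h) with h' | h'
        · exact hU t a h' c u ((le_max_left _ _).trans hu)
        · exact hV t h' (by push_cast at b; linarith) c u ((le_max_right _ _).trans hu)
      · exact ⟨U, fun t a b c => hU t a (by linarith) c⟩
  obtain ⟨n, hn⟩ := exists_nat_gt ((t₂ - t₁) / h)
  obtain ⟨U, hU⟩ := ind n
  rw [div_lt_iff₀ hh] at hn
  refine ⟨max U 1, by positivity, fun t a b u hu => hU t a (by linarith) (by linarith) u ((le_max_left _ _).trans hu)⟩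

end CFlow

/-- Backward tracking of alternating configurations. -/
theorem tracking (F : ℝ → ℝ → ℝ) (hF : Continuous (fun x : ℝ × ℝ => F x.1 x.2))
    (t₁ t₀ : ℝ) (h10 : t₁ ≤ t₀) (m : ℕ) (L : ℕ → ℝ) (η : ℝ) (hη : 0 ≤ η) (U : ℝ)
    (hU : ∀ t ∈ Icc t₁ t₀, ∀ u, U ≤ |u| → ∀ i ≤ 2 * m, Even i → L i + η * (t₀ - t) < F u t)
    (hgap : ∀ i < 2 * m, 2 * η * (t₀ - t₁) < (-1) ^ i * (L (i + 1) - L i))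
    (hmin : ∀ t ∈ Ioc t₁ t₀, ∀ u, ∀ i ≤ 2 * m, IsLocalMin (fun v => (-1) ^ i * F v t) u →
      ∀ᶠ r in nhdsWithin t (Iio t), (-1) ^ i * F u r ≤ (-1) ^ i * F u t + η * (t - r))
    (z : ℕ → ℝ) (hz : ∀ i < 2 * m, z i ≤ z (i + 1))
    (hz' : ∀ i ≤ 2 * m, (-1) ^ i * (F (z i) t₀ - L i) ≤ 0) :
    ∃ z : ℕ → ℝ, (∀ i < 2 * m, z i ≤ z (i + 1)) ∧
      ∀ i ≤ 2 * m, (-1) ^ i * (F (z i) t₁ - L i) ≤ η * (t₀ - t₁) := by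
  -- the good set of (reversed) times
  set G : Set ℝ := {x | ∃ z : ℕ → ℝ, (∀ i < 2 * m, z i ≤ z (i + 1)) ∧
      ∀ i ≤ 2 * m, (-1) ^ i * (F (z i) (-x) - L i) ≤ η * (t₀ - (-x))} with hG
  suffices h : -t₁ ∈ G by
    obtain ⟨z, h1, h2⟩ := h
    exact ⟨z, h1, by simpa using h2⟩
  have hbd : ∀ t ∈ Icc t₁ t₀, ∀ z : ℕ → ℝ, (∀ i < 2 * m, z i ≤ z (i + 1)) →
      (∀ i ≤ 2 * m, (-1) ^ i * (F (z i) t - L i) ≤ η * (t₀ - t)) →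
      ∀ i ≤ 2 * m, z i ∈ Icc (-U) U := by
    intro t ht z h1 h2
    have hev : ∀ i ≤ 2 * m, Even i → z i ∈ Icc (-U) U := by
      intro i hi he
      have := h2 i hi
      rw [he.neg_one_pow] at this
      by_contra hc
      have hc' : U ≤ |z i| := by
        by_contra hlt
        push Not at hlt
        rw [abs_lt] at hlt
        exact hc ⟨hlt.1.le, hlt.2.le⟩
      have := hU t ht _ hc' i hi he
      linarith
    intro i hi
    rcases Nat.even_or_odd i with he | ho
    · exact hev i hi he
    · obtain ⟨j, rfl⟩ := ho
      have e1 := hev (2 * j) (by omega) (by simp)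
      have e2 := hev (2 * j + 1 + 1) (by omega) ⟨j + 1, by ring⟩
      exact ⟨e1.1.trans (h1 (2 * j) (by omega)), (h1 (2 * j + 1) (by omega)).trans e2.2⟩
  -- closedness
  have hcl : IsClosed (G ∩ Icc (-t₀) (-t₁)) := by
    set K : Set (ℝ × (Fin (2 * m + 1) → ℝ)) :=
      (Icc (-t₀) (-t₁) ×ˢ Set.pi univ (fun _ => Icc (-U) U)) ∩
      ({x | ∀ i : ℕ, ∀ hi : i < 2 * m, x.2 ⟨i, by omega⟩ ≤ x.2 ⟨i + 1, by omega⟩} ∩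
       {x | ∀ i : ℕ, ∀ hi : i ≤ 2 * m, (-1) ^ i * (F (x.2 ⟨i, by omega⟩) (-x.1) - L i) ≤ η * (t₀ - (-x.1))})
      with hK
    have hKc : IsCompact K := by
      apply IsCompact.inter_right
      · exact isCompact_Icc.prod (isCompact_univ_pi fun _ => isCompact_Icc)
      · apply IsClosed.inter
        · simp only [ofPred_forall]
          refine isClosed_iInter fun i => isClosed_iInter fun hi => isClosed_le (by fun_prop) (by fun_prop)
        · simp only [ofPred_forall]
          refine isClosed_iInter fun i => isClosed_iInter fun hi => isClosed_le ?_ (by fun_prop)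
          have : Continuous fun x : ℝ × (Fin (2 * m + 1) → ℝ) => F (x.2 ⟨i, by omega⟩) (-x.1) :=
            hF.comp (by fun_prop : Continuous fun x : ℝ × (Fin (2 * m + 1) → ℝ) => (x.2 ⟨i, by omega⟩, -x.1))
          fun_prop
    have : G ∩ Icc (-t₀) (-t₁) = Prod.fst '' K := by
      ext x
      constructor
      · rintro ⟨⟨z, h1, h2⟩, hx⟩
        refine ⟨(x, fun i => z i), ⟨⟨hx, ?_⟩, ?_, ?_⟩, rfl⟩
        · intro i _
          exact hbd (-x) ⟨by linarith [hx.2], by linarith [hx.1]⟩ z h1 h2 i (by omega)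
        · intro i hi; exact h1 i hi
        · intro i hi; exact h2 i hi
      · rintro ⟨⟨x', z⟩, ⟨⟨hx, _⟩, h1, h2⟩, rfl⟩
        refine ⟨⟨fun i => if hi : i < 2 * m + 1 then z ⟨i, hi⟩ else 0, ?_, ?_⟩, hx⟩
        · intro i hi
          have := h1 i hi
          beta_reduce
          rw [dif_pos (by omega), dif_pos (by omega)]; exact this
        · intro i hi
          have := h2 i hi
          beta_reduce
          rw [dif_pos (by omega)]; exact this
    rw [this]
    exact (hKc.image continuous_fst).isClosed
  refine IsClosed.mem_of_ge_of_forall_exists_gt hcl ?_ (by linarith) ?_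
  · exact ⟨z, hz, by simpa using hz'⟩
  -- step
  rintro x ⟨⟨z, h1, h2⟩, hx1, hx2⟩
  set t := -x with ht
  have htm : t ∈ Ioc t₁ t₀ := ⟨by linarith, by linarith⟩
  have hstrict : ∀ i < 2 * m, z i < z (i + 1) := by
    intro i hi
    refine lt_of_le_of_ne (h1 i hi) fun heq => ?_
    have e1 := h2 i (by omega)
    have e2 := h2 (i + 1) (by omega)
    rw [← heq, pow_succ] at e2
    have e3 := hgap i hi
    have e4 : η * (t₀ - t) ≤ η * (t₀ - t₁) := by gcongr; exact htm.1.le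
    linarith
  obtain ⟨d, hd, hd'⟩ : ∃ d > 0, ∀ i < 2 * m, 2 * d ≤ z (i + 1) - z i := by
    have : ∀ n ≤ 2 * m, ∃ d > 0, ∀ i < n, 2 * d ≤ z (i + 1) - z i := by
      intro n
      induction n with
      | zero => exact fun _ => ⟨1, one_pos, by simp⟩
      | succ n ih =>
        intro hn
        obtain ⟨d, hd, h⟩ := ih (by omega)
        refine ⟨min d ((z (n + 1) - z n) / 2), lt_min hd (by linarith [hstrict n (by omega)]), ?_⟩
        intro i hi
        rcases Nat.lt_succ_iff_lt_or_eq.1 hi with h' | rfl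
        · linarith [h i h', min_le_left d ((z (n + 1) - z n) / 2)]
        · linarith [min_le_right d ((z (i + 1) - z i) / 2)]
    exact this _ le_rfl
  have hcF : ∀ y, Continuous fun r => F y r := fun y => hF.comp (by fun_prop : Continuous fun r : ℝ => (y, r))
  have hloc : ∀ i, ∃ y, |y - z i| < d ∧ (i ≤ 2 * m → ∀ᶠ r in nhdsWithin t (Iio t),
      (-1) ^ i * (F y r - L i) ≤ η * (t₀ - r)) := by
    intro i
    by_cases hi : i ≤ 2 * m
    swap
    · exact ⟨z i, by simpa using hd, fun h => absurd h hi⟩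
    have strict_case : ∀ y, (-1) ^ i * (F y t - L i) < η * (t₀ - t) →
        ∀ᶠ r in nhdsWithin t (Iio t), (-1) ^ i * (F y r - L i) ≤ η * (t₀ - r) := by
      intro y hy
      have : ∀ᶠ r in nhds t, (-1) ^ i * (F y r - L i) < η * (t₀ - r) := by
        have := hcF y
        exact ContinuousAt.eventually_lt (by fun_prop) (by fun_prop) hy
      exact (this.filter_mono nhdsWithin_le_nhds).mono fun r hr => hr.le
    by_cases hlm : IsLocalMin (fun v => (-1) ^ i * F v t) (z i)
    · refine ⟨z i, by simpa using hd, fun _ => ?_⟩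
      filter_upwards [hmin t htm (z i) i hi hlm] with r hr
      have := h2 i hi
      linarith
    · have : ∃ᶠ y in nhds (z i), (-1) ^ i * F y t < (-1) ^ i * F (z i) t := by
        simpa [IsLocalMin, IsMinFilter, Filter.not_eventually] using hlm
      obtain ⟨y, hy1, hy2⟩ := (this.and_eventually (Metric.ball_mem_nhds (z i) hd)).exists
      refine ⟨y, by simpa [Real.dist_eq] using hy2, fun _ => strict_case y ?_⟩
      have := h2 i hi
      linarith
  choose y hy1 hy2 using hloc
  have hev : ∀ᶠ r in nhdsWithin t (Iio t), ∀ i ∈ Finset.range (2 * m + 1),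
      (-1) ^ i * (F (y i) r - L i) ≤ η * (t₀ - r) := by
    rw [Filter.eventually_all_finset]
    intro i hi
    exact hy2 i (by simp at hi; omega)
  have hev2 : ∀ᶠ r in nhdsWithin t (Iio t), r ∈ Ioo t₁ t := Ioo_mem_nhdsLT htm.1
  obtain ⟨r, hr, hr1, hr2⟩ := (hev.and hev2).exists
  refine ⟨-r, ⟨y, ?_, ?_⟩, by linarith, by linarith⟩
  · intro i hi
    have a1 := abs_lt.1 (hy1 i)
    have a2 := abs_lt.1 (hy1 (i + 1))
    linarith [hd' i hi]
  · intro i hi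
    simpa using hr i (by simp; omega)

theorem second_deriv_min (φ φ' : ℝ → ℝ) (hφ : ∀ x, HasDerivAt φ (φ' x) x) (u d : ℝ)
    (hd : HasDerivAt φ' d u) (hm : IsLocalMin φ u) : φ' u = 0 ∧ 0 ≤ d := by
  have h0 : φ' u = 0 := hm.hasDerivAt_eq_zero (hφ u)
  refine ⟨h0, ?_⟩
  by_contra hneg
  push Not at hneg
  have h1 := hasDerivAt_iff_tendsto_slope.1 hd
  have h2 : ∀ᶠ x in nhdsWithin u {u}ᶜ, slope φ' u x < 0 := h1.eventually_lt_const hneg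
  have h3 : ∀ᶠ x in nhdsWithin u (Ioi u), slope φ' u x < 0 :=
    h2.filter_mono (nhdsWithin_mono _ (fun x hx => ne_of_gt hx))
  have h4 : ∀ᶠ x in nhdsWithin u (Ioi u), φ u ≤ φ x := hm.filter_mono nhdsWithin_le_nhds
  obtain ⟨b, hb, hb'⟩ := (mem_nhdsGT_iff_exists_Ioo_subset (a := u)).1 (h3.and h4)
  have hub : u < b := hb
  set x := (u + b) / 2
  have hx : x ∈ Ioo u b := ⟨by simp only [x]; linarith, by simp only [x]; linarith⟩
  obtain ⟨ξ, hξ, hξ'⟩ := exists_hasDerivAt_eq_slope φ φ' hx.1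
    (fun y _ => (hφ y).continuousAt.continuousWithinAt) (fun y _ => hφ y)
  have e1 := (hb' ⟨hξ.1, hξ.2.trans hx.2⟩).1
  have e2 := (hb' hx).2
  rw [slope_def_field, h0, sub_zero, div_lt_iff₀ (by linarith [hξ.1])] at e1
  rw [eq_div_iff (by linarith [hx.1])] at hξ'
  nlinarith [hx.1]

namespace CFlow
variable (Γ : CFlow)

theorem quu (u t : ℝ) : HasDerivAt (fun v => 2 * (Γ.g v t * Γ.S v t))
    (2 * (Γ.gu u t * Γ.S u t + Γ.g u t * (Γ.g u t * (1 + Γ.k u t * Γ.p u t)))) u :=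
  ((Γ.guu u t).fun_mul (Γ.Su u t)).const_mul 2

theorem flow_track (t₁ t₀ : ℝ) (h10 : t₁ ≤ t₀) (ht₀ : t₀ ≤ 0) (m : ℕ) (L : ℕ → ℝ)
    (v v' v'' : ℝ → ℝ) (hv : ∀ u, HasDerivAt v (v' u) u) (hv' : ∀ u, HasDerivAt v' (v'' u) u)
    (hvb : ∀ u, |v u| ≤ 1) (ε K η : ℝ) (hε : 0 ≤ ε) (hη : 0 ≤ η) (hεK : ε * K < η)
    (hK : ∀ t ∈ Icc t₁ t₀, ∀ u, |v' u * Γ.gu u t - v'' u * Γ.g u t| ≤ K * Γ.g u t ^ 3)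
    (hgap : ∀ i < 2 * m, 2 * η * (t₀ - t₁) < (-1) ^ i * (L (i + 1) - L i))
    (z : ℕ → ℝ) (hz : ∀ i < 2 * m, z i ≤ z (i + 1))
    (hz' : ∀ i ≤ 2 * m, (-1) ^ i * (Γ.q (z i) t₀ + 2 * t₀ + ε * v (z i) - L i) ≤ 0) :
    ∃ z : ℕ → ℝ, (∀ i < 2 * m, z i ≤ z (i + 1)) ∧
      ∀ i ≤ 2 * m, (-1) ^ i * (Γ.q (z i) t₁ + 2 * t₁ + ε * v (z i) - L i) ≤ η * (t₀ - t₁) := by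
  obtain ⟨U, hU0, hU⟩ := Γ.up (∑ i ∈ Finset.range (2 * m + 1), |L i| + η * (t₀ - t₁) - 2 * t₁ + ε + 1)
    t₁ t₀ ht₀
  have hvc : Continuous v := continuous_iff_continuousAt.2 fun u => (hv u).continuousAt
  refine tracking (fun u t => Γ.q u t + 2 * t + ε * v u) ?_ t₁ t₀ h10 m L η hη U ?_ hgap ?_ z hz hz'
  · have := Γ.contq
    fun_prop
  · intro t ht u hu i hi _
    have e1 := hU t ht.1 ht.2 u hu
    have e2 : |L i| ≤ ∑ i ∈ Finset.range (2 * m + 1), |L i| :=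
      Finset.single_le_sum (f := fun i => |L i|) (fun _ _ => abs_nonneg _) (by simp; omega)
    have e3 := (abs_le.1 (hvb u)).1
    have e4 : -ε ≤ ε * v u := by nlinarith
    have e5 : η * (t₀ - t) ≤ η * (t₀ - t₁) := by gcongr; exact ht.1
    have e6 := le_abs_self (L i)
    have := ht.1
    linarith
  · intro t ht u i hi hlm
    have ht0 : t ≤ 0 := ht.2.trans ht₀
    set σ : ℝ := (-1) ^ i with hσ
    have hσ1 : |σ| = 1 := by simp [hσ, abs_pow]
    have hg := Γ.gpos u t
    -- spatial derivatives
    have d1 : ∀ x, HasDerivAt (fun y => σ * (Γ.q y t + 2 * t + ε * v y))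
        (σ * (2 * (Γ.g x t * Γ.S x t) + ε * v' x)) x := fun x =>
      ((((Γ.qu x t).add_const (2 * t)).fun_add ((hv x).const_mul ε)).const_mul σ)
    have d2 := (((Γ.quu u t).fun_add ((hv' u).const_mul ε)).const_mul σ)
    obtain ⟨c1, c2⟩ := second_deriv_min _ _ d1 u _ d2 hlm
    have hD : -η < σ * (2 * (Γ.k u t * Γ.p u t) + 2) := by
      have hk := (abs_le.1 (show |σ * (v' u * Γ.gu u t - v'' u * Γ.g u t)| ≤ K * Γ.g u t ^ 3 by
        rw [abs_mul, hσ1, one_mul]; exact hK t ⟨ht.1.le, ht.2⟩ u)).1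
      have hg3 : 0 < Γ.g u t ^ 3 := by positivity
      have h1 : σ * (2 * (Γ.k u t * Γ.p u t) + 2) * Γ.g u t ^ 3 ≥
          ε * (σ * (v' u * Γ.gu u t - v'' u * Γ.g u t)) := by
        have c3 := mul_nonneg c2 hg.le
        linear_combination c3 + Γ.gu u t * c1
      have h2 := mul_le_mul_of_nonneg_left hk hε
      have h3 : -η * Γ.g u t ^ 3 < σ * (2 * (Γ.k u t * Γ.p u t) + 2) * Γ.g u t ^ 3 := by
        nlinarith
      exact lt_of_mul_lt_mul_right h3 hg3.le
    have dt : HasDerivWithinAt (fun r => σ * (Γ.q u r + 2 * r + ε * v u))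
        (σ * (2 * (Γ.k u t * Γ.p u t) + 2)) (Iio t) t := by
      have h1 := (Γ.qt u t ht0).mono (show Iio t ⊆ Iic 0 from fun r hr => (le_of_lt hr).trans ht0)
      have h2 := (((h1.fun_add ((hasDerivWithinAt_id t (Iio t)).const_mul 2)).add_const (ε * v u)).const_mul σ)
      simpa using h2
    have h3 := (hasDerivWithinAt_iff_tendsto_slope' (by simp)).1 dt
    filter_upwards [h3.eventually_const_lt hD, self_mem_nhdsWithin] with r hr hr'
    have hr' : r < t := hr'
    rw [slope_def_field, lt_div_iff_of_neg (by linarith)] at hr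
    linarith
end CFlow

namespace CFlow
variable (Γ : CFlow)

/-- weight `τ^{-1/2} e^{-q/4τ}`, `τ = -t` -/
def rho (u t : ℝ) : ℝ := Real.exp (-(1 / 2) * Real.log (-t) + Γ.q u t / (4 * t))
def cut (A u t : ℝ) : ℝ := max (A - (Γ.q u t + 2 * t)) 0
def kk (u t : ℝ) : ℝ := Γ.k u t - Γ.p u t / (2 * t)

def PP (A u t : ℝ) : ℝ := Γ.cut A u t ^ 3 * Γ.rho u t * Γ.g u t
def PT (A u t : ℝ) : ℝ :=
  Γ.g u t * (3 * Γ.cut A u t ^ 2 * -(2 + 2 * (Γ.k u t * Γ.p u t)) * Γ.rho u t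
   + Γ.cut A u t ^ 3 * Γ.rho u t * (-(1 / (2 * t)) + Γ.k u t * Γ.p u t / (2 * t) - Γ.q u t / (4 * t ^ 2))
   - Γ.cut A u t ^ 3 * Γ.rho u t * Γ.k u t ^ 2)
def WW (A u t : ℝ) : ℝ :=
  -(6 * Γ.cut A u t ^ 2 * Γ.S u t * Γ.rho u t) - Γ.cut A u t ^ 3 * Γ.rho u t * Γ.S u t / (2 * t)

theorem rho_pos (u t : ℝ) : 0 < Γ.rho u t := Real.exp_pos _
theorem cut_nonneg (A u t : ℝ) : 0 ≤ Γ.cut A u t := le_max_right _ _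

theorem rho_eq (u t : ℝ) (ht : t < 0) : Γ.rho u t = (√(-t))⁻¹ * Real.exp (-(Γ.q u t) / (4 * (-t))) := by
  unfold rho
  rw [Real.exp_add]
  congr 1
  · rw [neg_mul, Real.exp_neg]
    congr 1
    rw [Real.sqrt_eq_rpow, Real.rpow_def_of_pos (by linarith), mul_comm]
  · congr 1
    rw [mul_neg, neg_div_neg_eq]

theorem cut_u (A u t : ℝ) (n : ℕ) : HasDerivAt (fun v => Γ.cut A v t ^ (n + 2))
    ((n + 2) * Γ.cut A u t ^ (n + 1) * -(2 * (Γ.g u t * Γ.S u t))) u := by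
  have := (hasDerivAt_maxpow n (A - (Γ.q u t + 2 * t))).comp u
    (((Γ.qu u t).add_const (2 * t)).const_sub A)
  exact this

theorem cut_t (A u t : ℝ) (ht : t < 0) (n : ℕ) : HasDerivAt (fun r => Γ.cut A u r ^ (n + 2))
    ((n + 2) * Γ.cut A u t ^ (n + 1) * -(2 * (Γ.k u t * Γ.p u t) + 2)) t := by
  have := (hasDerivAt_maxpow n (A - (Γ.q u t + 2 * t))).comp t
    (((Γ.qt' u t ht).fun_add ((hasDerivAt_id t).const_mul 2)).const_sub A)
  rw [mul_one] at this
  exact this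

theorem rho_u (u t : ℝ) : HasDerivAt (fun v => Γ.rho v t)
    (Γ.rho u t * (2 * (Γ.g u t * Γ.S u t) / (4 * t))) u :=
  (((Γ.qu u t).div_const (4 * t)).const_add (-(1 / 2) * Real.log (-t))).exp

theorem rho_t (u t : ℝ) (ht : t < 0) : HasDerivAt (fun r => Γ.rho u r)
    (Γ.rho u t * (-(1 / (2 * t)) + Γ.k u t * Γ.p u t / (2 * t) - Γ.q u t / (4 * t ^ 2))) t := by
  have h1 : HasDerivAt (fun r : ℝ => Real.log (-r)) (-1 / -t) t :=
    (hasDerivAt_id t).fun_neg.log (by simpa using ht.ne)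
  have h2 := (Γ.qt' u t ht).fun_div ((hasDerivAt_id t).const_mul 4) (by simpa using ht.ne)
  have h3 := ((h1.const_mul (-(1/2))).fun_add h2).exp
  refine h3.congr_deriv ?_
  unfold rho
  simp only [id]
  congr 1
  field_simp
  ring

theorem PP_t (A u t : ℝ) (ht : t < 0) : HasDerivAt (fun r => Γ.PP A u r) (Γ.PT A u t) t := by
  have := ((Γ.cut_t A u t ht 1).fun_mul (Γ.rho_t u t ht)).fun_mul (Γ.gt u t ht)
  refine this.congr_deriv ?_
  unfold PT
  norm_num
  ring

theorem WW_u (A u t : ℝ) (ht : t < 0) : HasDerivAt (fun v => Γ.WW A v t)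
    (Γ.PT A u t + Γ.g u t * (24 * Γ.cut A u t * Γ.S u t ^ 2 * Γ.rho u t
      + Γ.cut A u t ^ 3 * Γ.rho u t * Γ.kk u t ^ 2)) u := by
  have h1 := (((Γ.cut_u A u t 0).const_mul 6).fun_mul (Γ.Su u t)).fun_mul (Γ.rho_u u t)
  have h2 := (((Γ.cut_u A u t 1).fun_mul (Γ.rho_u u t)).fun_mul (Γ.Su u t)).div_const (2 * t)
  have h3 := h1.fun_neg.fun_sub h2
  refine h3.congr_deriv ?_
  unfold PT kk
  rw [← Γ.Sp u t]
  have : t ≠ 0 := ht.ne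
  norm_num
  field_simp
  ring

theorem contcut (A : ℝ) : Continuous (fun x : ℝ × ℝ => Γ.cut A x.1 x.2) := by
  unfold cut
  have := Γ.contq
  fun_prop

theorem contrho : ContinuousOn (fun x : ℝ × ℝ => Γ.rho x.1 x.2) (univ ×ˢ Iio 0) := by
  unfold rho
  have := Γ.contq.continuousOn (s := univ ×ˢ Iio 0)
  have hne : ∀ x ∈ (univ ×ˢ Iio 0 : Set (ℝ × ℝ)), x.2 ≠ 0 := fun x hx => ne_of_lt hx.2
  refine ContinuousOn.rexp (ContinuousOn.add (ContinuousOn.mul continuousOn_const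
    (ContinuousOn.log (by fun_prop) fun x hx => by simpa using hne x hx)) (this.div (by fun_prop) ?_))
  intro x hx; simpa using hne x hx

theorem contPT (A : ℝ) : ContinuousOn (fun x : ℝ × ℝ => Γ.PT A x.1 x.2) (univ ×ˢ Iio 0) := by
  unfold PT
  have h1 := Γ.contq.continuousOn (s := univ ×ˢ Iio 0)
  have h2 := Γ.contk.continuousOn (s := univ ×ˢ Iio 0)
  have h3 := Γ.contg.continuousOn (s := univ ×ˢ Iio 0)
  have h4 := Γ.contp.continuousOn (s := univ ×ˢ Iio 0)
  have h5 := (Γ.contcut A).continuousOn (s := univ ×ˢ Iio 0)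
  have h6 := Γ.contrho
  have hne : ∀ x ∈ (univ ×ˢ Iio 0 : Set (ℝ × ℝ)), x.2 ≠ 0 := fun x hx => ne_of_lt hx.2
  have h7 : ContinuousOn (fun x : ℝ × ℝ => 1 / (2 * x.2)) (univ ×ˢ Iio 0) :=
    continuousOn_const.div (by fun_prop) (fun x hx => by simpa using hne x hx)
  have h8 : ContinuousOn (fun x : ℝ × ℝ => Γ.k x.1 x.2 * Γ.p x.1 x.2 / (2 * x.2)) (univ ×ˢ Iio 0) :=
    (h2.mul h4).div (by fun_prop) (fun x hx => by simpa using hne x hx)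
  have h9 : ContinuousOn (fun x : ℝ × ℝ => Γ.q x.1 x.2 / (4 * x.2 ^ 2)) (univ ×ˢ Iio 0) :=
    h1.div (by fun_prop) (fun x hx => by simpa using hne x hx)
  fun_prop

theorem crho (t : ℝ) : Continuous (fun u => Γ.rho u t) := by
  unfold rho
  have := Γ.cq t
  fun_prop
theorem ckk (t : ℝ) : Continuous (fun u => Γ.kk u t) := by
  unfold kk
  exact (Γ.ck t).sub ((Γ.cp t).div_const _)
theorem ccut (A t : ℝ) : Continuous (fun u => Γ.cut A u t) := slice _ (Γ.contcut A) t

theorem dissipation (T Λ B : ℝ) (hT : 0 < T) (hΛ : 1 < Λ) (hB : 1 ≤ B) :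
    ∃ t, t < -T ∧ ∀ a b, a ≤ b → (∀ u ∈ Icc a b, Γ.q u t ≤ B * (-t)) →
      ∫ u in a..b, Γ.g u t * Γ.kk u t ^ 2 * Real.exp (-(Γ.q u t) / (4 * (-t))) ≤
        64 * Γ.M * √(4 * π) / (√(-t) * Real.log Λ) := by
  set A := 2 * B * Λ * T with hA
  have hΛT : T < Λ * T := by nlinarith
  have hΛ0 : 0 < Λ := by linarith
  have hA0 : 0 < A := by positivity
  have hAL : 2 * (Λ * T) ≤ A := by rw [hA]; nlinarith [mul_pos hΛ0 hT]
  obtain ⟨U, hU0, hU⟩ := Γ.up (A + 2 * (Λ * T)) (-(Λ * T)) (-T) (by linarith)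
  have hlog : 0 < Real.log Λ := Real.log_pos hΛ
  have hPc : ∀ t, Continuous fun u => Γ.PP A u t := fun t => by
    unfold PP
    exact (((Γ.ccut A t).pow 3).mul (Γ.crho t)).mul (Γ.cg t)
  have hE : ∀ r < 0, HasDerivAt (fun r => ∫ u in (-U)..U, Γ.PP A u r) (∫ u in (-U)..U, Γ.PT A u r) r :=
    fun r hr => dui (Γ.PP A) (Γ.PT A) (fun t _ => hPc t) (Γ.contPT A) (Γ.PP_t A) _ _ r hr
  have hh : ∀ r < 0, HasDerivAt (fun r => -Real.log (-r)) (-(-1 / -r)) r := fun r hr =>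
    ((hasDerivAt_id r).fun_neg.log (by simpa using hr.ne)).fun_neg
  obtain ⟨t, ht, hmv⟩ := exists_ratio_hasDerivAt_eq_ratio_slope
    (fun r => ∫ u in (-U)..U, Γ.PP A u r) (fun r => ∫ u in (-U)..U, Γ.PT A u r)
    (show -(Λ * T) < -T by linarith)
    (fun x hx => (hE x (by linarith [hx.2])).continuousAt.continuousWithinAt)
    (fun x hx => hE x (by linarith [hx.2]))
    (fun r => -Real.log (-r)) (fun r => -(-1 / -r))
    (fun x hx => (hh x (by linarith [hx.2])).continuousAt.continuousWithinAt)
    (fun x hx => hh x (by linarith [hx.2]))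
  have ht0 : t < 0 := by linarith [ht.2]
  have htau : 0 < -t := by linarith
  refine ⟨t, ht.2, fun a b hab hq => ?_⟩
  -- the log difference
  have hl : -Real.log (- -T) - -Real.log (- -(Λ * T)) = Real.log Λ := by
    rw [neg_neg, neg_neg, Real.log_mul hΛ0.ne' hT.ne']; ring
  rw [hl] at hmv
  -- energy bounds
  have hPnn : ∀ u r, 0 ≤ Γ.PP A u r := fun u r => by
    unfold PP
    have := Γ.cut_nonneg A u r; have := Γ.rho_pos u r; have := Γ.gpos u r
    positivity
  have hEb : 0 ≤ ∫ u in (-U)..U, Γ.PP A u (-T) :=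
    intervalIntegral.integral_nonneg (by linarith) fun u _ => hPnn u _
  have hEa : ∫ u in (-U)..U, Γ.PP A u (-(Λ * T)) ≤ 8 * A ^ 3 * (Γ.M * √(4 * π)) := by
    set t' := -(Λ * T) with ht'
    have htn : t' < 0 := by rw [ht']; linarith
    have hst : 0 < √(-t') := Real.sqrt_pos.2 (by linarith)
    calc _ ≤ ∫ u in (-U)..U, (8 * A ^ 3 * (√(-t'))⁻¹) * (Real.exp (-(Γ.q u t') / (4 * (-t'))) * Γ.g u t') := by
          apply intervalIntegral.integral_mono_on (by linarith) ((hPc _).intervalIntegrable _ _)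
          · apply Continuous.intervalIntegrable
            have := Γ.cq t'
            have := Γ.cg t'
            fun_prop
          · intro u _
            unfold PP
            rw [Γ.rho_eq u t' htn]
            have hc : Γ.cut A u t' ≤ 2 * A := by
              unfold cut
              apply max_le _ (by linarith)
              have := Γ.q_nonneg u t'
              linarith
            have hc3 : Γ.cut A u t' ^ 3 ≤ 8 * A ^ 3 := by
              calc _ ≤ (2 * A) ^ 3 := by gcongr; exact Γ.cut_nonneg _ _ _
                _ = _ := by ring
            have := Γ.gpos u t'
            calc _ ≤ 8 * A ^ 3 * ((√(-t'))⁻¹ * rexp (-Γ.q u t' / (4 * -t'))) * Γ.g u t' := by gcongr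
              _ = _ := by ring
      _ = (8 * A ^ 3 * (√(-t'))⁻¹) * ∫ u in (-U)..U, (Real.exp (-(Γ.q u t') / (4 * (-t'))) * Γ.g u t') := by
          rw [intervalIntegral.integral_const_mul]
      _ ≤ (8 * A ^ 3 * (√(-t'))⁻¹) * (Γ.M * √(4 * π * (-t'))) := by
          gcongr
          exact Γ.ent' t' htn.le (-t') (by linarith) _ _ (by linarith)
      _ = _ := by
          rw [Real.sqrt_mul (by positivity) (-t')]
          field_simp
  -- derivative
  have hWc : IntervalIntegrable (fun u => Γ.PT A u t + Γ.g u t * (24 * Γ.cut A u t * Γ.S u t ^ 2 * Γ.rho u t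
      + Γ.cut A u t ^ 3 * Γ.rho u t * Γ.kk u t ^ 2)) volume (-U) U := by
    apply Continuous.intervalIntegrable
    have h1 : Continuous fun u => Γ.PT A u t := by
      rw [← continuousOn_univ]
      exact (Γ.contPT A).comp (f := fun u : ℝ => (u, t)) (by fun_prop) (by intro x _; simp [ht0])
    have := Γ.cg t
    have := Γ.ccut A t
    have := Γ.crho t
    have := Γ.ckk t
    have := Γ.cS t
    fun_prop
  have hW := intervalIntegral.integral_eq_sub_of_hasDerivAt (fun u _ => Γ.WW_u A u t ht0) hWc
  have hW0 : ∀ u, U ≤ |u| → Γ.WW A u t = 0 := fun u hu => by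
    have e1 := hU t ht.1.le ht.2.le u hu
    have : Γ.cut A u t = 0 := by
      unfold cut
      apply max_eq_right
      linarith [ht.1]
    unfold WW
    rw [this]; simp
  rw [hW0 U (le_abs_self U), hW0 (-U) (by rw [abs_neg]; exact le_abs_self U), sub_zero] at hW
  have hPTi : IntervalIntegrable (fun u => Γ.PT A u t) volume (-U) U := by
    apply Continuous.intervalIntegrable
    rw [← continuousOn_univ]
    exact (Γ.contPT A).comp (f := fun u : ℝ => (u, t)) (by fun_prop) (by intro x _; simp [ht0])
  have hDc : Continuous (fun u => Γ.g u t * (24 * Γ.cut A u t * Γ.S u t ^ 2 * Γ.rho u t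
      + Γ.cut A u t ^ 3 * Γ.rho u t * Γ.kk u t ^ 2)) := by
    have := Γ.cg t
    have := Γ.ccut A t
    have := Γ.crho t
    have := Γ.ckk t
    have := Γ.cS t
    fun_prop
  rw [intervalIntegral.integral_add hPTi (hDc.intervalIntegrable _ _)] at hW
  set D := ∫ u in (-U)..U, Γ.g u t * (24 * Γ.cut A u t * Γ.S u t ^ 2 * Γ.rho u t
      + Γ.cut A u t ^ 3 * Γ.rho u t * Γ.kk u t ^ 2) with hDdef
  have hDle : D * (Real.log Λ * (-t)) ≤ 8 * A ^ 3 * (Γ.M * √(4 * π)) := by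
    have e1 : (∫ u in (-U)..U, Γ.PT A u t) = -D := by linarith
    rw [e1] at hmv
    have e2 : -(-1 / -t) = 1 / (-t) := by rw [neg_div, neg_neg]
    rw [e2, mul_one_div, eq_div_iff htau.ne'] at hmv
    linarith
  -- inclusion
  have hin : ∀ u ∈ Icc a b, u ∈ Icc (-U) U := by
    intro u hu
    by_contra hc
    have hc' : U ≤ |u| := by
      by_contra hlt
      push Not at hlt
      rw [abs_lt] at hlt
      exact hc ⟨hlt.1.le, hlt.2.le⟩
    have e1 := hU t ht.1.le ht.2.le u hc'
    have e2 := hq u hu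
    have e3 : B * (-t) ≤ B * (Λ * T) := by gcongr; linarith [ht.1]
    have : A = 2 * (B * (Λ * T)) := by rw [hA]; ring
    nlinarith [mul_pos hΛ0 hT]
  have hst : 0 < √(-t) := Real.sqrt_pos.2 htau
  have hfin : ∫ u in a..b, Γ.g u t * Γ.kk u t ^ 2 * Real.exp (-(Γ.q u t) / (4 * (-t))) ≤
      8 * √(-t) / A ^ 3 * D := by
    rw [hDdef, ← intervalIntegral.integral_const_mul]
    calc _ ≤ ∫ u in a..b, 8 * √(-t) / A ^ 3 * (Γ.g u t * (24 * Γ.cut A u t * Γ.S u t ^ 2 * Γ.rho u t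
            + Γ.cut A u t ^ 3 * Γ.rho u t * Γ.kk u t ^ 2)) := by
          apply intervalIntegral.integral_mono_on hab
          · apply Continuous.intervalIntegrable
            have := Γ.cg t
            have := Γ.ckk t
            have := Γ.cq t
            fun_prop
          · exact (hDc.const_mul _).intervalIntegrable _ _
          · intro u hu
            have hg := Γ.gpos u t
            have hc := Γ.cut_nonneg A u t
            have hr := Γ.rho_pos u t
            have hcl : A / 2 ≤ Γ.cut A u t := by
              unfold cut
              apply le_max_of_le_left
              have e2 := hq u hu
              have e3 : B * (-t) ≤ B * (Λ * T) := by gcongr; linarith [ht.1]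
              have : A = 2 * (B * (Λ * T)) := by rw [hA]; ring
              linarith
            have hc3 : A ^ 3 / 8 ≤ Γ.cut A u t ^ 3 := by
              calc A ^ 3 / 8 = (A / 2) ^ 3 := by ring
                _ ≤ _ := by gcongr
            have h1 : Γ.g u t * Γ.kk u t ^ 2 * Real.exp (-(Γ.q u t) / (4 * (-t)))
                = 8 * √(-t) / A ^ 3 * (Γ.g u t * (A ^ 3 / 8 * Γ.rho u t * Γ.kk u t ^ 2)) := by
              rw [Γ.rho_eq u t ht0]
              field_simp
            rw [h1]
            have h2 : A ^ 3 / 8 * Γ.rho u t * Γ.kk u t ^ 2 ≤ Γ.cut A u t ^ 3 * Γ.rho u t * Γ.kk u t ^ 2 := by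
              gcongr
            have h3 : 0 ≤ 24 * Γ.cut A u t * Γ.S u t ^ 2 * Γ.rho u t := by positivity
            gcongr
            linarith
      _ ≤ _ := by
          apply intervalIntegral.integral_mono_interval (hin a (left_mem_Icc.2 hab)).1 hab
            (hin b (right_mem_Icc.2 hab)).2
          · refine Eventually.of_forall fun u => ?_
            have hg := Γ.gpos u t
            have hc := Γ.cut_nonneg A u t
            have hr := Γ.rho_pos u t
            simp only [Pi.zero_apply]
            positivity
          · exact (hDc.const_mul _).intervalIntegrable _ _
  refine hfin.trans ?_
  rw [le_div_iff₀ (by positivity)]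
  have hs2 : √(-t) * √(-t) = -t := Real.mul_self_sqrt htau.le
  calc 8 * √(-t) / A ^ 3 * D * (√(-t) * Real.log Λ) = 8 / A ^ 3 * (D * (Real.log Λ * (√(-t) * √(-t)))) := by ring
    _ ≤ 8 / A ^ 3 * (8 * A ^ 3 * (Γ.M * √(4 * π))) := by rw [hs2]; gcongr
    _ = _ := by field_simp; ring
end CFlow

namespace CFlow
variable (Γ : CFlow)

theorem exit_point (t : ℝ) (ht : t ≤ 0) (R u₀ : ℝ) (h0 : Γ.q u₀ t ≤ R) :
    ∃ u₂, u₀ ≤ u₂ ∧ Γ.q u₂ t = R ∧ ∀ u ∈ Icc u₀ u₂, Γ.q u t ≤ R := by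
  obtain ⟨V, hV⟩ := Γ.proper t ht R
  set s : Set ℝ := {u | u₀ ≤ u ∧ R ≤ Γ.q u t} with hs
  have hne : s.Nonempty := ⟨max u₀ V, le_max_left _ _, hV _ ((le_max_right _ _).trans (le_abs_self _))⟩
  have hcl : IsClosed s := by
    have := Γ.cq t
    exact (isClosed_le continuous_const continuous_id).inter (isClosed_le continuous_const this)
  have hbdd : BddBelow s := ⟨u₀, fun u hu => hu.1⟩
  have hmem := hcl.csInf_mem hne hbdd
  have hlt : ∀ u, u₀ ≤ u → u < sInf s → Γ.q u t < R := fun u h1 h2 => by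
    by_contra hc
    push Not at hc
    exact absurd (csInf_le hbdd ⟨h1, hc⟩) (not_le.2 h2)
  have heq : Γ.q (sInf s) t = R := by
    obtain ⟨x, hx, hx'⟩ := intermediate_value_Icc hmem.1 (Γ.cq t).continuousOn ⟨h0, hmem.2⟩
    have : sInf s ≤ x := csInf_le hbdd ⟨hx.1, ge_of_eq hx'⟩
    have : x = sInf s := le_antisymm hx.2 this
    rw [← this]; exact hx'
  refine ⟨sInf s, hmem.1, heq, fun u hu => ?_⟩
  rcases hu.2.eq_or_lt with h | h
  · rw [h]; exact heq.le
  · exact (hlt u hu.1 h).le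

theorem good_time (δ B T₀ : ℝ) (hδ : 0 < δ) (hB : 1 ≤ B) (hT : 0 < T₀)
    (hBδ : √B * Real.exp (-B / 4) ≤ δ / 2) :
    ∃ t, t < -T₀ ∧ ∀ u, Γ.S u t = 0 → Γ.q u t ≤ B * (-t) →
      √(Γ.q u t) * Real.exp (-(Γ.q u t) / (4 * (-t))) ≤ δ * √(-t) := by
  have hM := Γ.M_nonneg
  set C1 := 64 * Γ.M * √(4 * π) with hC1
  set C2 := 2 * Γ.M * √(8 * π) with hC2
  have hC1' : 0 ≤ C1 := by positivity
  have hC2' : 0 ≤ C2 := by positivity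
  set ε := δ / (4 * (C2 + 1)) with hε
  have hε0 : 0 < ε := by positivity
  set ℓ := 4 * (C1 + 1) / (ε * δ) with hℓ
  have hℓ0 : 0 < ℓ := by positivity
  obtain ⟨t, ht, hdis⟩ := Γ.dissipation T₀ (Real.exp ℓ) B hT (by simpa using hℓ0) hB
  rw [Real.log_exp] at hdis
  refine ⟨t, ht, fun u₀ hS hq => ?_⟩
  have ht0 : t < 0 := by linarith
  set τ := -t with hτ
  have hτ0 : 0 < τ := by linarith
  have hst : 0 < √τ := Real.sqrt_pos.2 hτ0
  have hss : √τ * √τ = τ := Real.mul_self_sqrt hτ0.le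
  obtain ⟨u₂, h02, hq2, hle⟩ := Γ.exit_point t ht0.le (B * τ) u₀ hq
  have hD := hdis u₀ u₂ h02 hle
  -- the function Q
  have hQ : ∀ u, HasDerivAt (fun v => Γ.p v t * Real.exp (-(Γ.q v t) / (4 * τ)))
      (-(Γ.g u t * Γ.S u t * Real.exp (-(Γ.q u t) / (4 * τ)) * Γ.kk u t)) u := fun u => by
    have := (Γ.pu u t).fun_mul (((Γ.qu u t).fun_neg.div_const (4 * τ)).exp)
    refine this.congr_deriv ?_
    unfold kk
    have e : t = -τ := by rw [hτ]; ring
    have : Γ.p u t / (2 * t) = - (Γ.p u t / (2 * τ)) := by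
      rw [show 2 * t = -(2 * τ) by rw [hτ]; ring, div_neg]
    rw [this]
    field_simp
    ring
  have cg := Γ.cg t
  have cq := Γ.cq t
  have cS := Γ.cS t
  have ck := Γ.ckk t
  have hQc : Continuous fun u => -(Γ.g u t * Γ.S u t * Real.exp (-(Γ.q u t) / (4 * τ)) * Γ.kk u t) := by
    fun_prop
  have hFTC := intervalIntegral.integral_eq_sub_of_hasDerivAt (a := u₀) (b := u₂) (fun u _ => hQ u)
    (hQc.intervalIntegrable _ _)
  set α := τ / ε with hα
  have hα0 : 0 < α := by positivity
  have hInteg : |∫ u in u₀..u₂, -(Γ.g u t * Γ.S u t * Real.exp (-(Γ.q u t) / (4 * τ)) * Γ.kk u t)|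
      ≤ α * (C1 / (√τ * ℓ)) + (1 / (4 * α)) * (8 * τ) * (Γ.M * √(4 * π * (2 * τ))) := by
    calc _ ≤ ∫ u in u₀..u₂, |-(Γ.g u t * Γ.S u t * Real.exp (-(Γ.q u t) / (4 * τ)) * Γ.kk u t)| :=
          intervalIntegral.abs_integral_le_integral_abs h02
      _ ≤ ∫ u in u₀..u₂, (α * (Γ.g u t * Γ.kk u t ^ 2 * Real.exp (-(Γ.q u t) / (4 * τ)))
            + (1 / (4 * α)) * (8 * τ) * (Real.exp (-(Γ.q u t) / (4 * (2 * τ))) * Γ.g u t)) := by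
          apply intervalIntegral.integral_mono_on h02 (hQc.abs.intervalIntegrable _ _)
          · apply Continuous.intervalIntegrable; fun_prop
          · intro u _
            have hg := Γ.gpos u t
            have he := Real.exp_pos (-(Γ.q u t) / (4 * τ))
            have h1 : Γ.q u t * Real.exp (-(Γ.q u t) / (4 * τ)) ≤
                8 * τ * Real.exp (-(Γ.q u t) / (4 * (2 * τ))) := by
              have e1 : Real.exp (-(Γ.q u t) / (4 * τ)) = Real.exp (-(Γ.q u t) / (4 * (2 * τ)))
                  * Real.exp (-(Γ.q u t / (8 * τ))) := by
                rw [← Real.exp_add]; congr 1; field_simp; ring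
              have e2 : Γ.q u t / (8 * τ) ≤ Real.exp (Γ.q u t / (8 * τ)) := by
                linarith [Real.add_one_le_exp (Γ.q u t / (8 * τ))]
              have e3 : Γ.q u t * Real.exp (-(Γ.q u t / (8 * τ))) ≤ 8 * τ := by
                rw [Real.exp_neg, ← div_eq_mul_inv, div_le_iff₀ (Real.exp_pos _)]
                rw [div_le_iff₀ (by positivity)] at e2
                linarith
              rw [e1]
              nlinarith [Real.exp_pos (-(Γ.q u t) / (4 * (2 * τ)))]
            have h2 : |Γ.S u t * Γ.kk u t| ≤ α * Γ.kk u t ^ 2 + (1 / (4 * α)) * Γ.q u t := by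
              have hSq : Γ.S u t ^ 2 ≤ Γ.q u t := by
                have := Γ.Sp u t
                nlinarith [sq_nonneg (Γ.p u t)]
              have e1 : |Γ.S u t * Γ.kk u t| ≤ α * Γ.kk u t ^ 2 + (1 / (4 * α)) * Γ.S u t ^ 2 := by
                have e3 : α * Γ.kk u t ^ 2 + (1 / (4 * α)) * Γ.S u t ^ 2
                    = |Γ.S u t| * |Γ.kk u t| + (2 * α * |Γ.kk u t| - |Γ.S u t|) ^ 2 / (4 * α) := by
                  rw [← sq_abs (Γ.kk u t), ← sq_abs (Γ.S u t)]
                  field_simp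
                  ring
                rw [abs_mul, e3]
                have : 0 ≤ (2 * α * |Γ.kk u t| - |Γ.S u t|) ^ 2 / (4 * α) := by positivity
                linarith
              refine e1.trans ?_
              gcongr
            calc |-(Γ.g u t * Γ.S u t * Real.exp (-(Γ.q u t) / (4 * τ)) * Γ.kk u t)|
                = Γ.g u t * Real.exp (-(Γ.q u t) / (4 * τ)) * |Γ.S u t * Γ.kk u t| := by
                  rw [abs_neg, show Γ.g u t * Γ.S u t * Real.exp (-(Γ.q u t) / (4 * τ)) * Γ.kk u t
                    = (Γ.g u t * Real.exp (-(Γ.q u t) / (4 * τ))) * (Γ.S u t * Γ.kk u t) by ring, abs_mul,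
                    abs_of_pos (mul_pos hg he)]
              _ ≤ Γ.g u t * Real.exp (-(Γ.q u t) / (4 * τ)) * (α * Γ.kk u t ^ 2 + (1 / (4 * α)) * Γ.q u t) := by
                  gcongr
              _ = α * (Γ.g u t * Γ.kk u t ^ 2 * Real.exp (-(Γ.q u t) / (4 * τ)))
                  + (1 / (4 * α)) * Γ.g u t * (Γ.q u t * Real.exp (-(Γ.q u t) / (4 * τ))) := by ring
              _ ≤ α * (Γ.g u t * Γ.kk u t ^ 2 * Real.exp (-(Γ.q u t) / (4 * τ)))
                  + (1 / (4 * α)) * Γ.g u t * (8 * τ * Real.exp (-(Γ.q u t) / (4 * (2 * τ)))) := by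
                  gcongr
              _ = _ := by ring
      _ = α * (∫ u in u₀..u₂, (Γ.g u t * Γ.kk u t ^ 2 * Real.exp (-(Γ.q u t) / (4 * τ))))
            + (1 / (4 * α)) * (8 * τ) * ∫ u in u₀..u₂, (Real.exp (-(Γ.q u t) / (4 * (2 * τ))) * Γ.g u t) := by
          rw [intervalIntegral.integral_add, intervalIntegral.integral_const_mul,
            intervalIntegral.integral_const_mul]
          · apply Continuous.intervalIntegrable; fun_prop
          · apply Continuous.intervalIntegrable; fun_prop
      _ ≤ _ := by
          gcongr
          exact Γ.ent' t ht0.le (2 * τ) (by positivity) _ _ h02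
  have hbound : α * (C1 / (√τ * ℓ)) + (1 / (4 * α)) * (8 * τ) * (Γ.M * √(4 * π * (2 * τ))) ≤ δ / 2 * √τ := by
    have e1 : √(4 * π * (2 * τ)) = √(8 * π) * √τ := by
      rw [← Real.sqrt_mul (by positivity)]; congr 1; ring
    rw [e1]
    have e2 : α * (C1 / (√τ * ℓ)) = (C1 / (C1 + 1)) * (δ / 4) * √τ := by
      rw [hα, hℓ]
      field_simp
      linear_combination -C1 * hss
    have e3 : (1 / (4 * α)) * (8 * τ) * (Γ.M * (√(8 * π) * √τ)) = C2 / (C2 + 1) * (δ / 4) * √τ := by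
      have : (1 / (4 * α)) * (8 * τ) * (Γ.M * (√(8 * π) * √τ)) = ε * C2 * √τ := by
        rw [hα, hC2]
        field_simp
        ring
      rw [this, hε]
      field_simp
    rw [e2, e3]
    have e4 : C1 / (C1 + 1) ≤ 1 := by rw [div_le_one (by positivity)]; linarith
    have e5 : C2 / (C2 + 1) ≤ 1 := by rw [div_le_one (by positivity)]; linarith
    have e6 := mul_le_mul_of_nonneg_right e4 (by positivity : 0 ≤ δ / 4 * √τ)
    have e7 := mul_le_mul_of_nonneg_right e5 (by positivity : 0 ≤ δ / 4 * √τ)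
    linarith
  have hp0 : √(Γ.q u₀ t) = |Γ.p u₀ t| := by
    rw [← Γ.Sp u₀ t, hS, ← Real.sqrt_sq_eq_abs]; simp
  have hQ2 : |Γ.p u₂ t * Real.exp (-(Γ.q u₂ t) / (4 * τ))| ≤ δ / 2 * √τ := by
    rw [abs_mul, abs_of_pos (Real.exp_pos _)]
    calc _ ≤ √(Γ.q u₂ t) * Real.exp (-(Γ.q u₂ t) / (4 * τ)) := by gcongr; exact Γ.p_abs _ _
      _ = √B * Real.exp (-B / 4) * √τ := by
          rw [hq2, Real.sqrt_mul (by linarith)]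
          have : -(B * τ) / (4 * τ) = -B / 4 := by field_simp
          rw [this]; ring
      _ ≤ _ := by gcongr
  have hQ0 : √(Γ.q u₀ t) * Real.exp (-(Γ.q u₀ t) / (4 * τ)) = |Γ.p u₀ t * Real.exp (-(Γ.q u₀ t) / (4 * τ))| := by
    rw [abs_mul, abs_of_pos (Real.exp_pos _), hp0]
  rw [hQ0]
  have : Γ.p u₀ t * Real.exp (-(Γ.q u₀ t) / (4 * τ)) = Γ.p u₂ t * Real.exp (-(Γ.q u₂ t) / (4 * τ))
      - ∫ u in u₀..u₂, -(Γ.g u t * Γ.S u t * Real.exp (-(Γ.q u t) / (4 * τ)) * Γ.kk u t) := by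
    rw [hFTC]; ring
  rw [this]
  refine (abs_sub _ _).trans ?_
  linarith
end CFlow

/-- incomplete Gaussian integral -/
def Th (r : ℝ) : ℝ := ∫ x in (0:ℝ)..r, Real.exp (-x ^ 2 / 4)

theorem Th_deriv (r : ℝ) : HasDerivAt Th (Real.exp (-r ^ 2 / 4)) r := by
  have hc : Continuous fun x : ℝ => Real.exp (-x ^ 2 / 4) := by fun_prop
  exact intervalIntegral.integral_hasDerivAt_right (hc.intervalIntegrable _ _)
    hc.stronglyMeasurable.stronglyMeasurableAtFilter hc.continuousAt

theorem Th_mono : Monotone Th :=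
  monotone_of_deriv_nonneg (fun r => (Th_deriv r).differentiableAt)
    (fun r => by rw [(Th_deriv r).deriv]; positivity)

theorem Th_le (r : ℝ) (hr : 0 ≤ r) : Th r ≤ r := by
  have hc : Continuous fun x : ℝ => Real.exp (-x ^ 2 / 4) := by fun_prop
  calc Th r ≤ ∫ x in (0:ℝ)..r, (1:ℝ) := by
        apply intervalIntegral.integral_mono_on hr (hc.intervalIntegrable _ _) (by simp)
        intro x _
        rw [Real.exp_le_one_iff]
        have := sq_nonneg x
        linarith
    _ = r := by simp

theorem Th_tendsto : Tendsto Th atTop (nhds (√π)) := by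
  have h1 := integral_gaussian_Ioi (1 / 4)
  have h2 : √(π / (1 / 4)) / 2 = √π := by
    rw [show π / (1 / 4) = 2 ^ 2 * π by ring, Real.sqrt_mul (by positivity), Real.sqrt_sq (by norm_num)]
    ring
  rw [h2] at h1
  have h3 : (fun x : ℝ => Real.exp (-(1 / 4) * x ^ 2)) = fun x => Real.exp (-x ^ 2 / 4) := by
    funext x; congr 1; ring
  have h4 : Integrable (fun x : ℝ => Real.exp (-(1 / 4) * x ^ 2)) := integrable_exp_neg_mul_sq (by norm_num)
  rw [h3] at h1 h4
  rw [← h1]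
  exact intervalIntegral_tendsto_integral_Ioi 0 h4.integrableOn tendsto_id

theorem exists_B (δ B₀ : ℝ) (hδ : 0 < δ) : ∃ B, 1 ≤ B ∧ B₀ ≤ B ∧ √B * Real.exp (-B / 4) ≤ δ / 2 := by
  set B := max (max 1 B₀) (64 / δ) with hB
  have h1 : 1 ≤ B := (le_max_left _ _).trans (le_max_left _ _)
  refine ⟨B, h1, (le_max_right _ _).trans (le_max_left _ _), ?_⟩
  have h2 : 64 / δ ≤ B := le_max_right _ _
  rw [div_le_iff₀ hδ] at h2
  have h3 : √B ≤ B := by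
    rw [Real.sqrt_le_left (by linarith)]; nlinarith
  have h4 := Real.quadratic_le_exp_of_nonneg (show 0 ≤ B / 4 by linarith)
  have h5 : B * 64 ≤ Real.exp (B / 4) * (B * δ * 32) := by
    have e1 : B ^ 2 / 32 ≤ Real.exp (B / 4) := by nlinarith
    have e2 : B ^ 2 / 32 * (B * δ * 32) ≤ Real.exp (B / 4) * (B * δ * 32) := by gcongr
    nlinarith [mul_le_mul_of_nonneg_left h2 (by positivity : 0 ≤ B ^ 2)]
  rw [neg_div, Real.exp_neg, ← div_eq_mul_inv, div_le_iff₀ (Real.exp_pos _)]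
  have h6 : 64 ≤ Real.exp (B / 4) * (δ * 32) := by
    have : B * 64 ≤ B * (Real.exp (B / 4) * (δ * 32)) := by linarith
    exact le_of_mul_le_mul_left this (by linarith)
  have e1 : B ^ 2 / 32 ≤ Real.exp (B / 4) := by nlinarith
  have e2 : B ^ 2 / 32 * (δ / 2) ≤ Real.exp (B / 4) * (δ / 2) := by gcongr
  nlinarith

namespace CFlow
variable (Γ : CFlow)

theorem arc (t : ℝ) (ht : t < 0) (ε : ℝ) (hε : 0 < ε) (a b : ℝ) (hab : a ≤ b) :
    √(-t) * |Th (√((Γ.q b t + ε) / (-t))) - Th (√((Γ.q a t + ε) / (-t)))| ≤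
      ∫ u in a..b, Real.exp (-(Γ.q u t) / (4 * (-t))) * Γ.g u t := by
  set τ := -t with hτ
  have hτ0 : 0 < τ := by linarith
  have hst : 0 < √τ := Real.sqrt_pos.2 hτ0
  have hpos : ∀ u, 0 < (Γ.q u t + ε) / τ := fun u => by
    have := Γ.q_nonneg u t
    positivity
  have hd : ∀ u, HasDerivAt (fun v => Th (√((Γ.q v t + ε) / τ)))
      (Real.exp (-(√((Γ.q u t + ε) / τ)) ^ 2 / 4) *
        ((2 * (Γ.g u t * Γ.S u t)) / τ / (2 * √((Γ.q u t + ε) / τ)))) u := fun u =>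
    (Th_deriv _).comp u ((((Γ.qu u t).add_const ε).div_const τ).sqrt (hpos u).ne')
  have cq := Γ.cq t
  have cg := Γ.cg t
  have cS := Γ.cS t
  have hc : Continuous fun u => (Real.exp (-(√((Γ.q u t + ε) / τ)) ^ 2 / 4) *
        ((2 * (Γ.g u t * Γ.S u t)) / τ / (2 * √((Γ.q u t + ε) / τ)))) := by
    refine Continuous.mul (by fun_prop) (Continuous.div (by fun_prop) (by fun_prop) fun u => ?_)
    have := Real.sqrt_pos.2 (hpos u)
    positivity
  have hci : Continuous fun u => Real.exp (-(Γ.q u t) / (4 * τ)) * Γ.g u t := by fun_prop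
  rw [← intervalIntegral.integral_eq_sub_of_hasDerivAt (fun u _ => hd u) (hc.intervalIntegrable _ _)]
  calc _ ≤ √τ * ∫ u in a..b, |(Real.exp (-(√((Γ.q u t + ε) / τ)) ^ 2 / 4) *
        ((2 * (Γ.g u t * Γ.S u t)) / τ / (2 * √((Γ.q u t + ε) / τ))))| := by
        gcongr
        exact intervalIntegral.abs_integral_le_integral_abs hab
    _ = ∫ u in a..b, √τ * |(Real.exp (-(√((Γ.q u t + ε) / τ)) ^ 2 / 4) *
        ((2 * (Γ.g u t * Γ.S u t)) / τ / (2 * √((Γ.q u t + ε) / τ))))| := by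
        rw [intervalIntegral.integral_const_mul]
    _ ≤ _ := by
        apply intervalIntegral.integral_mono_on hab ((hc.abs.const_mul _).intervalIntegrable _ _)
          (hci.intervalIntegrable _ _)
        intro u _
        have hg := Γ.gpos u t
        have hr := Real.sqrt_pos.2 (hpos u)
        have hq := Γ.q_nonneg u t
        rw [Real.sq_sqrt (hpos u).le |> fun h => (by rw [neg_div, neg_div, h] :
          -√((Γ.q u t + ε) / τ) ^ 2 / 4 = -((Γ.q u t + ε) / τ) / 4)]
        have h1 : Real.exp (-((Γ.q u t + ε) / τ) / 4) ≤ Real.exp (-(Γ.q u t) / (4 * τ)) := by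
          apply Real.exp_le_exp.2
          rw [show -((Γ.q u t + ε) / τ) / 4 = -(Γ.q u t + ε) / (4 * τ) by field_simp]
          gcongr
          linarith
        have h2 : |Γ.S u t| ≤ √τ * √((Γ.q u t + ε) / τ) := by
          rw [← Real.sqrt_mul hτ0.le, mul_div_cancel₀ _ hτ0.ne']
          exact (Γ.S_abs u t).trans (Real.sqrt_le_sqrt (by linarith))
        rw [abs_mul, abs_of_pos (Real.exp_pos _), abs_div, abs_div, abs_mul, abs_mul, abs_of_pos hτ0,
          abs_of_pos hg, abs_of_pos (by positivity : 0 < 2 * √((Γ.q u t + ε) / τ)), abs_two]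
        have h3 : √τ * (2 * (Γ.g u t * |Γ.S u t|) / τ / (2 * √((Γ.q u t + ε) / τ))) ≤ Γ.g u t := by
          have hss : √τ * √τ = τ := Real.mul_self_sqrt hτ0.le
          rw [div_div, ← mul_div_assoc, div_le_iff₀ (by positivity)]
          calc √τ * (2 * (Γ.g u t * |Γ.S u t|)) ≤ √τ * (2 * (Γ.g u t * (√τ * √((Γ.q u t + ε) / τ)))) := by
                gcongr
            _ = Γ.g u t * ((√τ * √τ) * (2 * √((Γ.q u t + ε) / τ))) := by ring
            _ = _ := by rw [hss]
        calc _ = Real.exp (-((Γ.q u t + ε) / τ) / 4) * (√τ * (2 * (Γ.g u t * |Γ.S u t|) / τ / (2 * √((Γ.q u t + ε) / τ)))) := by ring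
          _ ≤ _ := by gcongr

theorem S_zero_of_extr (t u : ℝ) (h : IsLocalMin (fun v => Γ.q v t) u ∨ IsLocalMax (fun v => Γ.q v t) u) :
    Γ.S u t = 0 := by
  have h0 : 2 * (Γ.g u t * Γ.S u t) = 0 := by
    rcases h with h | h
    · exact h.hasDerivAt_eq_zero (Γ.qu u t)
    · exact h.hasDerivAt_eq_zero (Γ.qu u t)
  have := (Γ.gpos u t).ne'
  simpa [this] using h0

theorem crit_min (t a b y : ℝ) (hy : y ∈ Icc a b) (ha : Γ.q y t < Γ.q a t) (hb : Γ.q y t < Γ.q b t) :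
    ∃ u ∈ Ioo a b, Γ.S u t = 0 ∧ Γ.q u t ≤ Γ.q y t := by
  obtain ⟨u, hu, hmin⟩ := isCompact_Icc.exists_isMinOn ⟨y, hy⟩ (Γ.cq t).continuousOn
  have huy : Γ.q u t ≤ Γ.q y t := hmin hy
  have h1 : a < u := lt_of_le_of_ne hu.1 (by rintro rfl; linarith)
  have h2 : u < b := lt_of_le_of_ne hu.2 (by rintro rfl; linarith)
  exact ⟨u, ⟨h1, h2⟩, Γ.S_zero_of_extr t u (Or.inl (hmin.isLocalMin (Icc_mem_nhds h1 h2))), huy⟩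

theorem crit_max (t a b y : ℝ) (hy : y ∈ Icc a b) (ha : Γ.q a t < Γ.q y t) (hb : Γ.q b t < Γ.q y t) :
    ∃ u ∈ Ioo a b, Γ.S u t = 0 ∧ Γ.q y t ≤ Γ.q u t := by
  obtain ⟨u, hu, hmin⟩ := isCompact_Icc.exists_isMaxOn ⟨y, hy⟩ (Γ.cq t).continuousOn
  have huy : Γ.q y t ≤ Γ.q u t := hmin hy
  have h1 : a < u := lt_of_le_of_ne hu.1 (by rintro rfl; linarith)
  have h2 : u < b := lt_of_le_of_ne hu.2 (by rintro rfl; linarith)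
  exact ⟨u, ⟨h1, h2⟩, Γ.S_zero_of_extr t u (Or.inr (hmin.isLocalMax (Icc_mem_nhds h1 h2))), huy⟩
end CFlow

namespace CFlow
variable (Γ : CFlow)

theorem core_static (m : ℕ) (hM : Γ.M = m) (t : ℝ) (ht : t < 0) (ρ δ r2 B : ℝ) (hρ : 0 < ρ) (hr2 : 1 ≤ r2)
    (hδ1 : δ ≤ ρ / 5) (hδ0 : 0 < δ) (hδ2 : δ ≤ Real.exp (-r2 ^ 2 / 4)) (hB3 : 3 ≤ B) (hBr : r2 ^ 2 ≤ B)
    (hbig : m * √π < (m + 1) * (Th r2 - ρ))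
    (hgood : ∀ u, Γ.S u t = 0 → Γ.q u t ≤ B * (-t) →
      √(Γ.q u t) * Real.exp (-(Γ.q u t) / (4 * (-t))) ≤ δ * √(-t))
    (y : ℕ → ℝ) (hy : ∀ i < 2 * m, y i ≤ y (i + 1))
    (hlow : ∀ j ≤ m, Γ.q (y (2 * j)) t ≤ 3 * (-t))
    (hhigh : ∀ j < m, -t ≤ Γ.q (y (2 * j + 1)) t)
    (h1 : ∀ j < m, Γ.q (y (2 * j)) t < Γ.q (y (2 * j + 1)) t)
    (h2 : ∀ j < m, Γ.q (y (2 * j + 2)) t < Γ.q (y (2 * j + 1)) t) : False := by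
  set τ := -t with hτ
  have hτ0 : 0 < τ := by linarith
  have hst : 0 < √τ := Real.sqrt_pos.2 hτ0
  obtain ⟨U, hU0, hU⟩ := Γ.up (3 * τ + r2 ^ 2 * τ) t t ht.le
  have hU' : ∀ u, U ≤ |u| → 3 * τ + r2 ^ 2 * τ ≤ Γ.q u t := hU t le_rfl le_rfl
  have hrτ : 0 < r2 ^ 2 * τ := by positivity
  have hlowU : ∀ j ≤ m, |y (2 * j)| < U := fun j hj => by
    by_contra hc
    push Not at hc
    linarith [hU' _ hc, hlow j hj]
  have hqU : 3 * τ + r2 ^ 2 * τ ≤ Γ.q U t := hU' U (by rw [abs_of_pos hU0])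
  have hqU' : 3 * τ + r2 ^ 2 * τ ≤ Γ.q (-U) t := hU' (-U) (by rw [abs_neg, abs_of_pos hU0])
  -- the separating high points
  obtain ⟨H, hH0, hHm, hHj⟩ : ∃ H : ℕ → ℝ, H 0 = -U ∧ H (m + 1) = U ∧ ∀ j < m, H (j + 1) = y (2 * j + 1) := by
    refine ⟨fun j => if j = 0 then -U else if j = m + 1 then U else y (2 * j - 1), by simp, by simp, ?_⟩
    intro j hj
    have : j ≠ m := hj.ne
    simp [this, show 2 * (j + 1) - 1 = 2 * j + 1 by omega]
  have hHl : ∀ j ≤ m, H j ≤ y (2 * j) ∧ Γ.q (y (2 * j)) t < Γ.q (H j) t := by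
    intro j hj
    rcases j with _ | j
    · rw [hH0]
      exact ⟨by linarith [(abs_lt.1 (hlowU 0 hj)).1], by linarith [hlow 0 hj]⟩
    · rw [hHj j hj]
      exact ⟨hy (2 * j + 1) (by omega), h2 j hj⟩
  have hHr : ∀ j ≤ m, y (2 * j) ≤ H (j + 1) ∧ Γ.q (y (2 * j)) t < Γ.q (H (j + 1)) t := by
    intro j hj
    rcases hj.lt_or_eq with hj' | rfl
    · rw [hHj j hj']
      exact ⟨hy (2 * j) (by omega), h1 j hj'⟩
    · rw [hHm]
      exact ⟨by linarith [(abs_lt.1 (hlowU j hj)).2], by linarith [hlow j hj]⟩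
  have hu : ∀ j, ∃ u, j ≤ m → (u ∈ Ioo (H j) (H (j + 1)) ∧ Γ.S u t = 0 ∧ Γ.q u t ≤ Γ.q (y (2 * j)) t) := by
    intro j
    by_cases hj : j ≤ m
    · obtain ⟨u, a, b, c⟩ := Γ.crit_min t (H j) (H (j + 1)) (y (2 * j)) ⟨(hHl j hj).1, (hHr j hj).1⟩
        (hHl j hj).2 (hHr j hj).2
      exact ⟨u, fun _ => ⟨a, b, c⟩⟩
    · exact ⟨0, fun h => absurd h hj⟩
  choose u hu using hu
  have hW : ∀ j, ∃ w, (j = 0 → w = -U) ∧ (j = m + 1 → w = U) ∧ (j ≤ m → w < u j) ∧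
      (∀ i, j = i + 1 → i ≤ m → u i < w) ∧ (j ≤ m + 1 → r2 ^ 2 * τ ≤ Γ.q w t) := by
    intro j
    rcases j with _ | j
    · refine ⟨-U, fun _ => rfl, fun h => by omega, fun h => ?_, fun i hi => by omega, fun _ => by linarith⟩
      rw [← hH0]; exact (hu 0 h).1.1
    · by_cases hj : j < m
      · obtain ⟨w, a, b, c⟩ := Γ.crit_max t (u j) (u (j + 1)) (H (j + 1))
          ⟨(hu j hj.le).1.2.le, (hu (j + 1) hj).1.1.le⟩
          ((hu j hj.le).2.2.trans_lt (hHr j hj.le).2) ((hu (j + 1) hj).2.2.trans_lt (hHl (j + 1) hj).2)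
        refine ⟨w, fun h => by omega, fun h => by omega, fun _ => a.2, fun i hi _ => ?_, fun _ => ?_⟩
        · obtain rfl : j = i := by omega
          exact a.1
        · rw [hHj j hj] at c
          have hqw := (hhigh j hj).trans c
          by_contra hlt
          push Not at hlt
          have hg := hgood w b (by nlinarith)
          have e1 : √τ ≤ √(Γ.q w t) := Real.sqrt_le_sqrt hqw
          have e2 : Real.exp (-r2 ^ 2 / 4) < Real.exp (-(Γ.q w t) / (4 * τ)) := by
            apply Real.exp_lt_exp.2
            rw [div_lt_div_iff₀ (by norm_num) (by positivity)]
            nlinarith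
          have e3 : δ * √τ < Real.exp (-(Γ.q w t) / (4 * τ)) * √τ := by
            apply mul_lt_mul_of_pos_right _ hst
            linarith
          have e4 : Real.exp (-(Γ.q w t) / (4 * τ)) * √τ ≤ Real.exp (-(Γ.q w t) / (4 * τ)) * √(Γ.q w t) := by
            gcongr
          linarith
      · refine ⟨U, fun h => by omega, fun _ => rfl, fun h => by omega, fun i hi him => ?_, fun _ => by linarith⟩
        obtain rfl : j = i := by omega
        obtain rfl : m = j := by omega
        rw [← hHm]
        exact (hu m le_rfl).1.2
  choose W hW0 hWm hWl hWr hWq using hW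
  have hsmall : ∀ j ≤ m, Γ.q (u j) t ≤ ρ ^ 2 / 2 * τ := by
    intro j hj
    have hq3 := (hu j hj).2.2.trans (hlow j hj)
    have hg := hgood (u j) (hu j hj).2.1 (by nlinarith)
    have hq0 := Γ.q_nonneg (u j) t
    have e1 : (1 : ℝ) / 3 ≤ Real.exp (-(Γ.q (u j) t) / (4 * τ)) := by
      have : Real.exp (-1) ≤ Real.exp (-(Γ.q (u j) t) / (4 * τ)) := by
        apply Real.exp_le_exp.2
        rw [le_div_iff₀ (by positivity)]
        linarith
      refine le_trans ?_ this
      rw [Real.exp_neg, one_div]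
      apply inv_anti₀ (Real.exp_pos _)
      linarith [Real.exp_one_lt_d9]
    have e2 : √(Γ.q (u j) t) * (1 / 3) ≤ δ * √τ := le_trans (by gcongr) hg
    have e3 : √(Γ.q (u j) t) ≤ 3 / 5 * ρ * √τ := by nlinarith
    have e4 : √(Γ.q (u j) t) ^ 2 ≤ (3 / 5 * ρ * √τ) ^ 2 := by gcongr
    rw [Real.sq_sqrt hq0, mul_pow, Real.sq_sqrt hτ0.le] at e4
    have : 0 ≤ ρ ^ 2 * τ := by positivity
    nlinarith
  set ε := ρ ^ 2 / 2 * τ with hε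
  have hε0 : 0 < ε := by positivity
  have hThu : ∀ j ≤ m, Th (√((Γ.q (u j) t + ε) / τ)) ≤ ρ := by
    intro j hj
    have e : √((Γ.q (u j) t + ε) / τ) ≤ ρ := by
      rw [Real.sqrt_le_left hρ.le, div_le_iff₀ hτ0]
      have := hsmall j hj
      linarith
    exact (Th_le _ (Real.sqrt_nonneg _)).trans e
  have hThW : ∀ j ≤ m + 1, Th r2 ≤ Th (√((Γ.q (W j) t + ε) / τ)) := by
    intro j hj
    apply Th_mono
    apply Real.le_sqrt_of_sq_le
    rw [le_div_iff₀ hτ0]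
    linarith [hWq j hj]
  have cq := Γ.cq t
  have cg := Γ.cg t
  have hci : Continuous fun u => Real.exp (-(Γ.q u t) / (4 * τ)) * Γ.g u t := by fun_prop
  have hseg : ∀ j ≤ m, 2 * √τ * (Th r2 - ρ) ≤
      ∫ u in W j..W (j + 1), Real.exp (-(Γ.q u t) / (4 * τ)) * Γ.g u t := by
    intro j hj
    have a1 := Γ.arc t ht ε hε0 (W j) (u j) (hWl j hj).le
    have a2 := Γ.arc t ht ε hε0 (u j) (W (j + 1)) (hWr (j + 1) j rfl hj).le
    rw [← hτ] at a1 a2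
    rw [← intervalIntegral.integral_add_adjacent_intervals (hci.intervalIntegrable (W j) (u j))
      (hci.intervalIntegrable _ _)]
    have b1 := hThW j (by omega)
    have b2 := hThW (j + 1) (by omega)
    have b3 := hThu j hj
    have c1 : Th r2 - ρ ≤ |Th (√((Γ.q (u j) t + ε) / τ)) - Th (√((Γ.q (W j) t + ε) / τ))| := by
      rw [abs_sub_comm]; exact le_trans (by linarith) (le_abs_self _)
    have c2 : Th r2 - ρ ≤ |Th (√((Γ.q (W (j + 1)) t + ε) / τ)) - Th (√((Γ.q (u j) t + ε) / τ))| :=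
      le_trans (by linarith) (le_abs_self _)
    have d1 := mul_le_mul_of_nonneg_left c1 hst.le
    have d2 := mul_le_mul_of_nonneg_left c2 hst.le
    linarith
  have hsum := intervalIntegral.sum_integral_adjacent_intervals (μ := volume) (a := W) (n := m + 1)
    (fun k _ => hci.intervalIntegrable (W k) (W (k + 1)))
  have hge : ∑ _k ∈ Finset.range (m + 1), 2 * √τ * (Th r2 - ρ) ≤
      ∑ k ∈ Finset.range (m + 1), ∫ u in W k..W (k + 1), Real.exp (-(Γ.q u t) / (4 * τ)) * Γ.g u t :=
    Finset.sum_le_sum fun k hk => hseg k (by have := Finset.mem_range.1 hk; omega)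
  rw [hsum, hW0 0 rfl, hWm (m + 1) rfl] at hge
  have hent := Γ.ent t ht.le τ hτ0 (-U) U (by linarith)
  have hent' : ∫ u in (-U)..U, Real.exp (-(Γ.q u t) / (4 * τ)) * Γ.g u t ≤ Γ.M * √(4 * π * τ) := hent
  rw [hM, show 4 * π * τ = 2 ^ 2 * (π * τ) by ring, Real.sqrt_mul (by positivity), Real.sqrt_sq (by norm_num),
    Real.sqrt_mul (by positivity)] at hent'
  simp only [Finset.sum_const, Finset.card_range, nsmul_eq_mul] at hge
  push_cast at hge
  nlinarith [mul_lt_mul_of_pos_right hbig hst]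

theorem exists_gap (n : ℕ) (f : ℕ → ℝ) (hf : ∀ i < n, 0 < f i) : ∃ G, 0 < G ∧ ∀ i < n, G ≤ f i := by
  induction n with
  | zero => exact ⟨1, one_pos, fun i hi => by omega⟩
  | succ n ih =>
    obtain ⟨G, hG, h⟩ := ih fun i hi => hf i (by omega)
    refine ⟨min G (f n), lt_min hG (hf n (by omega)), fun i hi => ?_⟩
    rcases Nat.lt_succ_iff_lt_or_eq.1 hi with h' | rfl
    · exact (min_le_left _ _).trans (h i h')
    · exact min_le_right _ _

theorem core (m : ℕ) (hM : Γ.M = m) (t₀ : ℝ) (ht₀ : t₀ ≤ 0) (z : ℕ → ℝ) (hz : ∀ i < 2 * m, z i ≤ z (i + 1))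
    (halt : ∀ i < 2 * m, 0 < (-1) ^ i * (Γ.q (z (i + 1)) t₀ - Γ.q (z i) t₀)) : False := by
  have hπ : 0 < √π := Real.sqrt_pos.2 Real.pi_pos
  have hm1 : (0 : ℝ) < m + 1 := by positivity
  set ρ := √π / (4 * (m + 1)) with hρ
  have hρ0 : 0 < ρ := by positivity
  have hρm : (m + 1) * ρ = √π / 4 := by rw [hρ]; field_simp
  have hev : ∀ᶠ r in atTop, √π - 2 * ρ < Th r := Th_tendsto.eventually (lt_mem_nhds (by linarith))
  obtain ⟨r2, hTh, hr2⟩ := (hev.and (eventually_ge_atTop 1)).exists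
  have hbig : m * √π < (m + 1) * (Th r2 - ρ) := by
    have := mul_lt_mul_of_pos_left hTh hm1
    nlinarith
  set δ := min (ρ / 5) (Real.exp (-r2 ^ 2 / 4)) with hδ
  have hδ0 : 0 < δ := lt_min (by positivity) (Real.exp_pos _)
  obtain ⟨B, hB1, hB2, hB3⟩ := exists_B δ (max 3 (r2 ^ 2)) hδ0
  obtain ⟨G, hG0, hG⟩ := exists_gap (2 * m) _ halt
  set L : ℕ → ℝ := fun i => Γ.q (z i) t₀ + 2 * t₀ with hL
  set C0 := ∑ i ∈ Finset.range (2 * m + 1), |L i| + G with hC0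
  have hLC : ∀ i ≤ 2 * m, |L i| + G ≤ C0 := fun i hi => by
    have := Finset.single_le_sum (f := fun i => |L i|) (fun i _ => abs_nonneg (L i))
      (Finset.mem_range.2 (by omega : i < 2 * m + 1))
    rw [hC0]; linarith
  obtain ⟨t₁, ht₁, hgood⟩ := Γ.good_time δ B (max (max 1 C0) (-t₀ + 1)) hδ0 hB1 (by positivity) hB3
  have k1 : max (max 1 C0) (-t₀ + 1) < -t₁ := by linarith
  have k2 : 1 < -t₁ := ((le_max_left 1 C0).trans (le_max_left _ _)).trans_lt k1
  have k3 : C0 < -t₁ := ((le_max_right 1 C0).trans (le_max_left _ _)).trans_lt k1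
  have k4 : -t₀ + 1 < -t₁ := (le_max_right _ _).trans_lt k1
  have h10 : 0 < t₀ - t₁ := by linarith
  obtain ⟨y, hy, hy'⟩ := Γ.flow_track t₁ t₀ (by linarith) ht₀ m L (fun _ => 0) (fun _ => 0) (fun _ => 0)
    (fun u => hasDerivAt_const _ _) (fun u => hasDerivAt_const _ _) (by simp) 0 0 (G / (4 * (t₀ - t₁)))
    le_rfl (by positivity) (by simp; positivity) (by simp) (fun i hi => by
      have : 2 * (G / (4 * (t₀ - t₁))) * (t₀ - t₁) = G / 2 := by field_simp; norm_num
      rw [this]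
      have := hG i hi
      simp only [hL]
      have e : Γ.q (z (i + 1)) t₀ + 2 * t₀ - (Γ.q (z i) t₀ + 2 * t₀) = Γ.q (z (i + 1)) t₀ - Γ.q (z i) t₀ := by ring
      rw [e]; linarith) z hz (fun i hi => by simp [hL])
  have e0 : G / (4 * (t₀ - t₁)) * (t₀ - t₁) = G / 4 := by field_simp
  simp only [e0, zero_mul, add_zero] at hy'
  have hlo : ∀ j ≤ m, Γ.q (y (2 * j)) t₁ + 2 * t₁ - L (2 * j) ≤ G / 4 := fun j hj => by
    have := hy' (2 * j) (by omega)
    rwa [pow_mul, neg_one_sq, one_pow, one_mul] at this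
  have hhi : ∀ j < m, -(G / 4) ≤ Γ.q (y (2 * j + 1)) t₁ + 2 * t₁ - L (2 * j + 1) := fun j hj => by
    have := hy' (2 * j + 1) (by omega)
    rw [pow_succ, pow_mul, neg_one_sq, one_pow, one_mul] at this
    linarith
  have g1 : ∀ j < m, G ≤ L (2 * j + 1) - L (2 * j) := fun j hj => by
    have := hG (2 * j) (by omega)
    rw [pow_mul, neg_one_sq, one_pow, one_mul] at this
    simp only [hL]; linarith
  have g2 : ∀ j < m, G ≤ L (2 * j + 1) - L (2 * j + 2) := fun j hj => by
    have := hG (2 * j + 1) (by omega)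
    rw [pow_succ, pow_mul, neg_one_sq, one_pow, one_mul] at this
    simp only [hL]
    rw [show 2 * j + 1 + 1 = 2 * j + 2 by ring] at this
    linarith
  refine Γ.core_static m hM t₁ (by linarith) ρ δ r2 B hρ0 hr2 (min_le_left _ _) hδ0 (min_le_right _ _)
    ((le_max_left _ _).trans hB2) ((le_max_right _ _).trans hB2) hbig hgood y hy ?_ ?_ ?_ ?_
  · intro j hj
    have := hlo j hj
    have := hLC (2 * j) (by omega)
    have := le_abs_self (L (2 * j))
    linarith
  · intro j hj
    have := hhi j hj
    have := hLC (2 * j + 1) (by omega)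
    have := neg_abs_le (L (2 * j + 1))
    linarith
  · intro j hj
    linarith [hlo j hj.le, hhi j hj, g1 j hj]
  · intro j hj
    have := hlo (j + 1) hj
    rw [show 2 * (j + 1) = 2 * j + 2 by ring] at this
    linarith [hhi j hj, g2 j hj]
end CFlow

theorem left_deriv_nonpos (f : ℝ → ℝ) (d t t1 : ℝ) (h1 : t1 < t) (hf : HasDerivAt f d t)
    (hmin : ∀ r, t1 ≤ r → r ≤ t → f t ≤ f r) : d ≤ 0 := by
  have h := (hasDerivWithinAt_iff_tendsto_slope' (s := Iio t) (by simp)).1 hf.hasDerivWithinAt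
  refine le_of_tendsto h ?_
  have : Ioo t1 t ∈ nhdsWithin t (Iio t) := Ioo_mem_nhdsLT h1
  filter_upwards [this] with r hr
  rw [slope_def_field]
  have := hmin r hr.1.le hr.2.le
  exact div_nonpos_of_nonneg_of_nonpos (by linarith) (by linarith [hr.2])

namespace CFlow
variable (Γ : CFlow)

theorem smp (σ C t1 t2 p' q' : ℝ) (h12 : t1 < t2) (h20 : t2 < 0) (hpq : p' < q')
    (hp : ∀ t ∈ Icc t1 t2, 0 < σ * (Γ.q p' t + 2 * t - C))
    (hq : ∀ t ∈ Icc t1 t2, 0 ≤ σ * (Γ.q q' t + 2 * t - C))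
    (hbot : ∀ u ∈ Icc p' q', 0 ≤ σ * (Γ.q u t1 + 2 * t1 - C)) :
    ∀ y, p' ≤ y → y < q' → 0 < σ * (Γ.q y t2 + 2 * t2 - C) := by
  have cq := Γ.contq
  have cg := Γ.contg
  have cgu := Γ.contgu
  -- lower bound on the left side
  have hcl : Continuous fun t => σ * (Γ.q p' t + 2 * t - C) := by
    have : Continuous fun t => Γ.q p' t := cq.comp (by fun_prop : Continuous fun t : ℝ => (p', t))
    fun_prop
  obtain ⟨tm, htm, hmin⟩ := isCompact_Icc.exists_isMinOn (nonempty_Icc.2 h12.le) hcl.continuousOn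
  set ε := σ * (Γ.q p' tm + 2 * tm - C) with hε
  have hε0 : 0 < ε := hp tm htm
  have hεle : ∀ t ∈ Icc t1 t2, ε ≤ σ * (Γ.q p' t + 2 * t - C) := fun t ht => hmin ht
  set ℓ := q' - p' with hℓ
  have hℓ0 : 0 < ℓ := by linarith
  set M := ℓ / (t2 - t1) with hM
  have hM0 : 0 < M := div_pos hℓ0 (by linarith)
  have hMt : M * (t2 - t1) = ℓ := div_mul_cancel₀ _ (by linarith)
  have hcA : Continuous fun x : ℝ × ℝ => (M * Γ.g x.1 x.2 ^ 3 - Γ.gu x.1 x.2) / Γ.g x.1 x.2 :=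
    Continuous.div (by fun_prop) cg fun x => (Γ.gpos _ _).ne'
  obtain ⟨A0, hA0⟩ := ((isCompact_Icc (a := p') (b := q')).prod (isCompact_Icc (a := t1) (b := t2))).bddAbove_image
    hcA.continuousOn
  set A := max A0 0 + 1 with hA
  have hA0' : 0 < A := by positivity
  have hAineq : ∀ u ∈ Icc p' q', ∀ t ∈ Icc t1 t2, M * Γ.g u t ^ 3 - Γ.gu u t < A * Γ.g u t := by
    intro u hu t ht
    have := hA0 (mem_image_of_mem _ (mk_mem_prod hu ht))
    simp only at this
    rw [div_le_iff₀ (Γ.gpos _ _)] at this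
    have hg := Γ.gpos u t
    have : A0 * Γ.g u t < A * Γ.g u t := by
      apply mul_lt_mul_of_pos_right _ hg
      have := le_max_left A0 0
      linarith
    linarith
  set E : ℝ → ℝ → ℝ := fun u t => Real.exp (-A * ((u - p') + M * (t2 - t))) with hE
  set e0 := Real.exp (-A * ℓ) with he0
  set D : ℝ → ℝ → ℝ := fun u t => σ * (Γ.q u t + 2 * t - C) - ε * (E u t - e0) with hD
  have hDc : Continuous fun x : ℝ × ℝ => D x.1 x.2 := by
    simp only [hD, hE]; fun_prop
  have hDnn : ∀ u ∈ Icc p' q', ∀ t ∈ Icc t1 t2, 0 ≤ D u t := by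
    obtain ⟨⟨u, t⟩, hx, hm⟩ := ((isCompact_Icc (a := p') (b := q')).prod
      (isCompact_Icc (a := t1) (b := t2))).exists_isMinOn
      ⟨(p', t1), mk_mem_prod (left_mem_Icc.2 hpq.le) (left_mem_Icc.2 h12.le)⟩ hDc.continuousOn
    obtain ⟨hu, ht⟩ := hx
    simp only at hu ht
    have hm' : ∀ u' ∈ Icc p' q', ∀ t' ∈ Icc t1 t2, D u t ≤ D u' t' := fun u' hu' t' ht' =>
      hm (mk_mem_prod hu' ht')
    suffices 0 ≤ D u t from fun u' hu' t' ht' => this.trans (hm' u' hu' t' ht')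
    by_contra hneg
    push Not at hneg
    have hEge : ℓ ≤ (u - p') + M * (t2 - t) → E u t ≤ e0 := fun h => by
      apply Real.exp_le_exp.2
      nlinarith
    have hM2 : 0 ≤ M * (t2 - t) := mul_nonneg hM0.le (by linarith [ht.2])
    have hup : p' < u := by
      refine lt_of_le_of_ne hu.1 ?_
      rintro rfl
      have := hεle t ht
      have hE1 : E p' t ≤ 1 := by
        rw [hE]; simp only; rw [Real.exp_le_one_iff]; nlinarith
      have he : 0 < e0 := Real.exp_pos _
      simp only [hD] at hneg
      nlinarith
    have huq : u < q' := by
      refine lt_of_le_of_ne hu.2 ?_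
      rintro rfl
      have := hq t ht
      have := hEge (by linarith)
      simp only [hD] at hneg
      nlinarith
    have ht1 : t1 < t := by
      refine lt_of_le_of_ne ht.1 ?_
      rintro rfl
      have := hbot u hu
      have := hEge (by linarith)
      simp only [hD] at hneg
      nlinarith
    have ht0 : t < 0 := by linarith [ht.2]
    -- spatial derivatives
    have hEu : ∀ x, HasDerivAt (fun v => E v t) (-A * E x t) x := fun x => by
      have h1 : HasDerivAt (fun v : ℝ => -A * ((v - p') + M * (t2 - t))) (-A) x := by
        simpa using (((hasDerivAt_id x).sub_const p').add_const (M * (t2 - t))).const_mul (-A)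
      have := h1.exp
      refine this.congr_deriv ?_
      simp only [hE]; ring
    have hDu : ∀ x, HasDerivAt (fun v => D v t) (σ * (2 * (Γ.g x t * Γ.S x t)) - ε * (-A * E x t)) x := fun x => by
      have h1 := (((Γ.qu x t).add_const (2 * t)).sub_const C).const_mul σ
      have h2 := ((hEu x).sub_const e0).const_mul ε
      exact h1.sub h2
    have hDuu : HasDerivAt (fun x => σ * (2 * (Γ.g x t * Γ.S x t)) - ε * (-A * E x t))
        (σ * (2 * (Γ.gu u t * Γ.S u t + Γ.g u t * (Γ.g u t * (1 + Γ.k u t * Γ.p u t)))) -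
          ε * (-A * (-A * E u t))) u := by
      exact ((Γ.quu u t).const_mul σ).sub (((hEu u).const_mul (-A)).const_mul ε)
    have hloc : IsLocalMin (fun v => D v t) u := by
      filter_upwards [Icc_mem_nhds hup huq] with v hv
      exact hm' v hv t ht
    obtain ⟨c1, c2⟩ := second_deriv_min _ _ hDu u _ hDuu hloc
    have hEt : HasDerivAt (fun r => E u r) (A * M * E u t) t := by
      have h1 : HasDerivAt (fun r : ℝ => -A * ((u - p') + M * (t2 - r))) (-A * (M * (-1))) t := by
        simpa using ((((hasDerivAt_id t).const_sub t2).const_mul M).const_add (u - p')).const_mul (-A)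
      refine h1.exp.congr_deriv ?_
      simp only [hE]; ring
    have hDt : HasDerivAt (fun r => D u r) (σ * (2 * (Γ.k u t * Γ.p u t) + 2) - ε * (A * M * E u t)) t := by
      have h0 : HasDerivAt (fun r : ℝ => 2 * r) 2 t := by simpa using (hasDerivAt_id t).const_mul 2
      exact ((((Γ.qt' u t ht0).add h0).sub_const C).const_mul σ).sub ((hEt.sub_const e0).const_mul ε)
    have c3 := left_deriv_nonpos _ _ t t1 ht1 hDt fun r hr1 hr2 => hm' u hu r ⟨hr1, hr2.trans ht.2⟩
    have hg := Γ.gpos u t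
    have hAi := hAineq u hu t ht
    have hEp : 0 < E u t := Real.exp_pos _
    set g := Γ.g u t
    set S := Γ.S u t
    set gu := Γ.gu u t
    set kp := Γ.k u t * Γ.p u t
    set e := E u t
    -- combine
    have k1 : g ^ 2 * (σ * (2 * kp + 2) - ε * (A * M * e)) ≤ 0 :=
      mul_nonpos_of_nonneg_of_nonpos (by positivity) c3
    have k2 : g * (σ * (2 * S)) = - ε * A * e := by linarith
    have k3 : g * (σ * (2 * (gu * S + g * (g * (1 + kp)))) - ε * (-A * (-A * e))) -
        g * (g ^ 2 * (σ * (2 * kp + 2) - ε * (A * M * e))) = ε * A * e * (M * g ^ 3 - gu - A * g) := by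
      linear_combination gu * k2
    have k4 : ε * A * e * (M * g ^ 3 - gu - A * g) < 0 :=
      mul_neg_of_pos_of_neg (by positivity) (by linarith)
    have k5 := mul_nonneg hg.le c2
    have k6 := mul_nonpos_of_nonneg_of_nonpos hg.le k1
    linarith
  intro y hy1 hy2
  have h := hDnn y ⟨hy1, hy2.le⟩ t2 ⟨h12.le, le_rfl⟩
  have hlt : e0 < E y t2 := by
    apply Real.exp_lt_exp.2
    nlinarith
  simp only [hD] at h
  nlinarith
end CFlow

namespace CFlow
variable (Γ : CFlow)

/-- the solution of the linear heat equation along the flow -/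
def w (C u t : ℝ) : ℝ := Γ.q u t + 2 * t - C

theorem contw (C : ℝ) : Continuous (fun x : ℝ × ℝ => Γ.w C x.1 x.2) := by
  have := Γ.contq
  unfold w
  fun_prop

theorem contwt (C u : ℝ) : Continuous (fun t => Γ.w C u t) :=
  (Γ.contw C).comp (by fun_prop : Continuous fun t : ℝ => (u, t))

theorem contwu (C t : ℝ) : Continuous (fun u => Γ.w C u t) :=
  (Γ.contw C).comp (by fun_prop : Continuous fun u : ℝ => (u, t))

/-- a smooth oscillating function supported in `[a,b]` -/
theorem exists_osc (m : ℕ) (a b : ℝ) (hab : a < b) : ∃ v v' v'' : ℝ → ℝ, (∀ u, HasDerivAt v (v' u) u) ∧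
    (∀ u, HasDerivAt v' (v'' u) u) ∧ Continuous v'' ∧ (∀ u, |v u| ≤ 1) ∧
    (∀ u, u ∉ Icc a b → v u = 0 ∧ v' u = 0 ∧ v'' u = 0) ∧
    ∃ z : ℕ → ℝ, (∀ i < 2 * m, z i ≤ z (i + 1)) ∧ (∀ i ≤ 2 * m, z i ∈ Icc a b) ∧
      ∀ i ≤ 2 * m, v (z i) = -(-1) ^ i := by
  set c := (a + b) / 2 with hc
  let f : ContDiffBump c := ⟨(b - a) / 4, (b - a) / 2, by linarith, by linarith⟩
  have hfin : f.rIn = (b - a) / 4 := rfl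
  have hfout : f.rOut = (b - a) / 2 := rfl
  set ω := (2 * m + 1) * π / ((b - a) / 4) with hω
  have hω0 : 0 < ω := by
    have := Real.pi_pos
    have : 0 < b - a := by linarith
    positivity
  set v : ℝ → ℝ := fun u => -(f u * Real.cos (ω * (u - c))) with hv
  have hvs : ContDiff ℝ 2 v := by
    have h1 : ContDiff ℝ 2 (f : ℝ → ℝ) := f.contDiff
    have h2 : ContDiff ℝ 2 fun u : ℝ => Real.cos (ω * (u - c)) := by fun_prop
    exact (h1.mul h2).neg
  have hvs' : ContDiff ℝ 1 (deriv v) := by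
    have := (contDiff_succ_iff_deriv (n := 1)).1 hvs
    exact this.2.2
  have hvs'' : Continuous (deriv (deriv v)) := hvs'.continuous_deriv le_rfl
  have hzero : ∀ u, u ∉ Icc a b → v u = 0 := by
    intro u hu
    have : f u = 0 := by
      apply f.zero_of_le_dist
      rw [hfout, Real.dist_eq]
      by_contra hlt
      push Not at hlt
      rw [abs_lt] at hlt
      exact hu ⟨by linarith [hlt.1], by linarith [hlt.2]⟩
    simp [hv, this]
  have hopen : IsOpen (Icc a b)ᶜ := isClosed_Icc.isOpen_compl
  have hd1 : ∀ u, u ∉ Icc a b → deriv v u = 0 := by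
    intro u hu
    have : v =ᶠ[nhds u] fun _ => 0 := by
      filter_upwards [hopen.mem_nhds hu] with x hx using hzero x hx
    rw [this.deriv_eq]; simp
  have hd2 : ∀ u, u ∉ Icc a b → deriv (deriv v) u = 0 := by
    intro u hu
    have : deriv v =ᶠ[nhds u] fun _ => 0 := by
      filter_upwards [hopen.mem_nhds hu] with x hx using hd1 x hx
    rw [this.deriv_eq]; simp
  have hzc : ∀ i ≤ 2 * m, (i : ℝ) * π / ω ≤ (b - a) / 4 := by
    intro i hi
    rw [div_le_iff₀ hω0, hω, mul_div_cancel₀ _ (by linarith)]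
    have : (i : ℝ) ≤ 2 * m := by exact_mod_cast hi
    nlinarith [Real.pi_pos]
  refine ⟨v, deriv v, deriv (deriv v), fun u => (hvs.differentiable (by norm_num) u).hasDerivAt,
    fun u => (hvs'.differentiable (by norm_num) u).hasDerivAt, hvs'', ?_,
    fun u hu => ⟨hzero u hu, hd1 u hu, hd2 u hu⟩, fun i => c + i * π / ω, ?_, ?_, ?_⟩
  · intro u
    simp only [hv]
    rw [abs_neg, abs_mul, abs_of_nonneg f.nonneg]
    have h1 : f u ≤ 1 := f.le_one
    have h2 := Real.abs_cos_le_one (ω * (u - c))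
    have h3 : 0 ≤ f u := f.nonneg
    nlinarith [abs_nonneg (Real.cos (ω * (u - c)))]
  · intro i _
    have := Real.pi_pos
    push_cast
    gcongr
    linarith
  · intro i hi
    have h0 : 0 ≤ (i : ℝ) * π / ω := by have := Real.pi_pos; positivity
    have := hzc i hi
    constructor <;> simp only <;> linarith
  · intro i hi
    have h0 : 0 ≤ (i : ℝ) * π / ω := by have := Real.pi_pos; positivity
    have h1 := hzc i hi
    have : f (c + i * π / ω) = 1 := by
      apply f.one_of_mem_closedBall
      rw [Metric.mem_closedBall, Real.dist_eq, hfin, show c + i * π / ω - c = i * π / ω by ring, abs_of_nonneg h0]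
      exact h1
    simp only [hv]
    rw [this, show ω * (c + i * π / ω - c) = i * π by field_simp; ring, Real.cos_nat_mul_pi, one_mul]

theorem zero_in (m : ℕ) (hM : Γ.M = m) (t₀ : ℝ) (ht₀ : t₀ ≤ 0) (C a b : ℝ) (hab : a < b)
    (h0 : ∀ u ∈ Icc a b, Γ.w C u t₀ = 0) :
    ∀ᶠ t in nhdsWithin t₀ (Iio t₀), ∃ u ∈ Icc a b, Γ.w C u t = 0 := by
  obtain ⟨v, v', v'', hv, hv', hcv'', hvb, hvout, z, hz, hzI, hzv⟩ := exists_osc m a b hab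
  have hcv' : Continuous v' := continuous_iff_continuousAt.2 fun u => (hv' u).continuousAt
  have cg := Γ.contg
  have cgu := Γ.contgu
  have hcK : Continuous fun x : ℝ × ℝ => |v' x.1 * Γ.gu x.1 x.2 - v'' x.1 * Γ.g x.1 x.2| / Γ.g x.1 x.2 ^ 3 := by
    refine Continuous.div (by fun_prop) (by fun_prop) fun x => ?_
    have := Γ.gpos x.1 x.2
    positivity
  obtain ⟨K0, hK0⟩ := ((isCompact_Icc (a := a) (b := b)).prod
    (isCompact_Icc (a := t₀ - 1) (b := t₀))).bddAbove_image hcK.continuousOn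
  set K := max K0 0 with hK
  have hKnn : 0 ≤ K := le_max_right _ _
  have hKb : ∀ t ∈ Icc (t₀ - 1) t₀, ∀ u, |v' u * Γ.gu u t - v'' u * Γ.g u t| ≤ K * Γ.g u t ^ 3 := by
    intro t ht u
    have hg := Γ.gpos u t
    by_cases hu : u ∈ Icc a b
    · have := hK0 (mem_image_of_mem _ (mk_mem_prod hu ht))
      simp only at this
      rw [div_le_iff₀ (by positivity)] at this
      refine this.trans ?_
      gcongr
      exact le_max_left _ _
    · obtain ⟨-, e1, e2⟩ := hvout u hu
      rw [e1, e2]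
      simp
      positivity
  have hwin : Ioo (t₀ - 1 / (K + 1)) t₀ ∈ nhdsWithin t₀ (Iio t₀) :=
    Ioo_mem_nhdsLT (by have : 0 < 1 / (K + 1) := by positivity
                       linarith)
  filter_upwards [hwin] with t₁ ht₁
  have hh : (K + 1) * (t₀ - t₁) < 1 := by
    have := ht₁.1
    have e : t₀ - t₁ < 1 / (K + 1) := by linarith
    rw [lt_div_iff₀ (by positivity)] at e
    linarith
  have ht01 : 0 < t₀ - t₁ := by linarith [ht₁.2]
  have ht1 : t₀ - 1 ≤ t₁ := by nlinarith
  by_contra hno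
  push Not at hno
  obtain ⟨um, hum, hmin⟩ := isCompact_Icc.exists_isMinOn (nonempty_Icc.2 hab.le)
    ((Γ.contwu C t₁).abs.continuousOn (s := Icc a b))
  set ε := |Γ.w C um t₁| / 2 with hε
  have hε0 : 0 < ε := by
    have := abs_pos.2 (hno um hum)
    positivity
  have hεle : ∀ u ∈ Icc a b, ε < |Γ.w C u t₁| := fun u hu => by
    have : |Γ.w C um t₁| ≤ |Γ.w C u t₁| := hmin hu
    linarith
  obtain ⟨y, hy, hy'⟩ := Γ.flow_track t₁ t₀ (by linarith) ht₀ m (fun i => C + ε * -(-1) ^ i) v v' v'' hv hv' hvb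
    ε K (ε * (K + 1)) hε0.le (by positivity) (by nlinarith)
    (fun t ht u => hKb t ⟨ht1.trans ht.1, ht.2⟩ u)
    (fun i hi => by
      have e : (-1 : ℝ) ^ i * (C + ε * -(-1) ^ (i + 1) - (C + ε * -(-1) ^ i)) = 2 * ε * ((-1) ^ i * (-1) ^ i) := by
        rw [pow_succ]; ring
      have e2 : (-1 : ℝ) ^ i * (-1) ^ i = 1 := by rw [← mul_pow]; norm_num
      rw [e, e2]
      nlinarith) z hz (fun i hi => by
      rw [hzv i hi]
      have := h0 _ (hzI i hi)
      unfold w at this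
      have e : Γ.q (z i) t₀ + 2 * t₀ + ε * -(-1) ^ i - (C + ε * -(-1) ^ i) = 0 := by linarith
      rw [e]; simp)
  have hsgn : ∀ i ≤ 2 * m, (-1) ^ i * Γ.w C (y i) t₁ < 0 := by
    intro i hi
    have h1 := hy' i hi
    have e2 : (-1 : ℝ) ^ i * (-1) ^ i = 1 := by rw [← mul_pow]; norm_num
    have e : (-1 : ℝ) ^ i * (Γ.q (y i) t₁ + 2 * t₁ + ε * v (y i) - (C + ε * -(-1) ^ i)) =
      (-1) ^ i * (Γ.w C (y i) t₁ + ε * v (y i)) + ε * ((-1) ^ i * (-1) ^ i) := by unfold w; ring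
    rw [e, e2] at h1
    have h2 : (-1) ^ i * (Γ.w C (y i) t₁ + ε * v (y i)) < 0 := by nlinarith
    by_cases hI : y i ∈ Icc a b
    · have h3 := hεle _ hI
      have h4 : |ε * v (y i)| ≤ ε := by
        rw [abs_mul, abs_of_pos hε0]; nlinarith [hvb (y i)]
      rw [abs_le] at h4
      rw [lt_abs] at h3
      rcases neg_one_pow_eq_or ℝ i with h | h <;> rw [h] at h2 ⊢ <;> rcases h3 with h3 | h3 <;> linarith
    · rw [(hvout _ hI).1] at h2
      simpa using h2
  refine Γ.core m hM t₁ (by linarith) y hy fun i hi => ?_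
  have a1 := hsgn i (by omega)
  have a2 := hsgn (i + 1) (by omega)
  rw [pow_succ] at a2
  unfold w at a1 a2
  nlinarith

theorem w_pers (σ C x t : ℝ) (h : 0 < σ * Γ.w C x t) : ∀ᶠ r in nhds t, 0 < σ * Γ.w C x r :=
  (((Γ.contwt C x).const_mul σ).tendsto t).eventually (lt_mem_nhds h)

theorem smp' (σ C t1 t2 p' q' : ℝ) (h12 : t1 < t2) (h20 : t2 < 0) (hpq : p' < q')
    (hp : ∀ t ∈ Icc t1 t2, 0 < σ * Γ.w C p' t)
    (hq : ∀ t ∈ Icc t1 t2, 0 ≤ σ * Γ.w C q' t)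
    (hbot : ∀ u ∈ Icc p' q', 0 ≤ σ * Γ.w C u t1) :
    ∀ y, p' ≤ y → y < q' → 0 < σ * Γ.w C y t2 :=
  Γ.smp σ C t1 t2 p' q' h12 h20 hpq hp hq hbot

theorem gapB (σ C t1 t2 p' q' a1 b1 a3 b3 : ℝ) (h12 : t1 < t2) (h20 : t2 < 0)
    (o1 : p' ≤ a1) (o2 : a1 ≤ b1) (o3 : b1 < a3) (o4 : a3 ≤ b3) (o5 : b3 ≤ q')
    (hp : ∀ t ∈ Icc t1 t2, 0 < σ * Γ.w C p' t)
    (hq : ∀ t ∈ Icc t1 t2, 0 < -σ * Γ.w C q' t)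
    (z1 : ∀ t ∈ Icc t1 t2, ∃ u ∈ Icc a1 b1, Γ.w C u t = 0)
    (z3 : ∀ t ∈ Icc t1 t2, ∃ u ∈ Icc a3 b3, Γ.w C u t = 0)
    (nopat : ∀ t ∈ Icc t1 t2, ∀ x y, p' ≤ x → x ≤ y → y ≤ q' → 0 < -σ * Γ.w C x t → 0 < σ * Γ.w C y t → False) :
    False := by
  have claim : ∀ t, t1 ≤ t → t < t2 → ∀ x, p' ≤ x → x ≤ a3 → 0 ≤ σ * Γ.w C x t := by
    intro t ht1 ht2 x hx1 hx2
    by_contra hneg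
    push Not at hneg
    have hx0 : 0 < -σ * Γ.w C x t := by linarith
    obtain ⟨r, hr, hr'⟩ := Metric.eventually_nhds_iff.1 (Γ.w_pers (-σ) C x t hx0)
    set t' := min t2 (t + r / 2) with ht'
    have htt : t < t' := lt_min ht2 (by linarith)
    have ht't2 : t' ≤ t2 := min_le_left _ _
    have ht'r : t' ≤ t + r / 2 := min_le_right _ _
    have hxq : x < q' := by
      rcases (hx2.trans (o4.trans o5)).lt_or_eq with h | h
      · exact h
      · exfalso
        have e3 : x = a3 := by linarith
        obtain ⟨u, hu, hu0⟩ := z3 t ⟨ht1, ht2.le⟩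
        have : u = x := by linarith [hu.1, hu.2]
        rw [← this, hu0] at hx0
        simp at hx0
    have key := Γ.smp' (-σ) C t t' x q' htt (by linarith) hxq
      (fun s hs => hr' (by rw [Real.dist_eq, abs_of_nonneg (by linarith [hs.1])]; linarith [hs.2]))
      (fun s hs => (hq s ⟨ht1.trans hs.1, hs.2.trans ht't2⟩).le)
      (fun u hu => by
        by_contra hc
        push Not at hc
        exact nopat t ⟨ht1, ht2.le⟩ x u hx1 hu.1 hu.2 hx0 (by linarith))
    have hmem : t' ∈ Icc t1 t2 := ⟨by linarith, ht't2⟩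
    obtain ⟨u, hu, hu0⟩ := z3 t' hmem
    rcases (hu.2.trans o5).lt_or_eq with h | h
    · have := key u (hx2.trans hu.1) h
      rw [hu0] at this; simp at this
    · have := hq t' hmem
      rw [← h, hu0] at this; simp at this
  set t' := (t1 + t2) / 2 with ht'
  have e1 : t1 < t' := by linarith
  have e2 : t' < t2 := by linarith
  have key := Γ.smp' σ C t1 t' p' a3 e1 (by linarith) (by linarith) (fun s hs => hp s ⟨hs.1, hs.2.trans e2.le⟩)
    (fun s hs => claim s hs.1 (hs.2.trans_lt e2) a3 (by linarith) le_rfl)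
    (fun u hu => claim t1 le_rfl h12 u hu.1 hu.2)
  obtain ⟨u, hu, hu0⟩ := z1 t' ⟨e1.le, e2.le⟩
  have := key u (o1.trans hu.1) (hu.2.trans_lt o3)
  rw [hu0] at this; simp at this

/-- alternating sign sequences -/
def Alt (C t σ : ℝ) (n : ℕ) (z : ℕ → ℝ) : Prop :=
  (∀ i < n, z i ≤ z (i + 1)) ∧ ∀ i ≤ n, 0 < σ * (-1) ^ i * Γ.w C (z i) t

theorem alt_bound (m : ℕ) (hM : Γ.M = m) (C t σ : ℝ) (ht : t ≤ 0) (hσ : σ = 1 ∨ σ = -1) (n : ℕ) (z : ℕ → ℝ)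
    (h : Γ.Alt C t σ n z) : n ≤ 2 * m := by
  by_contra hn
  push Not at hn
  obtain ⟨h1, h2⟩ := h
  rcases hσ with rfl | rfl
  · refine Γ.core m hM t ht (fun i => z (i + 1)) (fun i hi => h1 (i + 1) (by omega)) fun i hi => ?_
    have a1 := h2 (i + 1) (by omega)
    have a2 := h2 (i + 1 + 1) (by omega)
    rw [pow_succ] at a1
    rw [pow_succ, pow_succ] at a2
    unfold w at a1 a2
    nlinarith
  · refine Γ.core m hM t ht z (fun i hi => h1 i (by omega)) fun i hi => ?_
    have a1 := h2 i (by omega)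
    have a2 := h2 (i + 1) (by omega)
    rw [pow_succ] at a2
    unfold w at a1 a2
    nlinarith

theorem alt_append (C t σ : ℝ) (n : ℕ) (z : ℕ → ℝ) (h : Γ.Alt C t σ n z) (x : ℝ) (hx : z n ≤ x)
    (hw : 0 < -(σ * (-1) ^ n) * Γ.w C x t) : ∃ z', Γ.Alt C t σ (n + 1) z' := by
  obtain ⟨h1, h2⟩ := h
  refine ⟨fun i => if i ≤ n then z i else x, fun i hi => ?_, fun i hi => ?_⟩
  · have hi' : i ≤ n := by omega
    rcases hi'.lt_or_eq with h | rfl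
    · simp [hi', show i + 1 ≤ n from h, h1 i h]
    · simp [hx]
  · by_cases hi' : i ≤ n
    · simp only [hi', if_true]; exact h2 i hi'
    · obtain rfl : i = n + 1 := by omega
      simp only [hi', if_false]
      rw [pow_succ]; linarith

theorem alt_prepend (C t σ : ℝ) (n : ℕ) (z : ℕ → ℝ) (h : Γ.Alt C t σ n z) (x : ℝ) (hx : x ≤ z 0)
    (hw : 0 < -σ * Γ.w C x t) : ∃ z', Γ.Alt C t (-σ) (n + 1) z' := by
  obtain ⟨h1, h2⟩ := h
  refine ⟨fun i => if i = 0 then x else z (i - 1), fun i hi => ?_, fun i hi => ?_⟩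
  · rcases i with _ | i
    · simp [hx]
    · simpa using h1 i (by omega)
  · rcases i with _ | i
    · simpa using hw
    · have := h2 i (by omega)
      simp only [Nat.add_eq_zero_iff, one_ne_zero, and_false, if_false, Nat.add_sub_cancel]
      rw [pow_succ]; linarith

theorem alt_insert (C t σ : ℝ) (n : ℕ) (z : ℕ → ℝ) (h : Γ.Alt C t σ n z) (i : ℕ) (hi : i < n) (x y : ℝ)
    (hx : z i ≤ x) (hxy : x ≤ y) (hy : y ≤ z (i + 1))
    (hwx : 0 < -(σ * (-1) ^ i) * Γ.w C x t) (hwy : 0 < σ * (-1) ^ i * Γ.w C y t) :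
    ∃ z', Γ.Alt C t σ (n + 2) z' := by
  obtain ⟨h1, h2⟩ := h
  refine ⟨fun j => if j ≤ i then z j else if j = i + 1 then x else if j = i + 2 then y else z (j - 2),
    fun j hj => ?_, fun j hj => ?_⟩
  · rcases lt_trichotomy j i with h | rfl | h
    · simp [h.le, show j + 1 ≤ i from h, h1 j (by omega)]
    · simp [hx]
    · rcases Nat.lt_or_eq_of_le (Nat.succ_le_of_lt h) with h' | h'
      · rcases Nat.lt_or_eq_of_le (Nat.succ_le_of_lt h') with h'' | h''
        · have e1 : ¬ j ≤ i := by omega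
          have e2 : j ≠ i + 1 := by omega
          have e3 : j ≠ i + 2 := by omega
          have e4 : ¬ j + 1 ≤ i := by omega
          have e5 : j + 1 ≠ i + 1 := by omega
          have e6 : j + 1 ≠ i + 2 := by omega
          simp only [e1, e2, e3, e4, e5, e6, if_false]
          have := h1 (j - 2) (by omega)
          rwa [show j - 2 + 1 = j + 1 - 2 by omega] at this
        · obtain rfl : j = i + 2 := by omega
          simp [hy, show ¬ i + 2 ≤ i by omega, show ¬ i + 2 + 1 ≤ i by omega]
      · obtain rfl : j = i + 1 := by omega
        simp [hxy, show ¬ i + 1 + 1 ≤ i by omega]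
  · by_cases e1 : j ≤ i
    · simp only [e1, if_true]; exact h2 j (by omega)
    · by_cases e2 : j = i + 1
      · subst e2
        simp only [e1, if_false, if_true]
        rw [pow_succ]; linarith
      · by_cases e3 : j = i + 2
        · subst e3
          simp only [e1, e2, if_false, if_true]
          rw [pow_succ, pow_succ]; linarith
        · simp only [e1, e2, e3, if_false]
          have := h2 (j - 2) (by omega)
          obtain ⟨k, rfl⟩ : ∃ k, j = k + 2 := ⟨j - 2, by omega⟩
          rw [Nat.add_sub_cancel] at this ⊢
          rw [pow_succ, pow_succ]; linarith

theorem alt_pers (C t σ : ℝ) (n : ℕ) (z : ℕ → ℝ) (h : Γ.Alt C t σ n z) : ∀ᶠ r in nhds t, Γ.Alt C r σ n z := by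
  have : ∀ᶠ r in nhds t, ∀ i ∈ Finset.range (n + 1), 0 < σ * (-1) ^ i * Γ.w C (z i) r := by
    rw [Filter.eventually_all_finset]
    intro i hi
    exact Γ.w_pers _ C _ t (h.2 i (by have := Finset.mem_range.1 hi; omega))
  filter_upwards [this] with r hr
  exact ⟨h.1, fun i hi => hr i (Finset.mem_range.2 (by omega))⟩
end CFlow

theorem unhit (N : ℕ) (a d : ℝ) (hd : 0 < d) (n : ℕ) (hn : n + 1 < N) (z : ℕ → ℝ) :
    ∃ k < N, ∀ i ≤ n, z i ≤ a + k * d ∨ a + (k + 1) * d ≤ z i := by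
  by_contra hc
  push Not at hc
  have hc' : ∀ k : Fin N, ∃ i : Fin (n + 1), a + (k : ℕ) * d < z i ∧ z i < a + ((k : ℕ) + 1) * d := by
    intro k
    obtain ⟨i, hi, h⟩ := hc k k.2
    exact ⟨⟨i, by omega⟩, h⟩
  choose f hf using hc'
  have hinj : Function.Injective f := by
    intro k l hkl
    have h1 := hf k
    have h2 := hf l
    rw [hkl] at h1
    have e1 : ((k : ℕ) : ℝ) < (l : ℕ) + 1 := by
      have : ((k : ℕ) : ℝ) * d < ((l : ℕ) + 1) * d := by linarith [h1.1, h2.2]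
      exact lt_of_mul_lt_mul_right this hd.le
    have e2 : ((l : ℕ) : ℝ) < (k : ℕ) + 1 := by
      have : ((l : ℕ) : ℝ) * d < ((k : ℕ) + 1) * d := by linarith [h1.2, h2.1]
      exact lt_of_mul_lt_mul_right this hd.le
    have e1' : (k : ℕ) < l + 1 := by exact_mod_cast e1
    have e2' : (l : ℕ) < k + 1 := by exact_mod_cast e2
    exact Fin.ext (by omega)
  have := Fintype.card_le_of_injective f hinj
  simp at this
  omega

namespace CFlow
variable (Γ : CFlow)

theorem no_plateau' (m : ℕ) (hM : Γ.M = m) (t₀ : ℝ) (ht₀ : t₀ ≤ 0) (C a b : ℝ) (hab : a < b)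
    (h0 : ∀ u ∈ Icc a b, Γ.w C u t₀ = 0) : False := by
  obtain ⟨U0, hU00, hU0⟩ := Γ.up (C - 2 * (t₀ - 1) + 1) (t₀ - 1) t₀ ht₀
  set U := max U0 (|a| + |b| + 1) with hU
  have hUa : -U < a := by
    have : |a| + |b| + 1 ≤ U := le_max_right _ _
    linarith [neg_abs_le a, abs_nonneg b]
  have hUb : b < U := by
    have : |a| + |b| + 1 ≤ U := le_max_right _ _
    linarith [le_abs_self b, abs_nonneg a]
  have hUpos : 0 < U := hU00.trans_le (le_max_left _ _)
  have hwU : ∀ t, t₀ - 1 ≤ t → t ≤ t₀ → ∀ u, U ≤ |u| → 0 < 1 * Γ.w C u t := by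
    intro t h1 h2 u hu
    have := hU0 t h1 h2 u ((le_max_left _ _).trans hu)
    unfold w
    linarith
  have hU1 : U ≤ |U| := le_abs_self _
  have hU2 : U ≤ |-U| := by rw [abs_neg]; exact le_abs_self _
  set N := 2 * m + 2 with hN
  set d := (b - a) / N with hd
  have hNpos : (0 : ℝ) < N := by rw [hN]; positivity
  have hd0 : 0 < d := div_pos (by linarith) hNpos
  have hNd : N * d = b - a := by rw [hd]; field_simp
  have hblk : ∀ k < N, a ≤ a + k * d ∧ a + (k + 1) * d ≤ b := by
    intro k hk
    have h1 : (k : ℝ) + 1 ≤ N := by exact_mod_cast hk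
    constructor
    · have : 0 ≤ (k : ℝ) * d := by positivity
      linarith
    · nlinarith
  have hev : ∀ᶠ t in nhdsWithin t₀ (Iio t₀), (∀ k ∈ Finset.range N,
      (∃ u ∈ Icc (a + k * d) (a + k * d + d / 3), Γ.w C u t = 0) ∧
      (∃ u ∈ Icc (a + k * d + 2 * d / 3) (a + (k + 1) * d), Γ.w C u t = 0)) ∧ t ∈ Ioo (t₀ - 1) t₀ := by
    refine Filter.Eventually.and ?_ (Ioo_mem_nhdsLT (by linarith))
    rw [Filter.eventually_all_finset]
    intro k hk
    obtain ⟨e1, e2⟩ := hblk k (Finset.mem_range.1 hk)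
    refine (Γ.zero_in m hM t₀ ht₀ C _ _ (by linarith) fun u hu => h0 u ⟨by linarith [hu.1], by linarith [hu.2]⟩).and
      (Γ.zero_in m hM t₀ ht₀ C _ _ (by linarith) fun u hu => h0 u ⟨by linarith [hu.1], by linarith [hu.2]⟩)
  obtain ⟨s, hs, hsub⟩ := (mem_nhdsLT_iff_exists_Ioo_subset).1 hev
  have hs' : s < t₀ := hs
  -- maximal number of sign changes
  set P : ℕ → Prop := fun n => ∃ t ∈ Ioo s t₀, ∃ σ : ℝ, (σ = 1 ∨ σ = -1) ∧ ∃ z, Γ.Alt C t σ n z with hP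
  have hP0 : P 0 := by
    have hmem : (s + t₀) / 2 ∈ Ioo s t₀ := ⟨by linarith, by linarith⟩
    refine ⟨(s + t₀) / 2, hmem, 1, Or.inl rfl, fun _ => U, fun i hi => by omega, fun i hi => ?_⟩
    obtain rfl : i = 0 := by omega
    have h3 := (hsub hmem).2
    simpa using hwU _ h3.1.le h3.2.le U hU1
  have hPb : ∀ n, P n → n ≤ 2 * m := by
    rintro n ⟨t, ht, σ, hσ, z, hz⟩
    exact Γ.alt_bound m hM C t σ (by linarith [ht.2]) hσ n z hz
  obtain ⟨n, hPn, hmax⟩ : ∃ n, P n ∧ ∀ k, P k → k ≤ n := by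
    classical
    refine ⟨Nat.findGreatest P (2 * m), Nat.findGreatest_spec (Nat.zero_le _) hP0, fun k hk => ?_⟩
    exact Nat.le_findGreatest (hPb k hk) hk
  obtain ⟨t1, ht1, σ, hσ, z, hz⟩ := hPn
  have hnm := hPb n ⟨t1, ht1, σ, hσ, z, hz⟩
  obtain ⟨r, hr, hpers⟩ := Metric.eventually_nhds_iff.1 (Γ.alt_pers C t1 σ n z hz)
  set t2 := min (t1 + r / 2) ((t1 + t₀) / 2) with ht2
  have h12 : t1 < t2 := lt_min (by linarith) (by linarith [ht1.2])
  have h2r : t2 ≤ t1 + r / 2 := min_le_left _ _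
  have h20 : t2 < t₀ := (min_le_right _ _).trans_lt (by linarith [ht1.2])
  have hmem : ∀ t ∈ Icc t1 t2, t ∈ Ioo s t₀ := fun t ht => ⟨ht1.1.trans_le ht.1, ht.2.trans_lt h20⟩
  have hA : ∀ t ∈ Icc t1 t2, Γ.Alt C t σ n z := fun t ht =>
    hpers (by rw [Real.dist_eq, abs_of_nonneg (by linarith [ht.1])]; linarith [ht.2])
  have hz0 := fun t ht => hsub (hmem t ht)
  have hUU : ∀ t ∈ Icc t1 t2, ∀ u, U ≤ |u| → 0 < 1 * Γ.w C u t := fun t ht =>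
    hwU t (hz0 t ht).2.1.le (hz0 t ht).2.2.le
  have h1mem : t1 ∈ Icc t1 t2 := left_mem_Icc.2 h12.le
  obtain ⟨k, hk, hun⟩ := unhit N a d hd0 n (by omega) z
  obtain ⟨hk1, hk2⟩ := hblk k hk
  set α := a + k * d with hα
  set β := a + (k + 1) * d with hβ
  have hαβ : β = α + d := by rw [hα, hβ]; ring
  have hzr := fun t ht => (hz0 t ht).1 k (Finset.mem_range.2 hk)
  have hnot : ∀ j, n < j → P j → False := fun j hj hPj => by have := hmax j hPj; omega
  -- case A
  have caseA : ∀ p' q', p' ≤ α → β ≤ q' → (∀ t ∈ Icc t1 t2, 0 < 1 * Γ.w C p' t) →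
      (∀ t ∈ Icc t1 t2, 0 < 1 * Γ.w C q' t) → (∀ u ∈ Icc p' q', 0 ≤ 1 * Γ.w C u t1) → False := by
    intro p' q' hp' hq' h1 h2 h3
    have key := Γ.smp' 1 C t1 t2 p' q' h12 (by linarith) (by linarith) h1 (fun t ht => (h2 t ht).le) h3
    obtain ⟨u, hu, hu0⟩ := (hzr t2 (right_mem_Icc.2 h12.le)).1
    have := key u (by linarith [hu.1]) (by linarith [hu.2])
    rw [hu0] at this; simp at this
  by_cases hex : ∃ i, i ≤ n ∧ β ≤ z i
  · classical
    set i := Nat.find hex with hi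
    obtain ⟨hin, hiz⟩ := Nat.find_spec hex
    rw [← hi] at hin hiz
    rcases hi0 : i with _ | i'
    · rw [hi0] at hiz
      have hσ1 : σ = 1 := by
        rcases hσ with h | h
        · exact h
        · exfalso
          by_cases hzU : -U ≤ z 0
          · obtain ⟨z', hz'⟩ := Γ.alt_prepend C t1 σ n z hz (-U) hzU (by
              rw [h]; simpa using hUU t1 h1mem (-U) hU2)
            exact hnot (n + 1) (by omega) ⟨t1, ht1, -σ, by rw [h]; simp, z', hz'⟩
          · linarith
      have hpos : ∀ t ∈ Icc t1 t2, 0 < 1 * Γ.w C (z 0) t := fun t ht => by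
        have := (hA t ht).2 0 (by omega)
        rw [hσ1] at this
        simpa using this
      refine caseA (-U) (z 0) (by linarith) hiz (fun t ht => hUU t ht _ hU2) hpos ?_
      intro u hu
      by_contra hc
      push Not at hc
      obtain ⟨z', hz'⟩ := Γ.alt_prepend C t1 σ n z hz u hu.2 (by rw [hσ1]; linarith)
      exact hnot (n + 1) (by omega) ⟨t1, ht1, -σ, by rw [hσ1]; simp, z', hz'⟩
    · rw [hi0] at hin hiz
      have hi'z : z i' ≤ α := by
        rcases hun i' (by omega) with h | h
        · exact h
        · exact absurd ⟨by omega, h⟩ (Nat.find_min hex (m := i') (by omega))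
      refine Γ.gapB (σ * (-1) ^ i') C t1 t2 (z i') (z (i' + 1)) α (α + d / 3) (α + 2 * d / 3) β h12 (by linarith)
        hi'z (by linarith) (by linarith) (by linarith) hiz (fun t ht => (hA t ht).2 i' (by omega))
        (fun t ht => ?_) (fun t ht => (hzr t ht).1) (fun t ht => (hzr t ht).2) ?_
      · have := (hA t ht).2 (i' + 1) hin
        rw [pow_succ] at this
        linarith
      · intro t ht x y hx hxy hy hwx hwy
        obtain ⟨z', hz'⟩ := Γ.alt_insert C t σ n z (hA t ht) i' (by omega) x y hx hxy hy hwx hwy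
        exact hnot (n + 2) (by omega) ⟨t, hmem t ht, σ, hσ, z', hz'⟩
  · push Not at hex
    have hzn : z n ≤ α := by
      rcases hun n le_rfl with h | h
      · exact h
      · linarith [hex n le_rfl]
    have hσn : σ * (-1) ^ n = 1 := by
      have hc : σ * (-1) ^ n = 1 ∨ σ * (-1) ^ n = -1 := by
        rcases hσ with h | h <;> rcases neg_one_pow_eq_or ℝ n with h' | h' <;> rw [h, h'] <;> norm_num
      rcases hc with h | h
      · exact h
      · exfalso
        obtain ⟨z', hz'⟩ := Γ.alt_append C t1 σ n z hz U (by linarith) (by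
          rw [h]; simpa using hUU t1 h1mem U hU1)
        exact hnot (n + 1) (by omega) ⟨t1, ht1, σ, hσ, z', hz'⟩
    refine caseA (z n) U hzn (by linarith) (fun t ht => ?_) (fun t ht => hUU t ht _ hU1) ?_
    · have := (hA t ht).2 n le_rfl
      rwa [hσn] at this
    · intro u hu
      by_contra hc
      push Not at hc
      obtain ⟨z', hz'⟩ := Γ.alt_append C t1 σ n z hz u hu.1 (by rw [hσn]; linarith)
      exact hnot (n + 1) (by omega) ⟨t1, ht1, σ, hσ, z', hz'⟩

theorem no_plateau (m : ℕ) (hM : Γ.M = m) (t₀ : ℝ) (ht₀ : t₀ ≤ 0) (C a b : ℝ) (hab : a < b)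
    (h0 : ∀ u ∈ Icc a b, Γ.q u t₀ = C) : False :=
  Γ.no_plateau' m hM t₀ ht₀ (C + 2 * t₀) a b hab fun u hu => by
    unfold w; rw [h0 u hu]; ring
end CFlow

theorem sorted_of_large (A : Set ℝ) (n : ℕ) (h : ¬ (A.Finite ∧ A.ncard ≤ n)) :
    ∃ x : ℕ → ℝ, (∀ i ≤ n, x i ∈ A) ∧ ∀ i < n, x i < x (i + 1) := by
  obtain ⟨F, hFA, hF⟩ : ∃ F : Finset ℝ, (F : Set ℝ) ⊆ A ∧ F.card = n + 1 := by
    by_cases hfin : A.Finite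
    · have hc : n + 1 ≤ A.ncard := by
        by_contra hc
        exact h ⟨hfin, by omega⟩
      rw [Set.ncard_eq_toFinset_card A hfin] at hc
      obtain ⟨F, hF1, hF2⟩ := Finset.exists_subset_card_eq hc
      exact ⟨F, fun x hx => by simpa using hF1 hx, hF2⟩
    · exact Set.Infinite.exists_subset_card_eq hfin (n + 1)
  let e := F.orderEmbOfFin hF
  refine ⟨fun i => if hi : i < n + 1 then e ⟨i, hi⟩ else 0, fun i hi => ?_, fun i hi => ?_⟩
  · have hi' : i < n + 1 := by omega
    simp only [hi', dif_pos]
    exact hFA (F.orderEmbOfFin_mem hF _)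
  · have hi' : i < n + 1 := by omega
    have hi'' : i + 1 < n + 1 := by omega
    simp only [hi', hi'', dif_pos]
    exact e.strictMono (by simp)

namespace CFlow
variable (Γ : CFlow)

theorem right_diff (m : ℕ) (hM : Γ.M = m) (t : ℝ) (ht : t ≤ 0) (σ x y : ℝ) (hσ : σ ≠ 0) (hxy : x < y)
    (hx : IsLocalMin (fun v => σ * Γ.q v t) x) : ∃ h ∈ Icc x y, σ * Γ.q x t < σ * Γ.q h t := by
  by_contra hc
  push Not at hc
  obtain ⟨r, hr, hloc⟩ := Metric.eventually_nhds_iff.1 hx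
  refine Γ.no_plateau m hM t ht (Γ.q x t) x (min y (x + r / 2)) (lt_min hxy (by linarith)) fun u hu => ?_
  have h1 : u ≤ x + r / 2 := hu.2.trans (min_le_right _ _)
  have h2 := hc u ⟨hu.1, hu.2.trans (min_le_left _ _)⟩
  have h3 : σ * Γ.q x t ≤ σ * Γ.q u t := hloc (by
    rw [Real.dist_eq, abs_of_nonneg (by linarith [hu.1])]; linarith)
  exact mul_left_cancel₀ hσ (le_antisymm h2 h3)

theorem left_diff (m : ℕ) (hM : Γ.M = m) (t : ℝ) (ht : t ≤ 0) (σ x y : ℝ) (hσ : σ ≠ 0) (hxy : y < x)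
    (hx : IsLocalMin (fun v => σ * Γ.q v t) x) : ∃ h ∈ Icc y x, σ * Γ.q x t < σ * Γ.q h t := by
  by_contra hc
  push Not at hc
  obtain ⟨r, hr, hloc⟩ := Metric.eventually_nhds_iff.1 hx
  refine Γ.no_plateau m hM t ht (Γ.q x t) (max y (x - r / 2)) x (max_lt hxy (by linarith)) fun u hu => ?_
  have h1 : x - r / 2 ≤ u := (le_max_right _ _).trans hu.1
  have h2 := hc u ⟨(le_max_left _ _).trans hu.1, hu.2⟩
  have h3 : σ * Γ.q x t ≤ σ * Γ.q u t := hloc (by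
    rw [Real.dist_eq, abs_of_nonpos (by linarith [hu.2])]; linarith)
  exact mul_left_cancel₀ hσ (le_antisymm h2 h3)

theorem between (m : ℕ) (hM : Γ.M = m) (t : ℝ) (ht : t ≤ 0) (σ x y : ℝ) (hσ : σ ≠ 0) (hxy : x < y)
    (hx : IsLocalMin (fun v => σ * Γ.q v t) x) (hy : IsLocalMin (fun v => σ * Γ.q v t) y) :
    ∃ h ∈ Icc x y, σ * Γ.q x t < σ * Γ.q h t ∧ σ * Γ.q y t < σ * Γ.q h t := by
  obtain ⟨h, hh, hmax⟩ := isCompact_Icc.exists_isMaxOn (nonempty_Icc.2 hxy.le)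
    (((Γ.cq t).const_mul σ).continuousOn)
  obtain ⟨h1, hh1, e1⟩ := Γ.right_diff m hM t ht σ x y hσ hxy hx
  obtain ⟨h2, hh2, e2⟩ := Γ.left_diff m hM t ht σ y x hσ hxy hy
  exact ⟨h, hh, e1.trans_le (hmax hh1), e2.trans_le (hmax hh2)⟩

theorem count_min (m : ℕ) (hM : Γ.M = m) (t : ℝ) (ht : t ≤ 0) :
    {u | IsLocalMin (fun v => Γ.q v t) u}.Finite ∧ {u | IsLocalMin (fun v => Γ.q v t) u}.ncard ≤ m := by
  by_contra hc
  obtain ⟨x, hxA, hxl⟩ := sorted_of_large _ m hc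
  have hb : ∀ j, ∃ h, j < m → h ∈ Icc (x j) (x (j + 1)) ∧ Γ.q (x j) t < Γ.q h t ∧ Γ.q (x (j + 1)) t < Γ.q h t := by
    intro j
    by_cases hj : j < m
    · obtain ⟨h, h1, h2, h3⟩ := Γ.between m hM t ht 1 (x j) (x (j + 1)) one_ne_zero (hxl j hj)
        (by simpa using hxA j hj.le) (by simpa using hxA (j + 1) hj)
      exact ⟨h, fun _ => ⟨h1, by linarith, by linarith⟩⟩
    · exact ⟨0, fun h => absurd h hj⟩
  choose h hh using hb
  set z : ℕ → ℝ := fun i => if i % 2 = 0 then x (i / 2) else h (i / 2) with hz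
  have z0 : ∀ j, z (2 * j) = x j := fun j => by simp [hz]
  have z1 : ∀ j, z (2 * j + 1) = h j := fun j => by
    simp only [hz]
    rw [if_neg (by omega), show (2 * j + 1) / 2 = j by omega]
  have z2 : ∀ j, z (2 * j + 1 + 1) = x (j + 1) := fun j => by
    rw [show 2 * j + 1 + 1 = 2 * (j + 1) by ring, z0]
  refine Γ.core m hM t ht z (fun i hi => ?_) (fun i hi => ?_)
  · rcases Nat.even_or_odd' i with ⟨j, rfl | rfl⟩
    · rw [z0, z1]; exact (hh j (by omega)).1.1
    · rw [z1, z2]; exact (hh j (by omega)).1.2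
  · rcases Nat.even_or_odd' i with ⟨j, rfl | rfl⟩
    · rw [z0, z1, pow_mul, neg_one_sq, one_pow]
      linarith [(hh j (by omega)).2.1]
    · rw [z1, z2, pow_succ, pow_mul, neg_one_sq, one_pow]
      linarith [(hh j (by omega)).2.2]

theorem count_max (m : ℕ) (hm : 0 < m) (hM : Γ.M = m) (t : ℝ) (ht : t ≤ 0) :
    {u | IsLocalMax (fun v => Γ.q v t) u}.Finite ∧ {u | IsLocalMax (fun v => Γ.q v t) u}.ncard ≤ m - 1 := by
  by_contra hc
  obtain ⟨x, hxA, hxl⟩ := sorted_of_large _ (m - 1) hc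
  have hx' : ∀ j < m, IsLocalMin (fun v => -1 * Γ.q v t) (x j) := fun j hj => by
    have h : IsLocalMax (fun v => Γ.q v t) (x j) := hxA j (by omega)
    simpa using h.neg
  have hb : ∀ j, ∃ h, (∀ i, j = i + 1 → i < m → x i ≤ h ∧ Γ.q h t < Γ.q (x i) t) ∧
      (j < m → h ≤ x j ∧ Γ.q h t < Γ.q (x j) t) := by
    intro j
    rcases j with _ | j
    · obtain ⟨h, h1, h2⟩ := Γ.left_diff m hM t ht (-1) (x 0) (x 0 - 1) (by norm_num) (by linarith) (hx' 0 hm)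
      exact ⟨h, fun i hi => by omega, fun _ => ⟨h1.2, by linarith⟩⟩
    · by_cases hj : j + 1 < m
      · obtain ⟨h, h1, h2, h3⟩ := Γ.between m hM t ht (-1) (x j) (x (j + 1)) (by norm_num) (hxl j (by omega))
          (hx' j (by omega)) (hx' (j + 1) hj)
        refine ⟨h, fun i hi _ => ?_, fun _ => ⟨h1.2, by linarith⟩⟩
        obtain rfl : j = i := by omega
        exact ⟨h1.1, by linarith⟩
      · by_cases hj' : j < m
        · obtain ⟨h, h1, h2⟩ := Γ.right_diff m hM t ht (-1) (x j) (x j + 1) (by norm_num) (by linarith) (hx' j hj')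
          refine ⟨h, fun i hi _ => ?_, fun h => absurd h hj⟩
          obtain rfl : j = i := by omega
          exact ⟨h1.1, by linarith⟩
        · exact ⟨0, fun i hi him => by omega, fun h => absurd h hj⟩
  choose h hhl hhr using hb
  set z : ℕ → ℝ := fun i => if i % 2 = 0 then h (i / 2) else x (i / 2) with hz
  have z0 : ∀ j, z (2 * j) = h j := fun j => by simp [hz]
  have z1 : ∀ j, z (2 * j + 1) = x j := fun j => by
    simp only [hz]
    rw [if_neg (by omega), show (2 * j + 1) / 2 = j by omega]
  have z2 : ∀ j, z (2 * j + 1 + 1) = h (j + 1) := fun j => by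
    rw [show 2 * j + 1 + 1 = 2 * (j + 1) by ring, z0]
  refine Γ.core m hM t ht z (fun i hi => ?_) (fun i hi => ?_)
  · rcases Nat.even_or_odd' i with ⟨j, rfl | rfl⟩
    · rw [z0, z1]; exact (hhr j (by omega)).1
    · rw [z1, z2]; exact (hhl (j + 1) j rfl (by omega)).1
  · rcases Nat.even_or_odd' i with ⟨j, rfl | rfl⟩
    · rw [z0, z1, pow_mul, neg_one_sq, one_pow]
      linarith [(hhr j (by omega)).2]
    · rw [z1, z2, pow_succ, pow_mul, neg_one_sq, one_pow]
      linarith [(hhl (j + 1) j rfl (by omega)).2]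
end CFlow

/-- the closed space-time half plane -/
def Om : Set (ℝ × ℝ) := univ ×ˢ Iic 0

theorem Om_unique : UniqueDiffOn ℝ Om := uniqueDiffOn_univ.prod (uniqueDiffOn_Iic 0)

theorem mem_Om {u t : ℝ} (ht : t ≤ 0) : ((u, t) : ℝ × ℝ) ∈ Om := ⟨mem_univ _, ht⟩

def Dx (h : ℝ × ℝ → ℝ) (p : ℝ × ℝ) : ℝ := fderivWithin ℝ h Om p (1, 0)
def Dt (h : ℝ × ℝ → ℝ) (p : ℝ × ℝ) : ℝ := fderivWithin ℝ h Om p (0, 1)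

/-- smoothness on the half plane -/
def Smo (h : ℝ × ℝ → ℝ) : Prop := ContDiffOn ℝ (⊤ : ℕ∞) h Om

theorem Smo.fd {h : ℝ × ℝ → ℝ} (hh : Smo h) : ContDiffOn ℝ (⊤ : ℕ∞) (fderivWithin ℝ h Om) Om :=
  ContDiffOn.fderivWithin hh Om_unique (by simp)

theorem Smo.dx {h : ℝ × ℝ → ℝ} (hh : Smo h) : Smo (Dx h) := hh.fd.clm_apply contDiffOn_const
theorem Smo.dt {h : ℝ × ℝ → ℝ} (hh : Smo h) : Smo (Dt h) := hh.fd.clm_apply contDiffOn_const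

theorem Smo.hasf {h : ℝ × ℝ → ℝ} (hh : Smo h) {p : ℝ × ℝ} (hp : p ∈ Om) :
    HasFDerivWithinAt h (fderivWithin ℝ h Om p) Om p :=
  (hh.differentiableOn (by simp) p hp).hasFDerivWithinAt

theorem Smo.hasx {h : ℝ × ℝ → ℝ} (hh : Smo h) (u t : ℝ) (ht : t ≤ 0) :
    HasDerivAt (fun v => h (v, t)) (Dx h (u, t)) u := by
  have h1 : HasDerivAt (fun v : ℝ => (v, t)) ((1, 0) : ℝ × ℝ) u := (hasDerivAt_id u).prodMk (hasDerivAt_const u t)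
  exact (hh.hasf (mem_Om ht)).comp_hasDerivAt u h1 (Eventually.of_forall fun v => mem_Om ht)

theorem Smo.hast {h : ℝ × ℝ → ℝ} (hh : Smo h) (u t : ℝ) (ht : t ≤ 0) :
    HasDerivWithinAt (fun r => h (u, r)) (Dt h (u, t)) (Iic 0) t := by
  have h1 : HasDerivWithinAt (fun r : ℝ => (u, r)) ((0, 1) : ℝ × ℝ) (Iic 0) t :=
    ((hasDerivAt_const t u).prodMk (hasDerivAt_id t)).hasDerivWithinAt
  exact (hh.hasf (mem_Om ht)).comp_hasDerivWithinAt t h1 (fun r hr => mem_Om hr)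

theorem Smo.comm {h : ℝ × ℝ → ℝ} (hh : Smo h) (u t : ℝ) (ht : t ≤ 0) :
    Dt (Dx h) (u, t) = Dx (Dt h) (u, t) := by
  have hp := mem_Om (u := u) ht
  have hcl : ((u, t) : ℝ × ℝ) ∈ closure (interior Om) := by
    rw [Om, interior_prod_eq, closure_prod_eq]
    simp [ht]
  have hsym := ContDiffWithinAt.isSymmSndFDerivWithinAt (hh _ hp) (by simp only [minSmoothness_of_isRCLikeNormedField]; exact WithTop.coe_le_coe.2 (le_top : (2 : ℕ∞) ≤ ⊤)) Om_unique hcl hp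
  have hd := (hh.fd.differentiableOn (by simp) _ hp).hasFDerivWithinAt
  have key : ∀ a b : ℝ × ℝ, fderivWithin ℝ (fun p => fderivWithin ℝ h Om p a) Om (u, t) b =
      fderivWithin ℝ (fderivWithin ℝ h Om) Om (u, t) b a := by
    intro a b
    have := (hd.clm_apply (hasFDerivWithinAt_const a (u, t) Om)).fderivWithin (Om_unique _ hp)
    rw [this]; simp
  have e1 : Dt (Dx h) (u, t) = fderivWithin ℝ (fun p => fderivWithin ℝ h Om p (1, 0)) Om (u, t) (0, 1) := rfl
  have e2 : Dx (Dt h) (u, t) = fderivWithin ℝ (fun p => fderivWithin ℝ h Om p (0, 1)) Om (u, t) (1, 0) := rfl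
  rw [e1, e2, key, key]
  exact hsym _ _

theorem Smo.cont {h : ℝ × ℝ → ℝ} (hh : Smo h) : Continuous fun p : ℝ × ℝ => h (p.1, min p.2 0) :=
  ContinuousOn.comp_continuous (ContDiffOn.continuousOn hh) (by fun_prop) fun p => mem_Om (min_le_right _ _)

section
variable (X Y : ℝ × ℝ → ℝ)

def g0 (p : ℝ × ℝ) : ℝ := √(Dx X p ^ 2 + Dx Y p ^ 2)
def c0 (p : ℝ × ℝ) : ℝ := Dx X p / g0 X Y p
def s0 (p : ℝ × ℝ) : ℝ := Dx Y p / g0 X Y p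
def k0 (p : ℝ × ℝ) : ℝ := (Dx X p * Dx (Dx Y) p - Dx Y p * Dx (Dx X) p) / g0 X Y p ^ 3
def gu0 (p : ℝ × ℝ) : ℝ := (Dx X p * Dx (Dx X) p + Dx Y p * Dx (Dx Y) p) / g0 X Y p
end

section
variable {X Y : ℝ × ℝ → ℝ}

theorem g0_pos (hreg : ∀ u t, t ≤ 0 → 0 < Dx X (u, t) ^ 2 + Dx Y (u, t) ^ 2)
    (u t : ℝ) (ht : t ≤ 0) : 0 < g0 X Y (u, t) := Real.sqrt_pos.2 (hreg u t ht)

theorem g0_sq (hreg : ∀ u t, t ≤ 0 → 0 < Dx X (u, t) ^ 2 + Dx Y (u, t) ^ 2)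
    (u t : ℝ) (ht : t ≤ 0) : g0 X Y (u, t) ^ 2 = Dx X (u, t) ^ 2 + Dx Y (u, t) ^ 2 :=
  Real.sq_sqrt (hreg u t ht).le

theorem g0_u (hX : Smo X) (hY : Smo Y) (hreg : ∀ u t, t ≤ 0 → 0 < Dx X (u, t) ^ 2 + Dx Y (u, t) ^ 2)
    (u t : ℝ) (ht : t ≤ 0) : HasDerivAt (fun v => g0 X Y (v, t)) (gu0 X Y (u, t)) u := by
  have h1 := (((hX.dx.hasx u t ht).fun_pow 2).fun_add ((hY.dx.hasx u t ht).fun_pow 2)).sqrt (hreg u t ht).ne'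
  refine h1.congr_deriv ?_
  have hg := g0_pos hreg u t ht
  unfold gu0
  unfold g0 at hg ⊢
  field_simp
  push_cast
  ring

theorem c0_u (hX : Smo X) (hY : Smo Y) (hreg : ∀ u t, t ≤ 0 → 0 < Dx X (u, t) ^ 2 + Dx Y (u, t) ^ 2)
    (u t : ℝ) (ht : t ≤ 0) : HasDerivAt (fun v => c0 X Y (v, t))
      (-(k0 X Y (u, t) * g0 X Y (u, t) * s0 X Y (u, t))) u := by
  have hg := g0_pos hreg u t ht
  have h1 := (hX.dx.hasx u t ht).fun_div (g0_u hX hY hreg u t ht) hg.ne'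
  refine h1.congr_deriv ?_
  have h2 := g0_sq hreg u t ht
  unfold k0 s0 gu0
  field_simp
  rw [h2]; ring

theorem s0_u (hX : Smo X) (hY : Smo Y) (hreg : ∀ u t, t ≤ 0 → 0 < Dx X (u, t) ^ 2 + Dx Y (u, t) ^ 2)
    (u t : ℝ) (ht : t ≤ 0) : HasDerivAt (fun v => s0 X Y (v, t))
      (k0 X Y (u, t) * g0 X Y (u, t) * c0 X Y (u, t)) u := by
  have hg := g0_pos hreg u t ht
  have h1 := (hY.dx.hasx u t ht).fun_div (g0_u hX hY hreg u t ht) hg.ne'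
  refine h1.congr_deriv ?_
  have h2 := g0_sq hreg u t ht
  unfold k0 c0 gu0
  field_simp
  rw [h2]; ring

theorem k0_u (hX : Smo X) (hY : Smo Y) (hreg : ∀ u t, t ≤ 0 → 0 < Dx X (u, t) ^ 2 + Dx Y (u, t) ^ 2)
    (u t : ℝ) (ht : t ≤ 0) : ∃ d, HasDerivAt (fun v => k0 X Y (v, t)) d u := by
  have hg := g0_pos hreg u t ht
  exact ⟨_, (((hX.dx.hasx u t ht).fun_mul (hY.dx.dx.hasx u t ht)).fun_sub
    ((hY.dx.hasx u t ht).fun_mul (hX.dx.dx.hasx u t ht))).fun_div ((g0_u hX hY hreg u t ht).fun_pow 3)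
    (by positivity)⟩

theorem g0_t (hX : Smo X) (hY : Smo Y) (hreg : ∀ u t, t ≤ 0 → 0 < Dx X (u, t) ^ 2 + Dx Y (u, t) ^ 2)
    (hXt : ∀ u t, t ≤ 0 → Dt X (u, t) = -(k0 X Y (u, t) * s0 X Y (u, t)))
    (hYt : ∀ u t, t ≤ 0 → Dt Y (u, t) = k0 X Y (u, t) * c0 X Y (u, t))
    (u t : ℝ) (ht : t ≤ 0) : HasDerivWithinAt (fun r => g0 X Y (u, r))
      (-(k0 X Y (u, t) ^ 2 * g0 X Y (u, t))) (Iic 0) t := by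
  have hg := g0_pos hreg u t ht
  have h1 := (((hX.dx.hast u t ht).fun_pow 2).fun_add ((hY.dx.hast u t ht).fun_pow 2)).sqrt (hreg u t ht).ne'
  refine h1.congr_deriv ?_
  obtain ⟨d, hd⟩ := k0_u hX hY hreg u t ht
  have e1 : Dt (Dx X) (u, t) = -(d * s0 X Y (u, t) + k0 X Y (u, t) * (k0 X Y (u, t) * g0 X Y (u, t) * c0 X Y (u, t))) := by
    rw [hX.comm u t ht]
    refine (hX.dt.hasx u t ht).unique ?_
    have : (fun v => Dt X (v, t)) = fun v => -(k0 X Y (v, t) * s0 X Y (v, t)) := funext fun v => hXt v t ht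
    rw [this]
    exact (hd.fun_mul (s0_u hX hY hreg u t ht)).fun_neg
  have e2 : Dt (Dx Y) (u, t) = d * c0 X Y (u, t) + k0 X Y (u, t) * -(k0 X Y (u, t) * g0 X Y (u, t) * s0 X Y (u, t)) := by
    rw [hY.comm u t ht]
    refine (hY.dt.hasx u t ht).unique ?_
    have : (fun v => Dt Y (v, t)) = fun v => k0 X Y (v, t) * c0 X Y (v, t) := funext fun v => hYt v t ht
    rw [this]
    exact hd.fun_mul (c0_u hX hY hreg u t ht)
  have h2 := g0_sq hreg u t ht
  have e3 : √(Dx X (u, t) ^ 2 + Dx Y (u, t) ^ 2) = g0 X Y (u, t) := rfl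
  rw [e1, e2, e3]
  have ec : Dx X (u, t) = g0 X Y (u, t) * c0 X Y (u, t) := by unfold c0; field_simp
  have es : Dx Y (u, t) = g0 X Y (u, t) * s0 X Y (u, t) := by unfold s0; field_simp
  have hcs : c0 X Y (u, t) ^ 2 + s0 X Y (u, t) ^ 2 = 1 := by
    unfold c0 s0; field_simp; exact h2.symm
  rw [ec, es]
  rw [div_eq_iff (by positivity)]
  push_cast
  linear_combination (-2 * k0 X Y (u, t) ^ 2 * g0 X Y (u, t) ^ 2) * hcs

/-- the abstract flow data built from a smooth flow in coordinates -/
def mkFlow (hX : Smo X) (hY : Smo Y) (hreg : ∀ u t, t ≤ 0 → 0 < Dx X (u, t) ^ 2 + Dx Y (u, t) ^ 2)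
    (hXt : ∀ u t, t ≤ 0 → Dt X (u, t) = -(k0 X Y (u, t) * s0 X Y (u, t)))
    (hYt : ∀ u t, t ≤ 0 → Dt Y (u, t) = k0 X Y (u, t) * c0 X Y (u, t)) (M : ℝ)
    (hprop : ∀ t, t ≤ 0 → ∀ R : ℝ, ∃ U : ℝ, ∀ u, U ≤ |u| → R ≤ X (u, t) ^ 2 + Y (u, t) ^ 2)
    (hent : ∀ t, t ≤ 0 → ∀ l : ℝ, 0 < l → ∀ a b : ℝ, a ≤ b →
      ∫ u in a..b, Real.exp (-(X (u, t) ^ 2 + Y (u, t) ^ 2) / (4 * l)) * g0 X Y (u, t) ≤ M * √(4 * π * l)) :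
    CFlow where
  X u t := X (u, min t 0)
  Y u t := Y (u, min t 0)
  g u t := g0 X Y (u, min t 0)
  c u t := c0 X Y (u, min t 0)
  s u t := s0 X Y (u, min t 0)
  k u t := k0 X Y (u, min t 0)
  gu u t := gu0 X Y (u, min t 0)
  M := M
  contX := hX.cont
  contY := hY.cont
  contg := ((hX.dx.cont.pow 2).add (hY.dx.cont.pow 2)).sqrt
  contc := hX.dx.cont.div ((hX.dx.cont.pow 2).add (hY.dx.cont.pow 2)).sqrt
    fun p => (g0_pos hreg _ _ (min_le_right _ _)).ne'
  conts := hY.dx.cont.div ((hX.dx.cont.pow 2).add (hY.dx.cont.pow 2)).sqrt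
    fun p => (g0_pos hreg _ _ (min_le_right _ _)).ne'
  contk := ((hX.dx.cont.mul hY.dx.dx.cont).sub (hY.dx.cont.mul hX.dx.dx.cont)).div
    (((hX.dx.cont.pow 2).add (hY.dx.cont.pow 2)).sqrt.pow 3)
    fun p => pow_ne_zero 3 (g0_pos hreg _ _ (min_le_right _ _)).ne'
  contgu := ((hX.dx.cont.mul hX.dx.dx.cont).add (hY.dx.cont.mul hY.dx.dx.cont)).div
    (((hX.dx.cont.pow 2).add (hY.dx.cont.pow 2)).sqrt)
    fun p => (g0_pos hreg _ _ (min_le_right _ _)).ne'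
  gpos u t := g0_pos hreg _ _ (min_le_right _ _)
  cs u t := by
    have h := g0_pos hreg u _ (min_le_right t 0)
    have h2 := g0_sq hreg u _ (min_le_right t 0)
    unfold c0 s0; field_simp; exact h2.symm
  Xu u t := by
    have h := g0_pos hreg u _ (min_le_right t 0)
    refine (hX.hasx u _ (min_le_right t 0)).congr_deriv ?_
    unfold c0; field_simp
  Yu u t := by
    have h := g0_pos hreg u _ (min_le_right t 0)
    refine (hY.hasx u _ (min_le_right t 0)).congr_deriv ?_
    unfold s0; field_simp
  cu u t := c0_u hX hY hreg u _ (min_le_right t 0)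
  su u t := s0_u hX hY hreg u _ (min_le_right t 0)
  guu u t := g0_u hX hY hreg u _ (min_le_right t 0)
  Xt u t ht := by
    have h := hX.hast u t ht
    rw [hXt u t ht] at h
    rw [min_eq_left ht]
    refine h.congr (fun r hr => ?_) ?_
    · rw [min_eq_left hr]
    · rw [min_eq_left ht]
  Yt u t ht := by
    have h := hY.hast u t ht
    rw [hYt u t ht] at h
    rw [min_eq_left ht]
    refine h.congr (fun r hr => ?_) ?_
    · rw [min_eq_left hr]
    · rw [min_eq_left ht]
  gt u t ht := by
    have h := (g0_t hX hY hreg hXt hYt u t ht.le).hasDerivAt (Iic_mem_nhds ht)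
    rw [min_eq_left ht.le]
    refine h.congr_of_eventuallyEq ?_
    filter_upwards [Iic_mem_nhds ht] with r hr
    rw [min_eq_left hr]
  proper t ht R := by
    rw [min_eq_left ht]; exact hprop t ht R
  ent t ht l hl a b hab := by
    rw [min_eq_left ht]; exact hent t ht l hl a b hab
end

section Build
variable (γ : ℝ → ℝ → R2) (x₀ : R2)

def cX (p : ℝ × ℝ) : ℝ := γ p.1 p.2 0 - x₀ 0
def cY (p : ℝ × ℝ) : ℝ := γ p.1 p.2 1 - x₀ 1

theorem norm_sq_R2 (v : R2) : ‖v‖ ^ 2 = v 0 ^ 2 + v 1 ^ 2 := by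
  rw [EuclideanSpace.norm_sq_eq, Fin.sum_univ_two]
  simp

theorem cXY_sq (u t : ℝ) : cX γ x₀ (u, t) ^ 2 + cY γ x₀ (u, t) ^ 2 = ‖γ u t - x₀‖ ^ 2 := by
  rw [norm_sq_R2]; simp [cX, cY]

theorem hasDerivAt_coord (f : ℝ → R2) (u : ℝ) (h : DifferentiableAt ℝ f u) (i : Fin 2) :
    HasDerivAt (fun v => f v i) (deriv f u i) u :=
  (EuclideanSpace.proj i : R2 →L[ℝ] ℝ).hasFDerivAt.comp_hasDerivAt u h.hasDerivAt

theorem smoX (hcsf : IsCSF γ (Iic 0)) : Smo (cX γ x₀) := by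
  have h := (contDiffOn_euclidean.1 hcsf.smooth) 0
  exact h.sub contDiffOn_const

theorem smoY (hcsf : IsCSF γ (Iic 0)) : Smo (cY γ x₀) := by
  have h := (contDiffOn_euclidean.1 hcsf.smooth) 1
  exact h.sub contDiffOn_const

theorem diffu (γ : ℝ → ℝ → R2) (x₀ : R2) (hcsf : IsCSF γ (Iic 0)) (u t : ℝ) (ht : t ≤ 0) : DifferentiableAt ℝ (fun v => γ v t) u := by
  rw [differentiableAt_euclidean]
  intro i
  fin_cases i
  · have := ((smoX γ x₀ hcsf).hasx u t ht).add_const (x₀ 0)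
    refine this.differentiableAt.congr_of_eventuallyEq (Eventually.of_forall fun v => ?_)
    simp [cX]
  · have := ((smoY γ x₀ hcsf).hasx u t ht).add_const (x₀ 1)
    refine this.differentiableAt.congr_of_eventuallyEq (Eventually.of_forall fun v => ?_)
    simp [cY]

theorem dxX (hcsf : IsCSF γ (Iic 0)) (u t : ℝ) (ht : t ≤ 0) :
    deriv (fun v => γ v t) u 0 = Dx (cX γ x₀) (u, t) := by
  have h1 := (hasDerivAt_coord _ u (diffu γ x₀ hcsf u t ht) 0).sub_const (x₀ 0)
  exact h1.unique ((smoX γ x₀ hcsf).hasx u t ht)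

theorem dxY (hcsf : IsCSF γ (Iic 0)) (u t : ℝ) (ht : t ≤ 0) :
    deriv (fun v => γ v t) u 1 = Dx (cY γ x₀) (u, t) := by
  have h1 := (hasDerivAt_coord _ u (diffu γ x₀ hcsf u t ht) 1).sub_const (x₀ 1)
  exact h1.unique ((smoY γ x₀ hcsf).hasx u t ht)

theorem norm_deriv (hcsf : IsCSF γ (Iic 0)) (u t : ℝ) (ht : t ≤ 0) :
    ‖deriv (fun v => γ v t) u‖ = g0 (cX γ x₀) (cY γ x₀) (u, t) := by
  unfold g0
  rw [← dxX γ x₀ hcsf u t ht, ← dxY γ x₀ hcsf u t ht, ← norm_sq_R2, Real.sqrt_sq (norm_nonneg _)]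

theorem regXY (hcsf : IsCSF γ (Iic 0)) (u t : ℝ) (ht : t ≤ 0) :
    0 < Dx (cX γ x₀) (u, t) ^ 2 + Dx (cY γ x₀) (u, t) ^ 2 := by
  rw [← dxX γ x₀ hcsf u t ht, ← dxY γ x₀ hcsf u t ht, ← norm_sq_R2]
  have := norm_pos_iff.2 (hcsf.regular u t ht)
  positivity

theorem tangent0 (hcsf : IsCSF γ (Iic 0)) (t : ℝ) (ht : t ≤ 0) :
    (fun v => aderiv γ γ v t 0) = fun v => c0 (cX γ x₀) (cY γ x₀) (v, t) := by
  funext v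
  unfold aderiv c0
  rw [norm_deriv γ x₀ hcsf v t ht, PiLp.smul_apply, dxX γ x₀ hcsf v t ht, smul_eq_mul, div_eq_inv_mul]

theorem tangent1 (hcsf : IsCSF γ (Iic 0)) (t : ℝ) (ht : t ≤ 0) :
    (fun v => aderiv γ γ v t 1) = fun v => s0 (cX γ x₀) (cY γ x₀) (v, t) := by
  funext v
  unfold aderiv s0
  rw [norm_deriv γ x₀ hcsf v t ht, PiLp.smul_apply, dxY γ x₀ hcsf v t ht, smul_eq_mul, div_eq_inv_mul]

theorem difft (hcsf : IsCSF γ (Iic 0)) (u t : ℝ) (ht : t ≤ 0) :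
    DifferentiableWithinAt ℝ (fun r => γ u r) (Iic 0) t := by
  have h := hcsf.smooth.differentiableOn (by simp) (u, t) ⟨mem_univ _, ht⟩
  exact h.comp t (by fun_prop : DifferentiableWithinAt ℝ (fun r : ℝ => (u, r)) (Iic 0) t)
    (fun r hr => ⟨mem_univ _, hr⟩)

theorem dtc (hcsf : IsCSF γ (Iic 0)) (u t : ℝ) (ht : t ≤ 0) (i : Fin 2) :
    HasDerivWithinAt (fun r => γ u r i) (aderiv γ (aderiv γ γ) u t i) (Iic 0) t := by
  have h := (difft γ hcsf u t ht).hasDerivWithinAt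
  rw [hcsf.flow u t ht] at h
  exact (EuclideanSpace.proj i : R2 →L[ℝ] ℝ).hasFDerivAt.comp_hasDerivWithinAt t h

theorem diffT (γ : ℝ → ℝ → R2) (x₀ : R2) (hcsf : IsCSF γ (Iic 0)) (u t : ℝ) (ht : t ≤ 0) :
    DifferentiableAt ℝ (fun v => aderiv γ γ v t) u := by
  have hX := smoX γ x₀ hcsf
  have hY := smoY γ x₀ hcsf
  have hreg := regXY γ x₀ hcsf
  rw [differentiableAt_euclidean]
  intro i
  fin_cases i
  · have := (c0_u hX hY hreg u t ht).differentiableAt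
    rw [← tangent0 γ x₀ hcsf t ht] at this
    exact this
  · have := (s0_u hX hY hreg u t ht).differentiableAt
    rw [← tangent1 γ x₀ hcsf t ht] at this
    exact this

theorem dtX (hcsf : IsCSF γ (Iic 0)) (u t : ℝ) (ht : t ≤ 0) :
    Dt (cX γ x₀) (u, t) = -(k0 (cX γ x₀) (cY γ x₀) (u, t) * s0 (cX γ x₀) (cY γ x₀) (u, t)) := by
  have hX := smoX γ x₀ hcsf
  have hY := smoY γ x₀ hcsf
  have hreg := regXY γ x₀ hcsf
  have h1 := (dtc γ hcsf u t ht 0).sub_const (x₀ 0)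
  have h2 := (uniqueDiffOn_Iic (0 : ℝ) t ht).eq_deriv _ (hX.hast u t ht) h1
  rw [h2]
  have h3 := hasDerivAt_coord _ u (diffT γ x₀ hcsf u t ht) 0
  rw [tangent0 γ x₀ hcsf t ht] at h3
  have h4 := h3.unique (c0_u hX hY hreg u t ht)
  have hg := g0_pos hreg u t ht
  unfold aderiv at h4 ⊢
  rw [PiLp.smul_apply, h4, norm_deriv γ x₀ hcsf u t ht, smul_eq_mul]
  field_simp

theorem dtY (hcsf : IsCSF γ (Iic 0)) (u t : ℝ) (ht : t ≤ 0) :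
    Dt (cY γ x₀) (u, t) = k0 (cX γ x₀) (cY γ x₀) (u, t) * c0 (cX γ x₀) (cY γ x₀) (u, t) := by
  have hX := smoX γ x₀ hcsf
  have hY := smoY γ x₀ hcsf
  have hreg := regXY γ x₀ hcsf
  have h1 := (dtc γ hcsf u t ht 1).sub_const (x₀ 1)
  have h2 := (uniqueDiffOn_Iic (0 : ℝ) t ht).eq_deriv _ (hY.hast u t ht) h1
  rw [h2]
  have h3 := hasDerivAt_coord _ u (diffT γ x₀ hcsf u t ht) 1
  rw [tangent1 γ x₀ hcsf t ht] at h3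
  have h4 := h3.unique (s0_u hX hY hreg u t ht)
  have hg := g0_pos hreg u t ht
  unfold aderiv at h4 ⊢
  rw [PiLp.smul_apply, h4, norm_deriv γ x₀ hcsf u t ht, smul_eq_mul]
  field_simp

theorem prop_XY (hproper : ∀ t ∈ Iic (0:ℝ), IsProperMap fun u => γ u t) (t : ℝ) (ht : t ≤ 0) (R : ℝ) :
    ∃ U : ℝ, ∀ u, U ≤ |u| → R ≤ cX γ x₀ (u, t) ^ 2 + cY γ x₀ (u, t) ^ 2 := by
  have hc := (hproper t ht).isCompact_preimage (isCompact_closedBall x₀ (√R))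
  obtain ⟨U, hU⟩ := hc.isBounded.exists_norm_le
  refine ⟨U + 1, fun u hu => ?_⟩
  by_contra hlt
  push Not at hlt
  rw [cXY_sq] at hlt
  have hm : u ∈ (fun u => γ u t) ⁻¹' Metric.closedBall x₀ (√R) := by
    rw [mem_preimage, Metric.mem_closedBall, dist_eq_norm]
    exact Real.le_sqrt_of_sq_le hlt.le
  have := hU u hm
  rw [Real.norm_eq_abs] at this
  linarith

theorem ent_XY (hcsf : IsCSF γ (Iic 0)) (m : ℕ) (hEnt : entropyE γ (Iic 0) = (m : ℝ≥0∞)) (t : ℝ) (ht : t ≤ 0)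
    (l : ℝ) (hl : 0 < l) (a b : ℝ) (hab : a ≤ b) :
    ∫ u in a..b, Real.exp (-(cX γ x₀ (u, t) ^ 2 + cY γ x₀ (u, t) ^ 2) / (4 * l)) *
      g0 (cX γ x₀) (cY γ x₀) (u, t) ≤ (m : ℝ) * √(4 * π * l) := by
  have hX := smoX γ x₀ hcsf
  have hY := smoY γ x₀ hcsf
  have hreg := regXY γ x₀ hcsf
  set f : ℝ → ℝ := fun u => Real.exp (-(cX γ x₀ (u, t) ^ 2 + cY γ x₀ (u, t) ^ 2) / (4 * l)) *
      g0 (cX γ x₀) (cY γ x₀) (u, t) with hf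
  have hcX : Continuous fun u => cX γ x₀ (u, t) :=
    continuous_iff_continuousAt.2 fun u => (hX.hasx u t ht).continuousAt
  have hcY : Continuous fun u => cY γ x₀ (u, t) :=
    continuous_iff_continuousAt.2 fun u => (hY.hasx u t ht).continuousAt
  have hcg : Continuous fun u => g0 (cX γ x₀) (cY γ x₀) (u, t) :=
    continuous_iff_continuousAt.2 fun u => (g0_u hX hY hreg u t ht).continuousAt
  have hfc : Continuous f := by fun_prop
  have hf0 : ∀ u, 0 ≤ f u := fun u => by
    have := g0_pos hreg u t ht
    positivity
  have hs : 0 < √(4 * π * l) := Real.sqrt_pos.2 (by have := Real.pi_pos; positivity)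
  have h1 : gaussLenE γ x₀ l t ≤ m := by
    rw [← hEnt]
    unfold entropyE
    exact le_iSup₂_of_le t ht (le_iSup_of_le x₀ (le_iSup₂_of_le l hl le_rfl))
  unfold gaussLenE at h1
  have h2 : (fun u : ℝ => ENNReal.ofReal (Real.exp (-‖γ u t - x₀‖ ^ 2 / (4 * l)) * ‖deriv (fun v => γ v t) u‖)) =
      fun u => ENNReal.ofReal (f u) := by
    funext u
    rw [norm_deriv γ x₀ hcsf u t ht, ← cXY_sq]
  rw [h2, ← ENNReal.div_eq_inv_mul, ENNReal.div_le_iff (by simpa using hs) (by simp)] at h1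
  have h3 : ENNReal.ofReal (∫ u in a..b, f u) ≤ ENNReal.ofReal (m * √(4 * π * l)) := by
    rw [intervalIntegral.integral_of_le hab, ofReal_integral_eq_lintegral_ofReal
      ((hfc.intervalIntegrable a b).1) (Eventually.of_forall hf0)]
    refine (setLIntegral_le_lintegral _ _).trans (h1.trans ?_)
    rw [ENNReal.ofReal_mul (by positivity), ENNReal.ofReal_natCast]
  exact (ENNReal.ofReal_le_ofReal_iff (by positivity)).1 h3
end Build

/-- For an ancient complete non-compact embedded smooth curve shortening
flow with entropy a positive integer `m`, at each time the squared-distance function to any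
point `x₀` has at most `m` local minimum points and at most `m - 1` local maximum points. -/
theorem card_local_extrema_of_sq_dist_le
    (γ : ℝ → ℝ → R2) (m : ℕ) (hm : 0 < m)
    (hcsf : IsCSF γ (Iic 0))
    (hemb : ∀ t ∈ Iic (0:ℝ), Function.Injective fun u => γ u t)
    (hproper : ∀ t ∈ Iic (0:ℝ), IsProperMap fun u => γ u t)
    (hEnt : entropyE γ (Iic 0) = (m : ℝ≥0∞)) :
    ∀ x₀ : R2, ∀ t ∈ Iic (0:ℝ),
      ({u : ℝ | IsLocalMin (fun v => ‖γ v t - x₀‖ ^ 2) u}.Finite ∧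
        {u : ℝ | IsLocalMin (fun v => ‖γ v t - x₀‖ ^ 2) u}.ncard ≤ m) ∧
      ({u : ℝ | IsLocalMax (fun v => ‖γ v t - x₀‖ ^ 2) u}.Finite ∧
        {u : ℝ | IsLocalMax (fun v => ‖γ v t - x₀‖ ^ 2) u}.ncard ≤ m - 1) := by
  intro x₀ t ht
  let Γ : CFlow := mkFlow (smoX γ x₀ hcsf) (smoY γ x₀ hcsf) (regXY γ x₀ hcsf) (dtX γ x₀ hcsf)
    (dtY γ x₀ hcsf) (m : ℝ) (prop_XY γ x₀ hproper) (ent_XY γ x₀ hcsf m hEnt)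
  have hM : Γ.M = m := rfl
  have hq : (fun v => ‖γ v t - x₀‖ ^ 2) = fun v => Γ.q v t := by
    funext v
    have h0 : min t 0 = t := min_eq_left ht
    have h1 : Γ.q v t = cX γ x₀ (v, min t 0) ^ 2 + cY γ x₀ (v, min t 0) ^ 2 := rfl
    rw [h1, h0, cXY_sq]
  rw [hq]
  exact ⟨Γ.count_min m hM t ht, Γ.count_max m hm hM t ht⟩
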